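/- Let f_1,…,f_m ∈ 𝕂(X) be non-zero multiplicatively independent rational functions over a number field 𝕂. Then the set of α ∈ the algebraic closure of ℚ for which there exist two ℤ-linearly independent vectors (k_1,…,k_m), (ℓ_1,…,ℓ_m) ∈ ℤ^m with f_1(α)^{k_1}⋯f_m(α)^{k_m} = f_1(α)^{ℓ_1}⋯f_m(α)^{ℓ_m} = 1 is finite. -/

import Mathlib

/- PARTS -/

section partA
open NumberField Height Real

namespace MT

section places
variable {N : Type} [Field N] [NumberField N]

abbrev Pl (T : Finset (FinitePlace N)) : Type := (N →+* ℂ) ⊕ T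

noncomputable def pv (T : Finset (FinitePlace N)) : Pl T → AbsoluteValue N ℝ
  | .inl φ => NumberField.place φ
  | .inr v => v.1.val

@[simp] lemma pv_inl (T : Finset (FinitePlace N)) (φ : N →+* ℂ) (x : N) :
    pv T (.inl φ) x = ‖φ x‖ := rfl

@[simp] lemma pv_inr (T : Finset (FinitePlace N)) (v : T) (x : N) :
    pv T (.inr v) x = v.1 x := rfl

def GoodT (T : Finset (FinitePlace N)) (x : N) : Prop :=
  x ≠ 0 ∧ ∀ v : FinitePlace N, v ∉ T → v x = 1

lemma GoodT.mul {T : Finset (FinitePlace N)} {x y : N} (hx : GoodT T x) (hy : GoodT T y) :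
    GoodT T (x * y) :=
  ⟨mul_ne_zero hx.1 hy.1, fun v hv => by rw [map_mul, hx.2 v hv, hy.2 v hv, mul_one]⟩

lemma GoodT.inv {T : Finset (FinitePlace N)} {x : N} (hx : GoodT T x) : GoodT T x⁻¹ :=
  ⟨inv_ne_zero hx.1, fun v hv => by rw [map_inv₀, hx.2 v hv, inv_one]⟩

lemma GoodT.zpow {T : Finset (FinitePlace N)} {x : N} (hx : GoodT T x) (n : ℤ) :
    GoodT T (x ^ n) :=
  ⟨zpow_ne_zero _ hx.1, fun v hv => by rw [map_zpow₀, hx.2 v hv, one_zpow]⟩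

lemma GoodT.one {T : Finset (FinitePlace N)} : GoodT T (1 : N) :=
  ⟨one_ne_zero, fun v _ => map_one v⟩

lemma GoodT.prod {T : Finset (FinitePlace N)} {ι : Type} (s : Finset ι) (x : ι → N)
    (h : ∀ i ∈ s, GoodT T (x i)) : GoodT T (∏ i ∈ s, x i) := by
  classical
  induction s using Finset.induction_on with
  | empty => simpa using GoodT.one
  | insert a s ha ih =>
    rw [Finset.prod_insert ha]
    exact (h a (by simp)).mul (ih fun i hi => h i (by simp [hi]))

lemma exists_goodT (X : Finset N) (hX : ∀ x ∈ X, x ≠ 0) :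
    ∃ T : Finset (FinitePlace N), ∀ x ∈ X, GoodT T x := by
  classical
  induction X using Finset.induction_on with
  | empty => exact ⟨∅, by simp⟩
  | insert a s ha ih =>
    obtain ⟨T, hT⟩ := ih fun x hx => hX x (by simp [hx])
    have hfin := FinitePlace.hasFiniteMulSupport (hX a (by simp))
    refine ⟨T ∪ hfin.toFinset, fun x hx => ?_⟩
    rw [Finset.mem_insert] at hx
    rcases hx with rfl | hx
    · refine ⟨hX _ (by simp), fun v hv => ?_⟩
      by_contra h
      exact hv (Finset.mem_union_right _ (hfin.mem_toFinset.2 h))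
    · exact ⟨(hT x hx).1, fun v hv => (hT x hx).2 v fun h => hv (Finset.mem_union_left _ h)⟩

lemma sum_emb_eq (g : InfinitePlace N → ℝ) :
    ∑ φ : N →+* ℂ, g (InfinitePlace.mk φ) = ∑ v : InfinitePlace N, v.mult * g v := by
  classical
  rw [← Finset.sum_fiberwise (s := Finset.univ) (g := fun φ : N →+* ℂ => InfinitePlace.mk φ)]
  refine Finset.sum_congr rfl fun v _ => ?_
  rw [Finset.sum_congr rfl (g := fun _ => g v), Finset.sum_const,
    InfinitePlace.card_filter_mk_eq, nsmul_eq_mul]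
  intro φ hφ
  simp at hφ
  rw [hφ]

lemma pl_sum_log {T : Finset (FinitePlace N)} {x : N} (hx : GoodT T x) :
    ∑ w : Pl T, log (pv T w x) = 0 := by
  rw [Fintype.sum_sum_type]
  simp only [pv_inl, pv_inr]
  have h1 := sum_emb_eq (N := N) (fun v => log (v x))
  simp only [InfinitePlace.apply] at h1
  rw [h1]
  have h2 := prod_abs_eq_one (K := N) hx.1
  have h3 : ∏ᶠ w : FinitePlace N, w x = ∏ w ∈ T, w x :=
    finprod_eq_prod_of_mulSupport_subset _ (by
      intro v hv
      by_contra h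
      exact hv (hx.2 v h))
  rw [h3] at h2
  have h4 := congrArg Real.log h2
  rw [Real.log_mul, Real.log_one, Real.log_prod, Real.log_prod] at h4
  · rw [← h4]
    congr 1
    · refine Finset.sum_congr rfl fun v _ => ?_
      rw [Real.log_pow]
    · exact (Finset.sum_coe_sort T (fun v => log (v x)))
  · intro v _; exact (FinitePlace.pos_iff.2 hx.1).ne'
  · intro v _; exact (pow_pos (InfinitePlace.pos_iff.2 hx.1) _).ne'
  · exact Finset.prod_ne_zero_iff.2 fun v _ => (pow_pos (InfinitePlace.pos_iff.2 hx.1) _).ne'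
  · exact Finset.prod_ne_zero_iff.2 fun v _ => (FinitePlace.pos_iff.2 hx.1).ne'

lemma pl_sum_posLog {T : Finset (FinitePlace N)} {x : N} (hx : GoodT T x) :
    ∑ w : Pl T, log⁺ (pv T w x) = logHeight₁ x := by
  rw [Fintype.sum_sum_type, NumberField.logHeight₁_eq]
  simp only [pv_inl, pv_inr]
  have h1 := sum_emb_eq (N := N) (fun v => log⁺ (v x))
  simp only [InfinitePlace.apply] at h1
  rw [h1]
  congr 1
  rw [finsum_eq_sum_of_support_subset (s := T)]
  · exact (Finset.sum_coe_sort T (fun v => log⁺ (v x)))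
  · intro v hv
    by_contra h
    exact hv (by simp [hx.2 v h])

lemma pl_sum_abs_log {T : Finset (FinitePlace N)} {x : N} (hx : GoodT T x) :
    ∑ w : Pl T, |log (pv T w x)| = 2 * logHeight₁ x := by
  have h1 := pl_sum_log hx
  have h2 := pl_sum_posLog hx
  have : ∀ w : Pl T, |log (pv T w x)| = 2 * log⁺ (pv T w x) - log (pv T w x) := by
    intro w
    rw [Real.posLog]
    rcases le_total 0 (log (pv T w x)) with h | h
    · rw [abs_of_nonneg h, max_eq_right h]; ring
    · rw [abs_of_nonpos h, max_eq_left h]; ring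
  rw [Finset.sum_congr rfl fun w _ => this w, Finset.sum_sub_distrib, ← Finset.mul_sum, h1, h2]
  ring

lemma pv_inr_integral_le {T : Finset (FinitePlace N)} (v : T) {x : N} (hx : IsIntegral ℤ x) :
    pv T (.inr v) x ≤ 1 := by
  rw [pv_inr, ← FinitePlace.norm_embedding_eq]
  exact FinitePlace.norm_le_one N v.1.maximalIdeal (⟨x, hx⟩ : 𝓞 N)

lemma pv_inr_add_le {T : Finset (FinitePlace N)} (v : T) (x y : N) :
    pv T (.inr v) (x + y) ≤ max (pv T (.inr v) x) (pv T (.inr v) y) := 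
  FinitePlace.add_le v.1 x y

lemma card_emb : Fintype.card (N →+* ℂ) = Module.finrank ℚ N :=
  NumberField.Embeddings.card N ℂ

end places

section invariance
variable {N M : Type} [Field N] [NumberField N] [Field M] [NumberField M] [Algebra N M]

lemma sum_emb_ext (g : (N →+* ℂ) → ℝ) :
    ∑ ψ : M →+* ℂ, g (ψ.comp (algebraMap N M)) = Module.finrank N M * ∑ φ : N →+* ℂ, g φ := by
  classical
  have : IsScalarTower ℚ N M := by infer_instance
  have : FiniteDimensional N M := FiniteDimensional.right ℚ N M
  rw [← Finset.sum_fiberwise (s := Finset.univ) 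
    (g := fun ψ : M →+* ℂ => ψ.comp (algebraMap N M)), Finset.mul_sum]
  refine Finset.sum_congr rfl fun φ _ => ?_
  rw [Finset.sum_congr rfl (g := fun _ => g φ), Finset.sum_const, nsmul_eq_mul]
  · congr 2
    let _ := φ.toAlgebra
    rw [← AlgHom.card N M ℂ, ← Finset.card_univ]
    refine Finset.card_bij' (fun ψ h => ({ ψ with
        commutes' := fun r => congrArg (fun f : N →+* ℂ => f r) (Finset.mem_filter.1 h).2 } :
          M →ₐ[N] ℂ)) (fun ψ _ => ψ.toRingHom) ?_ ?_ ?_ ?_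
    · intros; simp
    · intro ψ _
      refine Finset.mem_filter.2 ⟨Finset.mem_univ _, ?_⟩
      ext r
      exact ψ.commutes r
    · intros; rfl
    · intros; rfl
  · intro ψ hψ
    simp at hψ
    rw [hψ]

lemma logHeight_formula (n : ℕ) (hn : n ≠ 0) (a : 𝓞 N) (x : N) (hx : n * x = a) :
    logHeight₁ x = ∑ φ : N →+* ℂ, log (max ‖φ a‖ n) 
      - log (Ideal.absNorm (Ideal.span {a, (n : 𝓞 N)})) := by
  have hn' : (n : N) ≠ 0 := by exact_mod_cast hn
  have hn0 : (0:ℝ) < n := by positivity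
  have hxx : x = a / n := by rw [← hx]; field_simp
  rw [logHeight₁_eq_log_mulHeight₁, hxx, mulHeight₁_div_eq_mulHeight, NumberField.mulHeight_eq (by simp [hn])]
  have h1 := absNorm_mul_finprod_finitePlace_eq_one (K := N) (x := ![a, (n : 𝓞 N)]) (by simp [hn])
  have hv (i : Fin 2) : (![a, n] i : N) = ![(a : N), n] i := by fin_cases i <;> rfl
  simp only [hv] at h1
  have h2 : Set.range ![a, (n : 𝓞 N)] = {a, (n : 𝓞 N)} := by simp [Set.pair_comm]
  rw [h2] at h1
  set A := (Ideal.absNorm (Ideal.span {a, (n : 𝓞 N)}) : ℝ)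
  set B := ∏ᶠ (v : FinitePlace N), ⨆ i, v (![(a : N), n] i)
  have hB : B = A⁻¹ := eq_inv_of_mul_eq_one_right h1
  have hA : A ≠ 0 := fun h => by simp [h] at h1
  have hsup (v : InfinitePlace N) : ⨆ i, v (![(a : N), n] i) = max (v a) n := by
    apply le_antisymm
    · refine ciSup_le fun i => ?_
      fin_cases i <;> simp
    · refine max_le ?_ ?_
      · exact Finite.le_ciSup_of_le 0 (by simp)
      · exact Finite.le_ciSup_of_le 1 (by simp)
  have hpos (v : InfinitePlace N) : 0 < max (v a) n := lt_max_of_lt_right hn0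
  simp only [hsup]
  rw [hB, Real.log_mul (Finset.prod_ne_zero_iff.2 fun v _ => (pow_pos (hpos v) _).ne') (inv_ne_zero hA), Real.log_inv, Real.log_prod (fun v _ => (pow_pos (hpos v) _).ne')]
  have h3 := sum_emb_eq (N := N) (fun v => log (max (v a) n))
  simp only [InfinitePlace.apply] at h3
  rw [h3]
  simp only [Real.log_pow]
  ring

lemma logHeight_ext (x : N) :
    logHeight₁ (algebraMap N M x) = Module.finrank N M * logHeight₁ x := by
  have : FiniteDimensional N M := FiniteDimensional.right ℚ N M
  obtain ⟨n, hn, a, ha, -⟩ := exists_nat_ne_zero_exists_integer_mul_eq_and_absNorm_span_eq_pow x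
  rw [logHeight_formula n hn a x ha, logHeight_formula n hn (algebraMap (𝓞 N) (𝓞 M) a) (algebraMap N M x)
    (by
      have := congrArg (algebraMap N M) ha
      rw [map_mul, map_natCast] at this
      rw [this]; rfl)]
  have h1 : Ideal.span {algebraMap (𝓞 N) (𝓞 M) a, (n : 𝓞 M)} = 
      (Ideal.span {a, (n : 𝓞 N)}).map (algebraMap (𝓞 N) (𝓞 M)) := by
    rw [Ideal.map_span, Set.image_pair, map_natCast]
  rw [h1, Ideal.absNorm_algebraMap]
  have h2 : Module.finrank (𝓞 N) (𝓞 M) = Module.finrank N M := by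
    exact (IsFractionRing.finrank_eq (𝓞 N) N (𝓞 M) M).symm
  rw [h2]
  push_cast
  rw [Real.log_pow, mul_sub, ← sum_emb_ext]
  rfl
end invariance
end MT
end partA

section partB
open NumberField Height Real

namespace MT

lemma totient_bound_aux (n : ℕ) : 0 < n → (n % 2 = 1 → n ≤ n.totient ^ 2) ∧ n ≤ 2 * n.totient ^ 2 := by
  induction n using Nat.recOnPosPrimePosCoprime with
  | prime_pow p k hp hk =>
    intro _
    rw [Nat.totient_prime_pow hp hk]
    obtain ⟨j, rfl⟩ : ∃ j, k = j + 1 := ⟨k - 1, by omega⟩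
    simp only [Nat.add_sub_cancel]
    have hpj : 1 ≤ p ^ j := Nat.one_le_pow _ _ hp.pos
    obtain ⟨r, rfl⟩ : ∃ r, p = r + 2 := ⟨p - 2, by have := hp.two_le; omega⟩
    have e : r + 2 - 1 = r + 1 := by omega
    rw [e, pow_succ]
    set q := (r + 2) ^ j
    by_cases hr : r = 0
    · subst hr
      constructor
      · intro h; omega
      · simp; nlinarith
    · have hr1 : 1 ≤ r := by omega
      have h1 : q * (r + 2) ≤ (q * (r + 1)) ^ 2 := by
        have : r + 2 ≤ (r+1)^2 := by nlinarith
        calc q * (r + 2) ≤ q * (r+1)^2 := by gcongr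
          _ ≤ (q * q) * (r+1)^2 := by gcongr; nlinarith
          _ = _ := by ring
      exact ⟨fun _ => h1, by omega⟩
  | zero => intro h; omega
  | one => intro _; simp
  | coprime a b ha hb hab iha ihb =>
    intro _
    rw [Nat.totient_mul hab]
    obtain ⟨a1, a2⟩ := iha (by omega)
    obtain ⟨b1, b2⟩ := ihb (by omega)
    constructor
    · intro h
      have h' : a % 2 = 1 ∧ b % 2 = 1 := by
        have := Nat.odd_iff.2 h
        rw [Nat.odd_mul] at this
        exact ⟨Nat.odd_iff.1 this.1, Nat.odd_iff.1 this.2⟩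
      rw [mul_pow]
      exact Nat.mul_le_mul (a1 h'.1) (b1 h'.2)
    · have : a % 2 = 1 ∨ b % 2 = 1 := by
        by_contra h
        push Not at h
        have h2 : 2 ∣ Nat.gcd a b := Nat.dvd_gcd (by omega) (by omega)
        rw [hab] at h2
        omega
      rcases this with h | h
      · calc a * b ≤ a.totient ^ 2 * (2 * b.totient ^ 2) := Nat.mul_le_mul (a1 h) b2
          _ = _ := by ring
      · calc a * b ≤ (2 * a.totient ^ 2) * (b.totient ^ 2) := Nat.mul_le_mul a2 (b1 h)
          _ = _ := by ring

section
variable {N : Type} [Field N] [NumberField N]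

lemma root_of_unity_order {x : N} {n : ℕ} (hn : 0 < n) (hx : x ^ n = 1) :
    ∃ k : ℕ, 0 < k ∧ k ≤ 2 * Module.finrank ℚ N ^ 2 ∧ x ^ k = 1 := by
  have h0 : 0 < orderOf x := orderOf_pos_iff.2 (isOfFinOrder_iff_pow_eq_one.2 ⟨n, hn, hx⟩)
  refine ⟨orderOf x, h0, ?_, pow_orderOf_eq_one x⟩
  have h1 := (IsPrimitiveRoot.orderOf x).totient_le_degree_minpoly
  have hint : IsIntegral ℤ x := (IsPrimitiveRoot.orderOf x).isIntegral h0
  have h2 : (minpoly ℤ x).natDegree ≤ Module.finrank ℚ N := by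
    have := minpoly.natDegree_le (A := ℚ) x
    rw [minpoly.isIntegrallyClosed_eq_field_fractions' ℚ hint] at this
    rwa [(minpoly.monic hint).natDegree_map] at this
  have := (totient_bound_aux (orderOf x) h0).2
  refine this.trans ?_
  gcongr
  exact h1.trans h2

lemma trace_pow_congr (x : 𝓞 N) (p : ℕ) (hp : p.Prime) :
    (p : ℤ) ∣ Algebra.trace ℤ (𝓞 N) (x ^ p) - Algebra.trace ℤ (𝓞 N) x := by
  classical
  have : Fact p.Prime := ⟨hp⟩
  rw [← ZMod.intCast_zmod_eq_zero_iff_dvd] 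
  push_cast
  let b := RingOfIntegers.basis N
  rw [Algebra.trace_eq_matrix_trace b, Algebra.trace_eq_matrix_trace b, map_pow]
  set A := Algebra.leftMulMatrix b x
  have key : ∀ B : Matrix (Module.Free.ChooseBasisIndex ℤ (𝓞 N)) (Module.Free.ChooseBasisIndex ℤ (𝓞 N)) ℤ, ((B.trace : ℤ) : ZMod p) = (B.map (Int.castRingHom (ZMod p))).trace := by
    intro B; simp [Matrix.trace]
  rw [key, key]
  have : (A ^ p).map (Int.castRingHom (ZMod p)) = (A.map (Int.castRingHom (ZMod p))) ^ p := by
    exact map_pow (Int.castRingHom (ZMod p)).mapMatrix A p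
  rw [this, ZMod.trace_pow_card, ZMod.pow_card, sub_self]

lemma trace_emb (x : 𝓞 N) : ((Algebra.trace ℤ (𝓞 N) x : ℤ) : ℂ) = ∑ φ : N →+* ℂ, φ x := by
  have h := trace_eq_sum_embeddings (K := ℚ) (L := N) ℂ (x := (x : N))
  rw [← Algebra.coe_trace_int] at h
  have h2 : ((Algebra.trace ℤ (𝓞 N) x : ℤ) : ℂ) = ∑ φ : N →ₐ[ℚ] ℂ, φ x := by
    rw [← h]; simp
  rw [h2]
  exact Fintype.sum_equiv (RingHom.equivRatAlgHom (R := N) (S := ℂ)).symm _ _ (fun φ => rfl)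

lemma powersum_lemma {ι : Type} [Fintype ι] (y : ι → ℂ) (p : ℕ)
    (h : ∀ k < 2 * Fintype.card ι, ∑ i, (y i ^ p) ^ k = ∑ i, y i ^ k) (i : ι) :
    ∃ j, y j = y i ^ p := by
  classical
  by_contra hcon
  push Not at hcon
  let S : Finset ℂ := Finset.univ.image y ∪ Finset.univ.image (fun i => y i ^ p)
  have hS : S.card ≤ 2 * Fintype.card ι := by
    refine (Finset.card_union_le _ _).trans ?_
    have := Finset.card_image_le (s := Finset.univ) (f := y)
    have := Finset.card_image_le (s := Finset.univ) (f := fun i => y i ^ p)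
    simp only [Finset.card_univ] at *
    omega
  let c : ℂ → ℂ := fun z => ((Finset.univ.filter fun i => y i ^ p = z).card : ℂ) - (Finset.univ.filter fun i => y i = z).card
  let e := S.equivFin
  have hz : (fun j : Fin S.card => c (e.symm j)) = 0 := by
    refine Matrix.eq_zero_of_forall_pow_sum_mul_pow_eq_zero (f := fun j => ((e.symm j : S) : ℂ)) ?_ ?_
    · exact Subtype.val_injective.comp e.symm.injective
    · intro k
      have hk := h k (lt_of_lt_of_le k.2 hS)
      have e1 : ∀ u : ι → ℂ, (∀ i, u i ∈ S) → ∑ i, u i ^ (k : ℕ) = ∑ z ∈ S, ((Finset.univ.filter fun i => u i = z).card : ℂ) * z ^ (k : ℕ) := by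
        intro u hu
        rw [← Finset.sum_fiberwise_of_maps_to (s := Finset.univ) (t := S) (g := u) (fun i _ => hu i)]
        refine Finset.sum_congr rfl fun z _ => ?_
        rw [Finset.sum_congr rfl (g := fun _ => z ^ (k:ℕ)), Finset.sum_const, nsmul_eq_mul]
        intro i hi
        rw [(Finset.mem_filter.1 hi).2]
      rw [e1 (fun i => y i ^ p) (fun i => by simp [S]), e1 y (fun i => by simp [S]), ← sub_eq_zero,
        ← Finset.sum_sub_distrib] at hk
      rw [← hk, ← Finset.sum_coe_sort S, ← e.symm.sum_comp]
      refine Finset.sum_congr rfl fun j _ => ?_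
      simp only [c]; ring
  have hi : y i ^ p ∈ S := by simp [S]
  have h1 := congrFun hz (e ⟨_, hi⟩)
  simp only [Equiv.symm_apply_apply, c, Pi.zero_apply] at h1
  have h2 : (Finset.univ.filter fun j => y j = y i ^ p) = ∅ := by
    ext j; simp [hcon j]
  rw [h2, Finset.card_empty, Nat.cast_zero, sub_zero, Nat.cast_eq_zero, Finset.card_eq_zero] at h1
  have : i ∈ (∅ : Finset ι) := by rw [← h1]; simp
  simp at this

/-- Weak Dobrowolski-type lower bound. -/
lemma height_lower_int (x : 𝓞 N) (hx : x ≠ 0)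
    (hH : logHeight₁ (x : N) ≤ 1 / (24 * (Module.finrank ℚ N : ℝ) ^ 2)) :
    ∃ n : ℕ, 0 < n ∧ (x : N) ^ n = 1 := by
  set d := Module.finrank ℚ N with hd
  have hd0 : 0 < d := Module.finrank_pos
  have hd1 : (1:ℝ) ≤ d := by exact_mod_cast hd0
  have hx' : (x : N) ≠ 0 := by simpa using hx
  set H := logHeight₁ (x : N)
  have hH0 : 0 ≤ H := zero_le_logHeight₁ _
  obtain ⟨T, hT⟩ := exists_goodT ({(x : N)} : Finset N) (by simpa using hx)
  have hT := hT x (by simp)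
  have hemb : ∀ φ : N →+* ℂ, ‖φ x‖ ≤ exp H := by
    intro φ
    have h1 : log⁺ (pv T (.inl φ) x) ≤ H := by
      refine le_trans ?_ (pl_sum_posLog hT).le
      exact Finset.single_le_sum (f := fun w => log⁺ (pv T w x)) (fun w _ => Real.posLog_nonneg) (Finset.mem_univ _)
    have hpos : 0 < ‖φ x‖ := by simpa using hx
    rw [← Real.log_le_iff_le_exp hpos]
    exact (le_max_right _ _).trans h1
  obtain ⟨p, hp, hp1, hp2⟩ := Nat.exists_prime_lt_and_le_two_mul (6 * d) (by omega)
  have hpr : (6 * d : ℝ) < p := by exact_mod_cast hp1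
  have hpr2 : (p : ℝ) ≤ 12 * d := by
    have : (p : ℝ) ≤ (2 * (6 * d) : ℕ) := by exact_mod_cast hp2
    push_cast at this; linarith
  have hs : ∀ k < 2 * d, ∑ φ : N →+* ℂ, ((φ x) ^ p) ^ k = ∑ φ : N →+* ℂ, (φ x) ^ k := by
    intro k hk
    have hkr : (k : ℝ) ≤ 2 * d := by exact_mod_cast hk.le
    have hbd : ∀ j ≤ k * p, ‖∑ φ : N →+* ℂ, (φ x) ^ j‖ ≤ d * exp 1 := by
      intro j hj
      refine (norm_sum_le _ _).trans ?_
      have : ∀ φ ∈ (Finset.univ : Finset (N →+* ℂ)), ‖(φ x) ^ j‖ ≤ exp 1 := by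
        intro φ _
        rw [norm_pow]
        calc ‖φ x‖ ^ j ≤ (exp H) ^ j := by gcongr; exact hemb φ
          _ = exp (j * H) := by rw [← Real.exp_nat_mul]
          _ ≤ exp 1 := by
            apply Real.exp_le_exp.2
            have hj' : (j : ℝ) ≤ k * p := by exact_mod_cast hj
            calc (j:ℝ) * H ≤ (2 * d * (12 * d)) * H := by
                  gcongr
                  exact hj'.trans (by gcongr)
              _ ≤ (2 * d * (12 * d)) * (1 / (24 * (d : ℝ) ^ 2)) := by gcongr
              _ = 1 := by field_simp; ring
      refine (Finset.sum_le_card_nsmul _ _ _ this).trans ?_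
      rw [Finset.card_univ, card_emb, nsmul_eq_mul]
    have e1 : ∑ φ : N →+* ℂ, ((φ x) ^ p) ^ k = ((Algebra.trace ℤ (𝓞 N) ((x ^ k) ^ p) : ℤ) : ℂ) := by
      rw [trace_emb]
      refine Finset.sum_congr rfl fun φ _ => ?_
      push_cast
      rw [map_pow, map_pow, ← pow_mul, ← pow_mul, mul_comm]
    have e2 : ∑ φ : N →+* ℂ, (φ x) ^ k = ((Algebra.trace ℤ (𝓞 N) (x ^ k) : ℤ) : ℂ) := by
      rw [trace_emb]
      refine Finset.sum_congr rfl fun φ _ => ?_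
      push_cast
      rw [map_pow]
    have h1 := trace_pow_congr (x ^ k) p hp
    have h2 := hbd (k * p) le_rfl
    have h3 := hbd k (Nat.le_mul_of_pos_right _ hp.pos)
    have e3 : ∑ φ : N →+* ℂ, (φ x) ^ (k * p) = ∑ φ : N →+* ℂ, ((φ x) ^ p) ^ k := by
      refine Finset.sum_congr rfl fun φ _ => ?_
      rw [← pow_mul, mul_comm]
    rw [e3] at h2
    rw [e1] at h2 ⊢
    rw [e2] at h3 ⊢
    set a := Algebra.trace ℤ (𝓞 N) ((x ^ k) ^ p)
    set b := Algebra.trace ℤ (𝓞 N) (x ^ k)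
    have hab : a - b = 0 := by
      refine Int.eq_zero_of_abs_lt_dvd h1 ?_
      rw [Complex.norm_intCast] at h2 h3
      have : (|a - b| : ℝ) < p := by
        have h5 := abs_sub (a:ℝ) b
        have := Real.exp_one_lt_d9
        nlinarith
      exact_mod_cast this
    have : a = b := by omega
    rw [this]
  rw [← card_emb] at hd
  rw [hd] at hs
  have hcl := powersum_lemma (fun φ : N →+* ℂ => φ x) p hs
  have φ₀ : N →+* ℂ := Classical.arbitrary _
  have hcl2 : ∀ n : ℕ, ∃ ψ : N →+* ℂ, ψ x = φ₀ x ^ (p ^ n) := by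
    intro n
    induction n with
    | zero => exact ⟨φ₀, by simp⟩
    | succ n ih =>
      obtain ⟨ψ, hψ⟩ := ih
      obtain ⟨ψ', hψ'⟩ := hcl ψ
      exact ⟨ψ', by rw [hψ', hψ, ← pow_mul, pow_succ]⟩
  choose ψ hψ using hcl2
  obtain ⟨a, b, hab, he⟩ := Finite.exists_ne_map_eq_of_infinite ψ
  wlog hlt : a < b generalizing a b
  · exact this b a hab.symm he.symm (by omega)
  have e1 : φ₀ ((x : N) ^ (p ^ a)) = φ₀ ((x : N) ^ (p ^ b)) := by
    rw [map_pow, map_pow, ← hψ, ← hψ, he]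
  have e2 := φ₀.injective e1
  have hpp : p ^ a < p ^ b := Nat.pow_lt_pow_right hp.one_lt hlt
  refine ⟨p ^ b - p ^ a, by omega, ?_⟩
  have : (x : N) ^ (p ^ a) * (x : N) ^ (p ^ b - p ^ a) = (x : N) ^ (p ^ a) * 1 := by
    rw [← pow_add, mul_one, e2]; congr 1; omega
  exact mul_left_cancel₀ (pow_ne_zero _ hx') this

lemma height_lower (x : N) (hx : x ≠ 0)
    (hH : logHeight₁ (x : N) ≤ 1 / (24 * (Module.finrank ℚ N : ℝ) ^ 2)) :
    ∃ n : ℕ, 0 < n ∧ n ≤ 2 * Module.finrank ℚ N ^ 2 ∧ (x : N) ^ n = 1 := by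
  obtain ⟨n, hn, hn1, hn2⟩ := exists_nat_le_mulHeight₁ x
  have hd1 : (1:ℝ) ≤ Module.finrank ℚ N := by exact_mod_cast (Module.finrank_pos (R := ℚ) (M := N))
  have h1 : logHeight₁ x < log 2 := by
    refine hH.trans_lt ?_
    have : (1:ℝ) / (24 * (Module.finrank ℚ N : ℝ) ^ 2) ≤ 1/24 := by
      apply one_div_le_one_div_of_le (by norm_num)
      nlinarith
    have := Real.log_two_gt_d9
    linarith
  rw [logHeight₁_eq_log_mulHeight₁] at h1
  have h2 : mulHeight₁ x < 2 := (Real.log_lt_log_iff (mulHeight₁_pos x) (by norm_num)).1 h1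
  have h3 : (n : ℝ) < 2 := by linarith
  have h4 : n < 2 := by exact_mod_cast h3
  have h5 : n = 1 := by omega
  subst h5
  simp at hn2
  obtain ⟨k, hk, hk1⟩ := height_lower_int (⟨x, hn2⟩ : 𝓞 N) (fun h => hx (congrArg (algebraMap (𝓞 N) N) h)) hH
  exact root_of_unity_order hk hk1
end
end MT
end partB

section partC
open NumberField Height Real
open scoped IntermediateField

namespace MT

variable {Qb : Type} [Field Qb] [CharZero Qb] [Algebra.IsAlgebraic ℚ Qb]

instance instNFadj (x : Qb) : NumberField ℚ⟮x⟯ :=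
  have : FiniteDimensional ℚ ℚ⟮x⟯ :=
    IntermediateField.adjoin.finiteDimensional (Algebra.IsAlgebraic.isAlgebraic x).isIntegral
  {}

/-- absolute logarithmic height -/
noncomputable def ht (x : Qb) : ℝ :=
  logHeight₁ (IntermediateField.AdjoinSimple.gen ℚ x) / Module.finrank ℚ ℚ⟮x⟯

lemma ht_nonneg (x : Qb) : 0 ≤ ht x :=
  div_nonneg (zero_le_logHeight₁ _) (Nat.cast_nonneg _)

lemma ht_eq {N : Type} [Field N] [NumberField N] (φ : N →+* Qb) (x : N) :
    logHeight₁ x = Module.finrank ℚ N * ht (φ x) := by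
  have hint : IsIntegral ℚ (φ x) := (Algebra.IsAlgebraic.isAlgebraic _).isIntegral
  let pb := IntermediateField.adjoin.powerBasis hint
  have hgen : pb.gen = IntermediateField.AdjoinSimple.gen ℚ (φ x) :=
    IntermediateField.adjoin.powerBasis_gen hint
  let φ' : N →ₐ[ℚ] Qb := φ.toRatAlgHom
  let g : ℚ⟮φ x⟯ →ₐ[ℚ] N := pb.lift x (by
    rw [hgen, IntermediateField.minpoly_gen ℚ (φ x)]
    have := minpoly.algHom_eq φ' φ.injective x
    rw [show φ x = φ' x from rfl, this]
    exact minpoly.aeval ℚ x)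
  let _ : Algebra ℚ⟮φ x⟯ N := g.toRingHom.toAlgebra
  have hx : algebraMap ℚ⟮φ x⟯ N (IntermediateField.AdjoinSimple.gen ℚ (φ x)) = x := by
    rw [← hgen]; exact pb.lift_gen _ _
  have h := logHeight_ext (N := ℚ⟮φ x⟯) (M := N) (IntermediateField.AdjoinSimple.gen ℚ (φ x))
  rw [hx] at h
  have hm : Module.finrank ℚ ℚ⟮φ x⟯ * Module.finrank ℚ⟮φ x⟯ N = Module.finrank ℚ N :=
    Module.finrank_mul_finrank _ _ _
  have h0 : (Module.finrank ℚ ℚ⟮φ x⟯ : ℝ) ≠ 0 := by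
    exact_mod_cast (Module.finrank_pos (R := ℚ) (M := ℚ⟮φ x⟯)).ne'
  rw [h, ht, ← hm]
  push_cast
  field_simp

variable (Qb) in
open Polynomial in
lemma northcott_Qb (D : ℕ) (C : ℝ) :
    {x : Qb | Module.finrank ℚ ℚ⟮x⟯ ≤ D ∧ ht x ≤ C}.Finite := by
  classical
  set B : ℝ := exp (D * |C|) with hB
  have hB1 : 1 ≤ B := by rw [hB]; exact Real.one_le_exp (by positivity)
  obtain ⟨Cn, hCn⟩ : ∃ Cn : ℤ, (B * B) ^ D * 2 ^ D ≤ Cn := ⟨_, Int.le_ceil _⟩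
  have hfin := bUnion_roots_finite (algebraMap ℤ Qb) D (Set.finite_Icc (-Cn) Cn)
  have hfin2 : (⋃ n ∈ Finset.Icc 1 ⌊B⌋₊, (fun y : Qb => y / (n : Qb)) '' 
      (⋃ (f : ℤ[X]) (_ : f.natDegree ≤ D ∧ ∀ i, f.coeff i ∈ Set.Icc (-Cn) Cn), 
        ((f.map (algebraMap ℤ Qb)).roots.toFinset : Set Qb))).Finite := by
    refine Set.Finite.biUnion (Finset.finite_toSet _) fun n _ => Set.Finite.image _ hfin
  refine hfin2.subset fun x ⟨hxD, hxC⟩ => ?_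
  set g := IntermediateField.AdjoinSimple.gen ℚ x
  have hg : algebraMap ℚ⟮x⟯ Qb g = x := IntermediateField.AdjoinSimple.algebraMap_gen ℚ x
  have hht : logHeight₁ g ≤ D * |C| := by
    have h0 : (Module.finrank ℚ ℚ⟮x⟯ : ℝ) > 0 := by
      exact_mod_cast (Module.finrank_pos (R := ℚ) (M := ℚ⟮x⟯))
    have : logHeight₁ g = Module.finrank ℚ ℚ⟮x⟯ * ht x := by rw [ht]; field_simp; rfl
    rw [this]
    calc (Module.finrank ℚ ℚ⟮x⟯ : ℝ) * ht x ≤ Module.finrank ℚ ℚ⟮x⟯ * |C| := by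
          gcongr; exact hxC.trans (le_abs_self C)
      _ ≤ D * |C| := by gcongr
  have hmul : mulHeight₁ g ≤ B := by
    rw [hB, ← Real.log_le_iff_le_exp (mulHeight₁_pos g), ← logHeight₁_eq_log_mulHeight₁]
    exact hht
  obtain ⟨n, hn, hn1, hn2⟩ := exists_nat_le_mulHeight₁ g
  have hnB : (n : ℝ) ≤ B := hn1.trans hmul
  refine Set.mem_biUnion (x := n) (by 
    simp only [Finset.coe_Icc, Set.mem_Icc]
    exact ⟨by omega, Nat.le_floor hnB⟩) ?_
  refine ⟨n * x, ?_, by field_simp⟩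
  have hemb : ∀ φ : ℚ⟮x⟯ →+* ℂ, ‖φ (n * g)‖ ≤ B * B := by
    intro φ
    rw [map_mul, norm_mul, map_natCast]
    simp only [Complex.norm_natCast]
    refine mul_le_mul hnB ?_ (norm_nonneg _) (by positivity)
    by_cases hg0 : g = 0
    · rw [hg0]; simp; positivity
    obtain ⟨T, hT⟩ := exists_goodT ({g} : Finset ℚ⟮x⟯) (by simpa using hg0)
    have hT := hT g (by simp)
    have h1 : log⁺ (pv T (.inl φ) g) ≤ D * |C| := by
      refine le_trans ?_ ((pl_sum_posLog hT).le.trans hht)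
      exact Finset.single_le_sum (f := fun w => log⁺ (pv T w g)) (fun w _ => Real.posLog_nonneg) (Finset.mem_univ _)
    have hpos : 0 < ‖φ g‖ := by simpa using hg0
    rw [← Real.log_le_iff_le_exp hpos]
    exact (le_max_right _ _).trans h1
  have hco := fun i => Embeddings.coeff_bdd_of_norm_le (A := ℂ) hemb i
  have hmn := minpoly.isIntegrallyClosed_eq_field_fractions' ℚ hn2
  have hdeg : (minpoly ℤ ((n : ℚ⟮x⟯) * g)).natDegree ≤ D := by
    have := minpoly.natDegree_le (A := ℚ) ((n : ℚ⟮x⟯) * g)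
    rw [hmn, (minpoly.monic hn2).natDegree_map] at this
    exact this.trans hxD
  refine Set.mem_iUnion₂.2 ⟨minpoly ℤ ((n : ℚ⟮x⟯) * g), ⟨hdeg, fun i => ?_⟩, ?_⟩
  · have h1 := hco i
    rw [hmn, coeff_map, eq_intCast, Int.norm_cast_rat, Int.norm_eq_abs] at h1
    rw [Set.mem_Icc, ← abs_le]
    have h2 : (|(minpoly ℤ ((n : ℚ⟮x⟯) * g)).coeff i| : ℝ) ≤ (B * B) ^ D * 2 ^ D := by
      refine h1.trans ?_
      have hBB : 1 ≤ B * B := by nlinarith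
      rw [max_eq_left hBB]
      have h3 : (Module.finrank ℚ ℚ⟮x⟯).choose (Module.finrank ℚ ℚ⟮x⟯ / 2) ≤ 2 ^ D :=
        (Nat.choose_le_two_pow _ _).trans (Nat.pow_le_pow_right (by norm_num) hxD)
      have h3' : ((Module.finrank ℚ ℚ⟮x⟯).choose (Module.finrank ℚ ℚ⟮x⟯ / 2) : ℝ) ≤ 2 ^ D := by
        exact_mod_cast h3
      gcongr
    have h4 := h2.trans hCn
    exact_mod_cast h4
  · simp only [Finset.mem_coe, Multiset.mem_toFinset]
    rw [mem_roots (by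
      rw [Ne, Polynomial.map_eq_zero_iff (RingHom.injective_int _)]
      exact minpoly.ne_zero hn2), IsRoot.def, eval_map_algebraMap]
    have := minpoly.aeval ℤ ((n : ℚ⟮x⟯) * g)
    have h2 := congrArg (algebraMap ℚ⟮x⟯ Qb) this
    rw [map_zero, ← aeval_algebraMap_apply, map_mul, hg, map_natCast] at h2
    exact h2

lemma dirichlet {ι : Type} [Fintype ι] (x : ι → ℝ) (Q : ℕ) (hQ : 0 < Q) :
    ∃ q : ℕ, 1 ≤ q ∧ q ≤ Q ^ Fintype.card ι ∧ ∃ p : ι → ℤ, ∀ i, |q * x i - p i| ≤ 1 / Q := by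
  classical
  have hQr : (0:ℝ) < Q := by exact_mod_cast hQ
  let f : Fin (Q ^ Fintype.card ι + 1) → (ι → Fin Q) := fun q i =>
    ⟨⌊Q * Int.fract ((q : ℕ) * x i)⌋₊, by
      rw [Nat.floor_lt (by positivity)]
      nlinarith [Int.fract_lt_one ((q : ℕ) * x i)]⟩
  obtain ⟨a, b, hab, hf⟩ := Fintype.exists_ne_map_eq_of_card_lt f (by simp)
  wlog hlt : a < b generalizing a b
  · exact this b a hab.symm hf.symm (lt_of_le_of_ne (not_lt.1 hlt) hab.symm)
  have hlt' : (a : ℕ) < b := hlt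
  refine ⟨b - a, by omega, by have := b.2; omega, fun i => ⌊(b : ℕ) * x i⌋ - ⌊(a : ℕ) * x i⌋, fun i => ?_⟩
  have h1 : ⌊Q * Int.fract ((a : ℕ) * x i)⌋₊ = ⌊Q * Int.fract ((b : ℕ) * x i)⌋₊ := by
    have := congrFun hf i
    simpa [f] using this
  have ha := Nat.floor_le (a := Q * Int.fract ((a : ℕ) * x i)) (by positivity)
  have hb := Nat.floor_le (a := Q * Int.fract ((b : ℕ) * x i)) (by positivity)
  have ha' := Nat.lt_floor_add_one (Q * Int.fract ((a : ℕ) * x i))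
  have hb' := Nat.lt_floor_add_one (Q * Int.fract ((b : ℕ) * x i))
  rw [h1] at ha ha'
  have e : (((b : ℕ) - (a : ℕ) : ℕ) : ℝ) * x i - ((⌊(b : ℕ) * x i⌋ - ⌊(a : ℕ) * x i⌋ : ℤ) : ℝ) =
      Int.fract ((b : ℕ) * x i) - Int.fract ((a : ℕ) * x i) := by
    rw [Nat.cast_sub hlt'.le, Int.fract, Int.fract]; push_cast; ring
  rw [e, le_div_iff₀ hQr]
  have e2 : (Q : ℝ) = |(Q : ℝ)| := (abs_of_pos hQr).symm
  rw [e2]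
  rw [← abs_mul, abs_le]
  constructor <;> nlinarith

end MT
end partC

section partD
set_option linter.unusedSectionVars false
open NumberField Height Real

namespace MT

lemma log_abv_prod_zpow {N : Type} [Field N] (v : AbsoluteValue N ℝ) {ι : Type} [Fintype ι]
    (x : ι → N) (hx : ∀ i, x i ≠ 0) (k : ι → ℤ) :
    log (v (∏ i, x i ^ k i)) = ∑ i, k i * log (v (x i)) := by
  rw [map_prod, Real.log_prod (fun i _ => v.ne_zero (zpow_ne_zero _ (hx i)))]
  refine Finset.sum_congr rfl fun i _ => ?_
  rw [map_zpow₀, Real.log_zpow]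

lemma lemmaS {K : Type} [Field K] [NumberField K] {ι : Type} [Fintype ι] (c : ι → K)
    (hc : ∀ i, c i ≠ 0) (hind : ∀ a : ι → ℤ, ∏ i, c i ^ a i = 1 → a = 0) :
    ∃ c0 : ℝ, 0 < c0 ∧ ∀ (N : Type) [Field N] [NumberField N] [Algebra K N]
      (T : Finset (FinitePlace N)) (_ : ∀ i, GoodT T (algebraMap K N (c i))) (A : ι → ℝ) (l : ι),
      c0 * Module.finrank ℚ N * |A l| ≤
        ∑ w : Pl T, |∑ i, A i * log (pv T w (algebraMap K N (c i)))| := by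
  classical
  set dK : ℝ := (Module.finrank ℚ K : ℝ) with hdK
  have hdK0 : 0 < dK := by rw [hdK]; exact_mod_cast (Module.finrank_pos (R := ℚ) (M := K))
  set μ : ℝ := 1 / (24 * dK ^ 2) with hμ
  have hμ0 : 0 < μ := by positivity
  have hlow : ∀ a : ι → ℤ, a ≠ 0 → μ ≤ logHeight₁ (∏ i, c i ^ a i) := by
    intro a ha
    by_contra h
    push Not at h
    obtain ⟨n, hn, -, hn1⟩ := height_lower _ (Finset.prod_ne_zero_iff.2 fun i _ => zpow_ne_zero _ (hc i)) h.le
    rw [← Finset.prod_pow] at hn1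
    have := hind (fun i => a i * n) (by
      rw [← hn1]
      refine Finset.prod_congr rfl fun i _ => ?_
      rw [zpow_mul, zpow_natCast])
    apply ha
    ext i
    have h2 := congrFun this i
    simp only [Pi.zero_apply, mul_eq_zero, Nat.cast_eq_zero] at h2
    rcases h2 with h2 | h2
    · exact h2
    · omega
  set S : ℝ := ∑ i, logHeight₁ (c i) with hS
  have hS0 : 0 ≤ S := Finset.sum_nonneg fun i _ => zero_le_logHeight₁ _
  obtain ⟨Q, hQ⟩ := exists_nat_ge (max 2 (S / (μ / 2)))
  have hQ2 : (2:ℝ) ≤ Q := (le_max_left _ _).trans hQ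
  have hQS : S / Q ≤ μ / 2 := by
    rw [div_le_iff₀ (by linarith)]
    have := (le_max_right _ _).trans hQ
    rw [div_le_iff₀ (by positivity)] at this
    linarith
  have hQ0 : 0 < Q := by
    have : (0:ℝ) < Q := by linarith
    exact_mod_cast this
  set q0 : ℝ := (Q : ℝ) ^ Fintype.card ι with hq0
  have hq00 : 0 < q0 := by positivity
  refine ⟨μ / (q0 * dK), by positivity, ?_⟩
  intro N _ _ _ T hT A l
  have hdim : (Module.finrank ℚ N : ℝ) = dK * Module.finrank K N := by
    rw [hdK]; exact_mod_cast (Module.finrank_mul_finrank ℚ K N).symm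
  set r : ℝ := (Module.finrank K N : ℝ) with hr
  have hr0 : 0 ≤ r := Nat.cast_nonneg _
  obtain ⟨m, -, hm⟩ := Finset.exists_max_image (Finset.univ : Finset ι) (fun i => |A i|) ⟨l, Finset.mem_univ _⟩
  have hml := hm l (Finset.mem_univ _)
  by_cases hAm : A m = 0
  · rw [hAm] at hml
    have : |A l| = 0 := le_antisymm (by simpa using hml) (abs_nonneg _)
    rw [this, mul_zero]
    exact Finset.sum_nonneg fun w _ => abs_nonneg _
  have hAm' : 0 < |A m| := abs_pos.2 hAm
  obtain ⟨q, hq1, hq2, p, hp⟩ := dirichlet (fun i => A i / |A m|) Q hQ0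
  have hp0 : p ≠ 0 := by
    intro h
    have h1 := hp m
    rw [h] at h1
    simp only [Pi.zero_apply, Int.cast_zero, sub_zero, abs_mul, abs_div, abs_abs, div_self hAm'.ne', mul_one, Nat.abs_cast] at h1
    have h2 : (1:ℝ) ≤ q := by exact_mod_cast hq1
    have h3 : (1:ℝ)/Q < 1 := by rw [div_lt_one (by linarith)]; linarith
    linarith
  have hh := hlow p hp0
  set L : Pl T → ι → ℝ := fun w i => log (pv T w (algebraMap K N (c i))) with hL
  have e1 : ∑ w : Pl T, |∑ i, p i * L w i| = 2 * (r * logHeight₁ (∏ i, c i ^ p i)) := by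
    rw [← logHeight_ext, map_prod]
    simp only [map_zpow₀]
    rw [← pl_sum_abs_log (GoodT.prod Finset.univ _ fun i _ => (hT i).zpow (p i))]
    refine Finset.sum_congr rfl fun w _ => ?_
    rw [log_abv_prod_zpow _ _ (fun i => (hT i).1)]
  have e2 : ∀ i, ∑ w : Pl T, |L w i| = 2 * (r * logHeight₁ (c i)) := by
    intro i
    rw [← logHeight_ext, ← pl_sum_abs_log (hT i)]
  set S0 := ∑ w : Pl T, |∑ i, A i * L w i| with hS0
  have e3 : ∀ w, |∑ i, p i * L w i| ≤ (q / |A m|) * |∑ i, A i * L w i| + ∑ i, (1 / Q) * |L w i| := by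
    intro w
    have : ∑ i, p i * L w i = (q / |A m|) * ∑ i, A i * L w i - ∑ i, (q * (A i / |A m|) - p i) * L w i := by
      rw [Finset.mul_sum, ← Finset.sum_sub_distrib]
      refine Finset.sum_congr rfl fun i _ => ?_
      field_simp; ring
    rw [this]
    refine (abs_sub _ _).trans ?_
    rw [abs_mul, abs_of_nonneg (show (0:ℝ) ≤ q / |A m| by positivity)]
    gcongr
    refine (Finset.abs_sum_le_sum_abs _ _).trans ?_
    refine Finset.sum_le_sum fun i _ => ?_
    rw [abs_mul]
    exact mul_le_mul_of_nonneg_right (hp i) (abs_nonneg _)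
  have e4 : 2 * (r * logHeight₁ (∏ i, c i ^ p i)) ≤ (q / |A m|) * S0 + (1 / Q) * (2 * (r * S)) := by
    rw [← e1]
    refine (Finset.sum_le_sum fun w _ => e3 w).trans ?_
    rw [Finset.sum_add_distrib, ← Finset.mul_sum, Finset.sum_comm]
    simp only [← Finset.mul_sum]
    simp only [e2]
    rw [← Finset.mul_sum, ← Finset.mul_sum]
  have e5 : 2 * (r * μ) ≤ (q / |A m|) * S0 + r * μ := by
    calc 2 * (r * μ) ≤ 2 * (r * logHeight₁ (∏ i, c i ^ p i)) := by gcongr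
      _ ≤ (q / |A m|) * S0 + (1 / Q) * (2 * (r * S)) := e4
      _ = (q / |A m|) * S0 + 2 * r * (S / Q) := by ring
      _ ≤ (q / |A m|) * S0 + 2 * r * (μ / 2) := by gcongr
      _ = _ := by ring
  have hSg : 0 ≤ S0 := Finset.sum_nonneg fun w _ => abs_nonneg _
  have hqq : (q : ℝ) ≤ q0 := by rw [hq0]; exact_mod_cast hq2
  have e6 : r * μ * |A m| ≤ q0 * S0 := by
    have : r * μ ≤ q * S0 / |A m| := by
      have : (q / |A m|) * S0 = q * S0 / |A m| := by ring
      linarith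
    rw [le_div_iff₀ hAm'] at this
    exact this.trans (by gcongr)
  calc μ / (q0 * dK) * Module.finrank ℚ N * |A l| ≤ μ / (q0 * dK) * (dK * r) * |A m| := by
        rw [hdim]; gcongr
    _ = (r * μ * |A m|) / q0 := by field_simp
    _ ≤ q0 * S0 / q0 := by gcongr
    _ = S0 := by field_simp

section smallrel
variable {E : Type} [Field E] [NumberField E] {J L : Type} [Fintype J] [Fintype L]

def IsRel (x : J → E) (c : L → E) (β : J → ℤ) (a : L → ℤ) : Prop :=
  (∏ j, x j ^ β j) * (∏ l, c l ^ a l) = 1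

lemma IsRel.comb {x : J → E} {c : L → E} (hx : ∀ j, x j ≠ 0) (hc : ∀ l, c l ≠ 0)
    {β β' : J → ℤ} {a a' : L → ℤ} (h : IsRel x c β a) (h' : IsRel x c β' a') (m n : ℤ) :
    IsRel x c (fun j => m * β j + n * β' j) (fun l => m * a l + n * a' l) := by
  unfold IsRel at *
  have e1 : ∏ j, x j ^ (m * β j + n * β' j) = (∏ j, x j ^ β j) ^ m * (∏ j, x j ^ β' j) ^ n := by
    rw [← Finset.prod_zpow, ← Finset.prod_zpow, ← Finset.prod_mul_distrib]
    refine Finset.prod_congr rfl fun j _ => ?_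
    rw [zpow_add₀ (hx j), mul_comm m, mul_comm n, zpow_mul, zpow_mul]
  have e2 : ∏ l, c l ^ (m * a l + n * a' l) = (∏ l, c l ^ a l) ^ m * (∏ l, c l ^ a' l) ^ n := by
    rw [← Finset.prod_zpow, ← Finset.prod_zpow, ← Finset.prod_mul_distrib]
    refine Finset.prod_congr rfl fun j _ => ?_
    rw [zpow_add₀ (hc j), mul_comm m, mul_comm n, zpow_mul, zpow_mul]
  rw [e1, e2]
  calc _ = ((∏ j, x j ^ β j) * (∏ l, c l ^ a l)) ^ m * ((∏ j, x j ^ β' j) * (∏ l, c l ^ a' l)) ^ n := by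
        rw [mul_zpow, mul_zpow]; ring
    _ = 1 := by rw [h, h', one_zpow, one_zpow, one_mul]

lemma logHeight_prod_zpow {ι : Type} [Fintype ι] (x : ι → E) (k : ι → ℤ) :
    logHeight₁ (∏ i, x i ^ k i) ≤ ∑ i, |(k i : ℝ)| * logHeight₁ (x i) := by
  refine (logHeight₁_prod_le _ _).trans ?_
  refine Finset.sum_le_sum fun i _ => ?_
  rw [logHeight₁_zpow, Nat.cast_natAbs, Int.cast_abs]

lemma smallrel1 {x : J → E} {c : L → E} (hx : ∀ j, x j ≠ 0) (hc : ∀ l, c l ≠ 0)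
    (Q : ℕ) (hQ2 : 2 ≤ Q)
    (hQ : 24 * (Module.finrank ℚ E : ℝ) ^ 2 * (∑ j, logHeight₁ (x j) + ∑ l, logHeight₁ (c l)) ≤ Q)
    {β : J → ℤ} {a : L → ℤ} (h : IsRel x c β a) (j0 : J) (hj0 : β j0 ≠ 0)
    (hmax : ∀ j, |β j| ≤ |β j0|) :
    ∃ (β' : J → ℤ) (a' : L → ℤ), IsRel x c β' a' ∧ β' j0 ≠ 0 ∧ (∀ j, β j = 0 → β' j = 0) ∧
      ∀ j, |(β' j : ℝ)| ≤ 4 * (Module.finrank ℚ E : ℝ) ^ 2 * (Q : ℝ) ^ (Fintype.card J + Fintype.card L) := by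
  have hb0 : (0:ℝ) < |(β j0 : ℝ)| := by positivity
  have hbne : (β j0 : ℝ) ≠ 0 := by exact_mod_cast hj0
  have hQr : (2:ℝ) ≤ Q := by exact_mod_cast hQ2
  have hQ1 : (1:ℝ) / Q < 1 := by rw [div_lt_one (by linarith)]; linarith
  set d : ℝ := (Module.finrank ℚ E : ℝ) with hdd
  have hd : 0 < d := by rw [hdd]; exact_mod_cast (Module.finrank_pos (R := ℚ) (M := E))
  let z : J ⊕ L → E := Sum.elim x c
  let k : J ⊕ L → ℤ := Sum.elim β a
  have hz : ∀ i, z i ≠ 0 := by rintro (j | l); exacts [hx j, hc l]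
  have hk : ∏ i, z i ^ k i = 1 := by rw [Fintype.prod_sum_type]; exact h
  obtain ⟨q, hq1, hq2, p, hp⟩ := dirichlet (fun i => (k i : ℝ) / β j0) Q (by omega)
  rw [Fintype.card_sum] at hq2
  have hqr : (1:ℝ) ≤ q := by exact_mod_cast hq1
  have hint : ∀ n : ℤ, |(n : ℝ)| ≤ 1 / Q → n = 0 := by
    intro n hn
    have : |(n:ℝ)| < 1 := by linarith
    have h2 : |n| < 1 := by exact_mod_cast this
    rwa [Int.abs_lt_one_iff] at h2
  set y := ∏ i, z i ^ p i with hy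
  have hy0 : y ≠ 0 := Finset.prod_ne_zero_iff.2 fun i _ => zpow_ne_zero _ (hz i)
  have hyp : y ^ (β j0) = ∏ i, z i ^ (β j0 * p i - q * k i) := by
    have : ∏ i, z i ^ (β j0 * p i - q * k i) = (∏ i, z i ^ p i) ^ (β j0) / (∏ i, z i ^ k i) ^ (q : ℤ) := by
      rw [← Finset.prod_zpow, ← Finset.prod_zpow, ← Finset.prod_div_distrib]
      refine Finset.prod_congr rfl fun i _ => ?_
      rw [zpow_sub₀ (hz i), mul_comm (β j0), mul_comm (q : ℤ), zpow_mul, zpow_mul]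
    rw [this, hk, one_zpow, div_one]
  have hhy : |(β j0 : ℝ)| * logHeight₁ y ≤ |(β j0 : ℝ)| * ((1 / Q) * ∑ i, logHeight₁ (z i)) := by
    have e1 : |(β j0 : ℝ)| * logHeight₁ y = logHeight₁ (y ^ (β j0)) := by
      rw [logHeight₁_zpow, Nat.cast_natAbs, Int.cast_abs]
    rw [e1, hyp]
    refine (logHeight_prod_zpow _ _).trans ?_
    rw [← mul_assoc, Finset.mul_sum]
    refine Finset.sum_le_sum fun i _ => ?_
    refine mul_le_mul_of_nonneg_right ?_ (zero_le_logHeight₁ _)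
    have e2 : ((β j0 * p i - q * k i : ℤ) : ℝ) = - (β j0 * (q * ((k i : ℝ) / β j0) - p i)) := by
      push_cast; field_simp; ring
    rw [e2, abs_neg, abs_mul]
    gcongr
    exact hp i
  have hhy2 : logHeight₁ y ≤ 1 / (24 * d ^ 2) := by
    have h1 := le_of_mul_le_mul_left hhy hb0
    refine h1.trans ?_
    rw [Fintype.sum_sum_type]
    simp only [z, Sum.elim_inl, Sum.elim_inr]
    rw [div_mul_eq_mul_div, one_mul, div_le_div_iff₀ (by linarith) (by positivity)]
    linarith
  obtain ⟨n, hn0, hn1, hn2⟩ := height_lower y hy0 hhy2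
  have hnr : (n : ℝ) ≤ 2 * d ^ 2 := by rw [hdd]; exact_mod_cast hn1
  refine ⟨fun j => p (.inl j) * n, fun l => p (.inr l) * n, ?_, ?_, ?_, ?_⟩
  · unfold IsRel
    rw [← hn2, hy, ← Finset.prod_pow, Fintype.prod_sum_type]
    simp only [z, Sum.elim_inl, Sum.elim_inr, zpow_mul, zpow_natCast]
  · have h1 := hp (.inl j0)
    simp only [k, Sum.elim_inl, div_self hbne, mul_one] at h1
    have h2 := hint (q - p (.inl j0)) (by push_cast; exact h1)
    have : p (.inl j0) ≠ 0 := by omega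
    exact mul_ne_zero this (by omega)
  · intro j hj
    have h1 := hp (.inl j)
    simp only [k, Sum.elim_inl, hj, Int.cast_zero, zero_div, mul_zero, zero_sub, abs_neg] at h1
    show p (.inl j) * (n : ℤ) = 0
    rw [hint _ h1, zero_mul]
  · intro j
    have h1 := hp (.inl j)
    simp only [k, Sum.elim_inl] at h1
    have h2 : |(β j : ℝ) / β j0| ≤ 1 := by
      rw [abs_div, div_le_one hb0]; exact_mod_cast hmax j
    have h3 : |(p (.inl j) : ℝ)| ≤ q * |(β j : ℝ) / β j0| + 1 := by
      have := abs_sub_abs_le_abs_sub ((p (.inl j) : ℝ)) (q * ((β j : ℝ) / β j0))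
      rw [abs_sub_comm, abs_mul, Nat.abs_cast] at this
      linarith
    have hq2r : (q : ℝ) ≤ (Q : ℝ) ^ (Fintype.card J + Fintype.card L) := by exact_mod_cast hq2
    have h4 : |(p (.inl j) : ℝ)| ≤ 2 * (Q : ℝ) ^ (Fintype.card J + Fintype.card L) := by
      have : (q : ℝ) * |(β j : ℝ) / β j0| ≤ q := by nlinarith
      linarith
    push_cast
    rw [abs_mul, Nat.abs_cast]
    calc |(p (.inl j) : ℝ)| * n ≤ (2 * (Q : ℝ) ^ (Fintype.card J + Fintype.card L)) * (2 * d ^ 2) := by gcongr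
      _ = _ := by ring

def NonProp (β β' : J → ℤ) : Prop := ∃ i j, β i * β' j - β j * β' i ≠ 0

lemma smallrel2 {x : J → E} {c : L → E} (hx : ∀ j, x j ≠ 0) (hc : ∀ l, c l ≠ 0)
    (Q : ℕ) (hQ2 : 2 ≤ Q)
    (hQ : 24 * (Module.finrank ℚ E : ℝ) ^ 2 * (∑ j, logHeight₁ (x j) + ∑ l, logHeight₁ (c l)) ≤ Q)
    {β β' : J → ℤ} {a a' : L → ℤ} (h : IsRel x c β a) (h' : IsRel x c β' a') (hnp : NonProp β β') :
    ∃ (γ γ' : J → ℤ) (b b' : L → ℤ), IsRel x c γ b ∧ IsRel x c γ' b' ∧ NonProp γ γ' ∧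
      (∀ j, |(γ j : ℝ)| ≤ 4 * (Module.finrank ℚ E : ℝ) ^ 2 * (Q : ℝ) ^ (Fintype.card J + Fintype.card L)) ∧
      (∀ j, |(γ' j : ℝ)| ≤ 4 * (Module.finrank ℚ E : ℝ) ^ 2 * (Q : ℝ) ^ (Fintype.card J + Fintype.card L)) := by
  obtain ⟨i0, j0, hij⟩ := hnp
  obtain ⟨j1, -, hj1⟩ := Finset.exists_max_image (Finset.univ : Finset J) (fun j => |β j|) ⟨i0, Finset.mem_univ _⟩
  have hj1' : ∀ j, |β j| ≤ |β j1| := fun j => hj1 j (Finset.mem_univ _)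
  have hb1 : β j1 ≠ 0 := by
    intro h0
    have : ∀ j, β j = 0 := fun j => by have := hj1' j; rw [h0] at this; simpa using this
    rw [this, this] at hij
    simp at hij
  obtain ⟨γ, b, hγ, hγ1, -, hγ3⟩ := smallrel1 hx hc Q hQ2 hQ h j1 hb1 hj1'
  have hl := IsRel.comb hx hc h h' (-β' j1) (β j1)
  set lb := fun j => -β' j1 * β j + β j1 * β' j with hlb
  obtain ⟨j2, -, hj2⟩ := Finset.exists_max_image (Finset.univ : Finset J) (fun j => |lb j|) ⟨i0, Finset.mem_univ _⟩
  have hj2' : ∀ j, |lb j| ≤ |lb j2| := fun j => hj2 j (Finset.mem_univ _)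
  have hb2 : lb j2 ≠ 0 := by
    intro h0
    have h1 : ∀ j, lb j = 0 := fun j => by have := hj2' j; rw [h0] at this; simpa using this
    apply hij
    have h2 := h1 i0
    have h3 := h1 j0
    simp only [hlb] at h2 h3
    apply mul_left_cancel₀ hb1
    linear_combination β i0 * h3 - β j0 * h2
  obtain ⟨γ', b', hγ', hγ1', hγ2', hγ3'⟩ := smallrel1 hx hc Q hQ2 hQ hl j2 hb2 hj2'
  refine ⟨γ, γ', b, b', hγ, hγ', ⟨j1, j2, ?_⟩, hγ3, hγ3'⟩
  rw [hγ2' j1 (by simp only [hlb]; ring), mul_zero, sub_zero]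
  exact mul_ne_zero hγ1 hγ1'
end smallrel
end MT
end partD

section partE1
open Filter Topology Complex

namespace MT

lemma factor_zeros (Z : Finset ℂ) (U : Set ℂ) (hU : IsOpen U) (hZ : ∀ z ∈ Z, z ∈ U) (f : ℂ → ℂ)
    (hf : DifferentiableOn ℂ f U) (h0 : ∀ z ∈ Z, f z = 0) :
    ∃ g : ℂ → ℂ, DifferentiableOn ℂ g U ∧ ∀ z, f z = (∏ a ∈ Z, (z - a)) * g z := by
  classical
  induction Z using Finset.induction_on generalizing f with
  | empty => exact ⟨f, hf, by simp⟩
  | insert a s ha ih =>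
    have h1 : DifferentiableOn ℂ (dslope f a) U :=
      (Complex.differentiableOn_dslope (hU.mem_nhds (hZ a (by simp)))).2 hf
    have h2 : ∀ z, f z = (z - a) * dslope f a z := by
      intro z
      have := sub_smul_dslope f a z
      rw [h0 a (by simp), sub_zero, smul_eq_mul] at this
      exact this.symm
    obtain ⟨g, hg, hg2⟩ := ih (fun z hz => hZ z (by simp [hz])) (dslope f a) h1 (by
      intro z hz
      have h3 := h2 z
      rw [h0 z (by simp [hz])] at h3
      rcases mul_eq_zero.1 h3.symm with h | h
      · exact absurd (sub_eq_zero.1 h ▸ hz) ha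
      · exact h)
    refine ⟨g, hg, fun z => ?_⟩
    rw [h2, hg2, Finset.prod_insert ha]; ring

/-- Schwarz lemma with several zeros. -/
lemma schwarz (Z : Finset ℂ) (f : ℂ → ℂ) (R r ρ ρ' B : ℝ) (hρ : 0 ≤ ρ) (hρr : ρ < r) (hrR : r < R)
    (hρ' : 0 ≤ ρ') (hρ'r : ρ' ≤ r)
    (hf : DifferentiableOn ℂ f (Metric.ball 0 R)) (hB : ∀ z, ‖z‖ ≤ r → ‖f z‖ ≤ B)
    (hZ : ∀ z ∈ Z, ‖z‖ ≤ ρ) (h0 : ∀ z ∈ Z, f z = 0) (z : ℂ) (hz : ‖z‖ ≤ ρ') :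
    ‖f z‖ ≤ B * ((ρ' + ρ) / (r - ρ)) ^ Z.card := by
  have hr : 0 < r := by linarith
  obtain ⟨g, hg, hfg⟩ := factor_zeros Z (Metric.ball 0 R) Metric.isOpen_ball
    (fun z hz => by simpa using (hZ z hz).trans_lt (by linarith)) f hf h0
  have hB0 : 0 ≤ B := (norm_nonneg _).trans (hB 0 (by simpa using hr.le))
  have hgb : ∀ u ∈ Metric.sphere (0:ℂ) r, ‖g u‖ ≤ B / (r - ρ) ^ Z.card := by
    intro u hu
    have hu' : ‖u‖ = r := by simpa using hu
    rw [le_div_iff₀ (pow_pos (by linarith) _)]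
    have h1 := hB u hu'.le
    rw [hfg, norm_mul, norm_prod] at h1
    have h2 : (r - ρ) ^ Z.card ≤ ∏ a ∈ Z, ‖u - a‖ := by
      rw [← Finset.prod_const]
      refine Finset.prod_le_prod (fun _ _ => by linarith) fun a ha => ?_
      have := norm_sub_norm_le u a
      have := hZ a ha
      linarith
    calc ‖g u‖ * (r - ρ) ^ Z.card ≤ ‖g u‖ * ∏ a ∈ Z, ‖u - a‖ := by gcongr
      _ ≤ B := by rw [mul_comm]; exact h1
  have hdc : DiffContOnCl ℂ g (Metric.ball 0 r) := by
    apply DifferentiableOn.diffContOnCl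
    rw [closure_ball _ hr.ne']
    exact hg.mono (Metric.closedBall_subset_ball hrR)
  have hgz : ‖g z‖ ≤ B / (r - ρ) ^ Z.card := by
    refine Complex.norm_le_of_forall_mem_frontier_norm_le Metric.isBounded_ball hdc ?_ ?_
    · rw [frontier_ball _ hr.ne']; exact hgb
    · rw [closure_ball _ hr.ne']; simpa using hz.trans hρ'r
  rw [hfg, norm_mul, norm_prod]
  have h3 : ∏ a ∈ Z, ‖z - a‖ ≤ (ρ' + ρ) ^ Z.card := by
    rw [← Finset.prod_const]
    refine Finset.prod_le_prod (fun _ _ => norm_nonneg _) fun a ha => ?_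
    exact (norm_sub_le _ _).trans (add_le_add hz (hZ a ha))
  calc _ ≤ (ρ' + ρ) ^ Z.card * (B / (r - ρ) ^ Z.card) := by gcongr
    _ = _ := by rw [div_pow]; ring

lemma tendsto_mul_log_pow (j : ℕ) :
    Tendsto (fun s : ℝ => s * Real.log s ^ j) (𝓝[>] 0) (𝓝 0) := by
  have h1 : (fun s : ℝ => |Real.log s| ^ (j:ℝ)) =o[𝓝[>] 0] fun s => s ^ (-1 : ℝ) :=
    isLittleO_abs_log_rpow_rpow_nhdsGT_zero j (by norm_num)
  have h2 := h1.tendsto_div_nhds_zero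
  rw [tendsto_zero_iff_abs_tendsto_zero]
  refine h2.congr' ?_
  filter_upwards [self_mem_nhdsWithin] with s hs
  have hs' : (0:ℝ) < s := hs
  simp only [Function.comp]
  rw [Real.rpow_neg_one, div_inv_eq_mul, Real.rpow_natCast, abs_mul, abs_pow, abs_of_pos hs', mul_comm]

lemma log_rel_value (d : ℕ) (H : ℕ → ℂ → ℂ) (hH : ∀ k < d, AnalyticAt ℂ (H k) 0)
    (h : ∀ᶠ s : ℝ in 𝓝[>] 0, ∑ k ∈ Finset.range d, (Real.log s : ℂ) ^ k * H k s = 0) :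
    ∀ k < d, H k 0 = 0 := by
  by_contra hcon
  push Not at hcon
  classical
  obtain ⟨k1, hk1, hne1⟩ := hcon
  obtain ⟨k0, hk0m, hk0max⟩ := Finset.exists_max_image ((Finset.range d).filter fun k => H k 0 ≠ 0) id
    ⟨k1, by simp [hk1, hne1]⟩
  simp only [Finset.mem_filter, Finset.mem_range, id, ne_eq] at hk0m hk0max
  have hcast : Tendsto (fun s : ℝ => (s : ℂ)) (𝓝[>] 0) (𝓝 0) := by
    have : Tendsto (fun s : ℝ => (s : ℂ)) (𝓝 0) (𝓝 ((0:ℝ):ℂ)) := Complex.continuous_ofReal.tendsto 0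
    rw [ofReal_zero] at this
    exact this.mono_left nhdsWithin_le_nhds
  have hlog : Tendsto (fun s : ℝ => ((Real.log s : ℂ))⁻¹) (𝓝[>] 0) (𝓝 0) := by
    have h1 := Real.tendsto_log_nhdsGT_zero.inv_tendsto_atBot
    have : Tendsto (fun s : ℝ => (((Real.log s)⁻¹ : ℝ) : ℂ)) (𝓝[>] 0) (𝓝 ((0:ℝ):ℂ)) :=
      (Complex.continuous_ofReal.tendsto 0).comp h1
    simpa using this
  have hterm : ∀ k ∈ Finset.range d, Tendsto (fun s : ℝ => (Real.log s : ℂ) ^ k * H k s / (Real.log s : ℂ) ^ k0)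
      (𝓝[>] 0) (𝓝 (if k = k0 then H k0 0 else 0)) := by
    intro k hk
    rw [Finset.mem_range] at hk
    have hlogne : ∀ᶠ s : ℝ in 𝓝[>] 0, (Real.log s : ℂ) ≠ 0 := by
      have := Real.tendsto_log_nhdsGT_zero.eventually (eventually_lt_atBot (0:ℝ))
      filter_upwards [this] with s hs
      exact_mod_cast hs.ne
    have hHk : Tendsto (fun s : ℝ => H k s) (𝓝[>] 0) (𝓝 (H k 0)) :=
      (hH k hk).continuousAt.tendsto.comp hcast
    rcases lt_trichotomy k k0 with hlt | heq | hgt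
    · rw [if_neg hlt.ne]
      have : Tendsto (fun s : ℝ => ((Real.log s : ℂ))⁻¹ ^ (k0 - k) * H k s) (𝓝[>] 0) (𝓝 (0 ^ (k0 - k) * H k 0)) :=
        (hlog.pow _).mul hHk
      rw [zero_pow (by omega), zero_mul] at this
      refine this.congr' ?_
      filter_upwards [hlogne] with s hs
      have : (Real.log s : ℂ) ^ k0 = (Real.log s : ℂ) ^ k * (Real.log s : ℂ) ^ (k0 - k) := by
        rw [← pow_add]; congr 1; omega
      rw [this, inv_pow]; field_simp
    · subst heq
      rw [if_pos rfl]
      refine hHk.congr' ?_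
      filter_upwards [hlogne] with s hs
      field_simp
    · rw [if_neg hgt.ne']
      have hz : H k 0 = 0 := by
        by_contra hne
        have := hk0max k ⟨hk, hne⟩
        omega
      have hdiff : ContinuousAt (dslope (H k) 0) 0 := 
        continuousAt_dslope_same.2 (hH k hk).differentiableAt
      have h1 : Tendsto (fun s : ℝ => dslope (H k) 0 s) (𝓝[>] 0) (𝓝 (dslope (H k) 0 0)) :=
        hdiff.tendsto.comp hcast
      have h2 : Tendsto (fun s : ℝ => ((s * Real.log s ^ (k - k0) : ℝ) : ℂ)) (𝓝[>] 0) (𝓝 ((0:ℝ):ℂ)) :=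
        (Complex.continuous_ofReal.tendsto 0).comp (tendsto_mul_log_pow _)
      have h3 := h2.mul h1
      rw [ofReal_zero, zero_mul] at h3
      refine h3.congr' ?_
      filter_upwards [hlogne] with s hs
      have e1 := sub_smul_dslope (H k) 0 (s : ℂ)
      rw [hz, sub_zero, sub_zero, smul_eq_mul] at e1
      have : (Real.log s : ℂ) ^ k = (Real.log s : ℂ) ^ k0 * (Real.log s : ℂ) ^ (k - k0) := by
        rw [← pow_add]; congr 1; omega
      rw [this, ← e1]
      push_cast
      field_simp
  have hsum := tendsto_finsetSum (Finset.range d) hterm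
  rw [Finset.sum_ite_eq' (Finset.range d) k0, if_pos (Finset.mem_range.2 hk0m.1)] at hsum
  have hzero : Tendsto (fun s : ℝ => ∑ k ∈ Finset.range d, (Real.log s : ℂ) ^ k * H k s / (Real.log s : ℂ) ^ k0)
      (𝓝[>] 0) (𝓝 0) := by
    refine tendsto_const_nhds.congr' ?_
    filter_upwards [h] with s hs
    rw [← Finset.sum_div, hs, zero_div]
  exact hk0m.2 (tendsto_nhds_unique hsum hzero)

lemma log_rel_zero (d : ℕ) (H : ℕ → ℂ → ℂ) (hH : ∀ k < d, AnalyticAt ℂ (H k) 0)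
    (h : ∀ᶠ s : ℝ in 𝓝[>] 0, ∑ k ∈ Finset.range d, (Real.log s : ℂ) ^ k * H k s = 0) :
    ∀ k < d, ∀ᶠ z in 𝓝 0, H k z = 0 := by
  have key : ∀ n : ℕ, ∀ H : ℕ → ℂ → ℂ, (∀ k < d, AnalyticAt ℂ (H k) 0) → 
      (∀ᶠ s : ℝ in 𝓝[>] 0, ∑ k ∈ Finset.range d, (Real.log s : ℂ) ^ k * H k s = 0) →
      ∀ k < d, ∃ g : ℂ → ℂ, AnalyticAt ℂ g 0 ∧ ∀ z, H k z = z ^ n * g z := by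
    intro n
    induction n with
    | zero => intro H hH _ k hk; exact ⟨H k, hH k hk, by simp⟩
    | succ n ih =>
      intro H hH h k hk
      have hv := log_rel_value d H hH h
      have hds : ∀ k < d, ∀ z, H k z = z * dslope (H k) 0 z := by
        intro k hk z
        have := sub_smul_dslope (H k) 0 z
        rw [hv k hk, sub_zero, sub_zero, smul_eq_mul] at this
        exact this.symm
      have han : ∀ k < d, AnalyticAt ℂ (dslope (H k) 0) 0 := by
        intro k hk
        obtain ⟨p, hp⟩ := hH k hk
        exact hp.has_fpower_series_dslope_fslope.analyticAt
      obtain ⟨g, hg, hg2⟩ := ih (fun k => dslope (H k) 0) han (by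
        filter_upwards [h, self_mem_nhdsWithin] with s hs hs0
        have hs0' : (s : ℂ) ≠ 0 := by exact_mod_cast (ne_of_gt hs0)
        apply mul_left_cancel₀ hs0'
        rw [mul_zero, Finset.mul_sum]
        refine Eq.trans (Finset.sum_congr rfl fun k hk => ?_) hs
        have e := hds k (Finset.mem_range.1 hk) (s : ℂ)
        generalize dslope (H k) 0 (s : ℂ) = u at e ⊢
        rw [e]
        ring) k hk
      exact ⟨g, hg, fun z => by rw [hds k hk, hg2]; ring⟩
  intro k hk
  rw [← analyticOrderAt_eq_top]
  rw [ENat.eq_top_iff_forall_ge]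
  intro n
  rw [natCast_le_analyticOrderAt (hH k hk)]
  obtain ⟨g, hg, hg2⟩ := key n H hH h k hk
  exact ⟨g, hg, Eventually.of_forall fun z => by rw [hg2, sub_zero, smul_eq_mul]⟩
end MT
end partE1

section partE2
open Filter Topology Complex

namespace MT

lemma logs_indep (n : ℕ) : ∀ (w : Fin n → ℂ), Function.Injective w → (∀ j, w j ≠ 0) →
    ∀ p : MvPolynomial (Fin n) ℂ,
    (∀ᶠ z in 𝓝 (0:ℂ), MvPolynomial.eval (fun j => log (1 + w j * z)) p = 0) → p = 0 := by
  have hlogd : ∀ (w : ℂ) (z : ℂ), 0 < (1 + w * z).re → DifferentiableAt ℂ (fun z => log (1 + w * z)) z := by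
    intro w z hz
    exact DifferentiableAt.clog (by fun_prop) (Or.inl hz)
  have hpoly : ∀ (k : ℕ) (w : Fin k → ℂ) (p : MvPolynomial (Fin k) ℂ) (z : ℂ), (∀ j, 0 < (1 + w j * z).re) →
      DifferentiableAt ℂ (fun z => MvPolynomial.eval (fun j => log (1 + w j * z)) p) z := by
    intro k w p z hz
    induction p using MvPolynomial.induction_on with
    | C a => simp
    | add p q hp hq => simp only [map_add]; exact hp.fun_add hq
    | mul_X p i hp => simp only [map_mul, MvPolynomial.eval_X]; exact hp.fun_mul (hlogd (w i) z (hz i))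
  have hVo : ∀ (k : ℕ) (w : Fin k → ℂ), IsOpen {z : ℂ | ∀ j, 0 < (1 + w j * z).re} := by
    intro k w
    simp only [Set.ofPred_forall]
    exact isOpen_iInter_of_finite fun j => isOpen_lt continuous_const (by fun_prop)
  have hVc : ∀ (k : ℕ) (w : Fin k → ℂ), Convex ℝ {z : ℂ | ∀ j, 0 < (1 + w j * z).re} := by
    intro k w x hx y hy a b ha hb hab j
    have hx := hx j
    have hy := hy j
    have e : (1 + w j * (a • x + b • y)).re = a * (1 + w j * x).re + b * (1 + w j * y).re := by
      have : (1 + w j * (a • x + b • y)) = a * (1 + w j * x) + b * (1 + w j * y) := by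
        have : (a : ℂ) + b = 1 := by exact_mod_cast hab
        simp only [real_smul]
        linear_combination -this
      rw [this, add_re, re_ofReal_mul, re_ofReal_mul]
    rw [e]
    rcases ha.eq_or_lt with h | h
    · subst h; have : b = 1 := by linarith
      subst this; simpa using hy
    · have := mul_pos h hx
      have := mul_nonneg hb hy.le
      linarith
  have hident : ∀ (k : ℕ) (w : Fin k → ℂ) (g : ℂ → ℂ), (∀ z, (∀ j, 0 < (1 + w j * z).re) → DifferentiableAt ℂ g z) →
      ∀ z0, (∀ j, 0 < (1 + w j * z0).re) → (∀ᶠ z in 𝓝 z0, g z = 0) → ∀ z, (∀ j, 0 < (1 + w j * z).re) → g z = 0 := by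
    intro k w g hg z0 hz0 h z hz
    have hd : DifferentiableOn ℂ g {z : ℂ | ∀ j, 0 < (1 + w j * z).re} :=
      fun z hz => (hg z hz).differentiableWithinAt
    have := (hd.analyticOnNhd (hVo k w)).eqOn_zero_of_preconnected_of_eventuallyEq_zero
      (hVc k w).isPreconnected (z₀ := z0) hz0 h
    exact this hz
  induction n with
  | zero =>
    intro w _ _ p h
    have := h.self_of_nhds
    rw [MvPolynomial.eq_C_of_isEmpty p] at this ⊢
    simpa using this
  | succ n ih =>
    have main : ∀ (w : Fin (n+1) → ℂ), Function.Injective w → (∀ j, w j ≠ 0) → (∀ j, ‖w j‖ ≤ ‖w 0‖) →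
      ∀ p : MvPolynomial (Fin (n+1)) ℂ,
      (∀ᶠ z in 𝓝 (0:ℂ), MvPolynomial.eval (fun j => log (1 + w j * z)) p = 0) → p = 0 := by
      intro w hw hw0 hmax p h
      set q := MvPolynomial.finSuccEquiv ℂ n p with hq
      set hk : ℕ → ℂ → ℂ := fun k z => MvPolynomial.eval (fun j : Fin n => log (1 + w j.succ * z)) (q.coeff k) with hhk
      have hF : ∀ z, MvPolynomial.eval (fun j => log (1 + w j * z)) p =
          ∑ k ∈ Finset.range (q.natDegree + 1), log (1 + w 0 * z) ^ k * hk k z := by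
        intro z
        have e : (fun j => log (1 + w j * z)) = Fin.cons (log (1 + w 0 * z)) (fun j : Fin n => log (1 + w j.succ * z)) := by
          funext j
          refine Fin.cases ?_ (fun i => ?_) j <;> simp
        rw [e, MvPolynomial.eval_eq_eval_mv_eval', Polynomial.eval_map, Polynomial.eval₂_eq_sum_range]
        exact Finset.sum_congr rfl fun k _ => mul_comm _ _
      set z1 : ℂ := -(w 0)⁻¹ with hz1
      have hz1V : ∀ j : Fin n, 0 < (1 + w j.succ * z1).re := by
        intro j
        set u := w j.succ / w 0 with hu
        have e : 1 + w j.succ * z1 = 1 - u := by rw [hz1, hu]; ring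
        have hu1 : ‖u‖ ≤ 1 := by
          rw [hu, norm_div]
          exact div_le_one_of_le₀ (hmax _) (norm_nonneg _)
        have hne : u ≠ 1 := by
          rw [hu]
          intro hh
          rw [div_eq_one_iff_eq (hw0 0)] at hh
          exact (Fin.succ_ne_zero j) (hw hh)
        rw [e, sub_re, one_re, sub_pos]
        refine lt_of_le_of_ne ((re_le_norm u).trans hu1) fun hre => hne ?_
        have h2 : u.re * u.re + u.im * u.im ≤ 1 := by
          rw [← normSq_apply, normSq_eq_norm_sq]
          nlinarith [norm_nonneg u]
        rw [hre] at h2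
        have : u.im = 0 := by nlinarith
        exact Complex.ext (by simpa using hre) (by simpa using this)
      have hV0 : ∀ j : Fin (n+1), 0 < (1 + w j * 0).re := by intro j; simp
      have hdk : ∀ k z, (∀ j : Fin n, 0 < (1 + w j.succ * z).re) → DifferentiableAt ℂ (hk k) z := by
        intro k z hz
        exact hpoly n (fun j => w j.succ) _ z hz
      have hFz := hident (n+1) w _ (fun z hz => hpoly (n+1) w p z hz) 0 hV0 h
      have hseg : ∀ s : ℝ, 0 < s → s < 1 → ∀ j : Fin (n+1), 0 < (1 + w j * (z1 * (1 - s))).re := by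
        intro s hs0 hs1 j
        refine Fin.cases ?_ (fun i => ?_) j
        · have : 1 + w 0 * (z1 * (1 - s)) = (s : ℂ) := by
            rw [hz1]; have := hw0 0; field_simp; ring
          rw [this]; simpa using hs0
        · have : 1 + w i.succ * (z1 * (1 - s)) = ((1 - s : ℝ) : ℂ) * (1 + w i.succ * z1) + (s : ℝ) := by
            push_cast; ring
          rw [this, add_re, re_ofReal_mul, ofReal_re]
          have := mul_pos (sub_pos.2 hs1) (hz1V i)
          linarith
      have hrel := log_rel_zero (q.natDegree + 1) (fun k s => hk k (z1 * (1 - s))) (by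
        intro k _
        have h1 : AnalyticAt ℂ (hk k) z1 := by
          have hd : DifferentiableOn ℂ (hk k) {z : ℂ | ∀ j : Fin n, 0 < (1 + w j.succ * z).re} :=
            fun z hz => (hdk k z hz).differentiableWithinAt
          exact hd.analyticAt ((hVo n (fun j => w j.succ)).mem_nhds hz1V)
        have h2 : AnalyticAt ℂ (fun s : ℂ => z1 * (1 - s)) 0 := by fun_prop
        exact AnalyticAt.fun_comp (f := fun s : ℂ => z1 * (1 - s)) (g := hk k) (by simpa using h1) h2) (by
        have : ∀ᶠ s : ℝ in 𝓝[>] 0, s < 1 := 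
          (eventually_lt_nhds (by norm_num : (0:ℝ) < 1)).filter_mono nhdsWithin_le_nhds
        filter_upwards [this, self_mem_nhdsWithin] with s hs1 hs0
        have h1 := hFz _ (hseg s hs0 hs1)
        rw [hF] at h1
        have e : 1 + w 0 * (z1 * (1 - s)) = (s : ℂ) := by
          rw [hz1]; have := hw0 0; field_simp; ring
        rw [e, ← Complex.ofReal_log (le_of_lt hs0)] at h1
        exact h1)
      have hz1ne : z1 ≠ 0 := neg_ne_zero.2 (inv_ne_zero (hw0 0))
      have hcoef : ∀ k < q.natDegree + 1, q.coeff k = 0 := by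
        intro k hkd
        refine ih (fun j => w j.succ) (hw.comp (Fin.succ_injective n)) (fun j => hw0 _) _ ?_
        have h1 : ∀ᶠ z in 𝓝 z1, hk k z = 0 := by
          have ht : Tendsto (fun z : ℂ => 1 - z / z1) (𝓝 z1) (𝓝 0) := by
            have : ContinuousAt (fun z : ℂ => 1 - z / z1) z1 := by fun_prop
            have h2 := this.tendsto
            simpa [hz1ne] using h2
          filter_upwards [ht.eventually (hrel k hkd)] with z hz
          have : z1 * (1 - (1 - z / z1)) = z := by field_simp; ring
          rw [← this]; exact hz
        have h2 := hident n (fun j => w j.succ) (hk k) (hdk k) z1 hz1V h1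
        have h3 : ∀ᶠ z in 𝓝 (0:ℂ), ∀ j : Fin n, 0 < (1 + w j.succ * z).re :=
          (hVo n (fun j => w j.succ)).mem_nhds (by simp)
        filter_upwards [h3] with z hz
        exact h2 z hz
      have hq0 : q = 0 := by
        ext1 k
        by_cases hkd : k < q.natDegree + 1
        · simpa using hcoef k hkd
        · simpa using Polynomial.coeff_eq_zero_of_natDegree_lt (by omega)
      rw [hq] at hq0
      simpa using hq0
    intro w hw hw0 p h
    obtain ⟨j0, -, hj0⟩ := Finset.exists_max_image Finset.univ (fun j => ‖w j‖) ⟨0, Finset.mem_univ _⟩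
    set e := Equiv.swap 0 j0 with he
    have := main (w ∘ e) (hw.comp e.injective) (fun j => hw0 _) (fun j => by
        simpa [he] using hj0 (e j) (Finset.mem_univ _)) (MvPolynomial.rename e p) (by
      filter_upwards [h] with z hz
      rw [MvPolynomial.eval_rename, ← hz]
      congr 2
      funext j
      simp [he])
    exact MvPolynomial.rename_injective e e.injective (by simpa using this)
end MT
end partE2

section partE3
open Filter Topology Complex

namespace MT

/-- normalised local logarithm -/
noncomputable def lt (t0 P z : ℂ) : ℂ := log (1 + z / (t0 - P)) / (2 * Real.pi * I)

def Reg {J : ℕ} (P : Fin J → ℂ) (δ : ℝ) : Set ℂ := {t | ‖t‖ ≤ 1 / δ ∧ ∀ j, δ ≤ ‖t - P j‖}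

lemma isCompact_Reg {J : ℕ} (P : Fin J → ℂ) (δ : ℝ) : IsCompact (Reg P δ) := by
  apply Metric.isCompact_of_isClosed_isBounded
  · have : Reg P δ = {t | ‖t‖ ≤ 1 / δ} ∩ ⋂ j, {t | δ ≤ ‖t - P j‖} := by
      ext t; simp [Reg]
    rw [this]
    apply IsClosed.inter
    · exact isClosed_le continuous_norm continuous_const
    · exact isClosed_iInter fun j => isClosed_le continuous_const (by fun_prop)
  · exact (Metric.isBounded_closedBall (x := (0:ℂ)) (r := 1 / δ)).subset fun t ht => by simpa using ht.1

lemma reg_bound {J : ℕ} {P : Fin J → ℂ} {δ : ℝ} (hδ : 0 < δ) {t0 : ℂ} (ht : t0 ∈ Reg P δ) (j : Fin J)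
    {z : ℂ} {r : ℝ} (hz : ‖z‖ ≤ r) : ‖z / (t0 - P j)‖ ≤ r / δ := by
  rw [norm_div]
  have := ht.2 j
  exact div_le_div₀ ((norm_nonneg z).trans hz) hz hδ this

lemma slit_of {x : ℂ} (hx : ‖x‖ < 1) : 1 + x ∈ slitPlane := by
  left
  have := neg_abs_le x.re
  have := abs_re_le_norm x
  simp only [add_re, one_re]; linarith

lemma two_pi_I_ne : (2 * Real.pi * I : ℂ) ≠ 0 := by
  simp [Real.pi_ne_zero]

lemma compact_lower {J : ℕ} (P : Fin J → ℂ) (hP : Function.Injective P) {δ : ℝ} (hδ : 0 < δ) (L : ℕ)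
    {r : ℝ} (hr : 0 < r) (hrδ : r < δ) :
    ∃ η > 0, ∀ t0 ∈ Reg P δ, ∀ c : (Fin J → Fin L) → ℂ, ∃ z, ‖z‖ ≤ r ∧
      η * ‖c‖ ≤ ‖∑ e, c e * ∏ j, lt t0 (P j) z ^ (e j : ℕ)‖ := by
  classical
  set S : Set (ℂ × ((Fin J → Fin L) → ℂ)) := Reg P δ ×ˢ Metric.sphere 0 1 with hS
  have hSc : IsCompact S := (isCompact_Reg P δ).prod (isCompact_sphere _ _)
  set φ : (ℂ × ((Fin J → Fin L) → ℂ)) → ℂ → ℂ := fun x z => ∑ e, x.2 e * ∏ j, lt x.1 (P j) z ^ (e j : ℕ) with hφ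
  have main : ∃ η > 0, ∀ x ∈ S, ∃ z, ‖z‖ ≤ r ∧ η ≤ ‖φ x z‖ := by
    refine hSc.induction_on (p := fun S => ∃ η > 0, ∀ x ∈ S, ∃ z, ‖z‖ ≤ r ∧ η ≤ ‖φ x z‖) ⟨1, one_pos, by simp⟩ ?_ ?_ ?_
    · rintro s t hst ⟨η, h, h'⟩
      exact ⟨η, h, fun x hx => h' x (hst hx)⟩
    · rintro s t ⟨η, h, h'⟩ ⟨η2, h2, h2'⟩
      refine ⟨min η η2, lt_min h h2, ?_⟩
      rintro x (hx | hx)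
      · obtain ⟨z, hz, hz'⟩ := h' x hx
        exact ⟨z, hz, (min_le_left _ _).trans hz'⟩
      · obtain ⟨z, hz, hz'⟩ := h2' x hx
        exact ⟨z, hz, (min_le_right _ _).trans hz'⟩
    · rintro ⟨t0, c⟩ ⟨ht0, hc⟩
      simp only at ht0 hc
      have hne : ∀ j, t0 - P j ≠ 0 := fun j h => by
        have := ht0.2 j; rw [h, norm_zero] at this; linarith
      -- nonvanishing somewhere
      have hex : ∃ z, ‖z‖ ≤ r ∧ φ (t0, c) z ≠ 0 := by
        by_contra hcon
        push Not at hcon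
        set p : MvPolynomial (Fin J) ℂ := ∑ e : Fin J → Fin L, 
          MvPolynomial.monomial (Finsupp.equivFunOnFinite.symm fun j => (e j : ℕ)) (c e * ∏ j, ((2 * Real.pi * I : ℂ)⁻¹) ^ (e j : ℕ)) with hp
        have hp0 : p = 0 := by
          refine logs_indep J (fun j => (t0 - P j)⁻¹) (fun i j h => hP ?_) (fun j => inv_ne_zero (hne j)) p ?_
          · have := inv_injective h; simpa using this
          · have : ∀ᶠ z : ℂ in 𝓝 0, ‖z‖ ≤ r := by
              filter_upwards [Metric.closedBall_mem_nhds (0:ℂ) hr] with z hz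
              simpa using hz
            filter_upwards [this] with z hz
            rw [← hcon z hz, hp, map_sum]
            simp only [hφ]
            refine Finset.sum_congr rfl fun e _ => ?_
            rw [MvPolynomial.eval_monomial, Finsupp.prod_fintype _ _ (by simp)]
            rw [mul_assoc, ← Finset.prod_mul_distrib]
            congr 1
            refine Finset.prod_congr rfl fun j _ => ?_
            simp only [Finsupp.equivFunOnFinite_symm_apply_apply, lt]
            rw [← mul_pow]
            congr 1
            rw [div_eq_mul_inv, div_eq_mul_inv, mul_comm z, mul_comm]
        have hc0 : c = 0 := by
          funext e
          have := congrArg (MvPolynomial.coeff (Finsupp.equivFunOnFinite.symm fun j => (e j : ℕ))) hp0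
          rw [hp, MvPolynomial.coeff_sum] at this
          simp only [MvPolynomial.coeff_monomial, MvPolynomial.coeff_zero] at this
          rw [Finset.sum_eq_single e] at this
          · rw [if_pos rfl] at this
            rcases mul_eq_zero.1 this with h | h
            · exact h
            · exact absurd h (Finset.prod_ne_zero_iff.2 fun j _ => pow_ne_zero _ (inv_ne_zero two_pi_I_ne))
          · intro e' _ hne'
            rw [if_neg]
            intro h
            apply hne'
            have h2 := Finsupp.equivFunOnFinite.symm.injective h
            funext j
            exact Fin.ext (congrFun h2 j)
          · simp
        rw [hc0] at hc
        simp at hc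
      obtain ⟨z, hz, hzne⟩ := hex
      refine ⟨{x | ‖φ (t0, c) z‖ / 2 < ‖φ x z‖}, ?_, ‖φ (t0, c) z‖ / 2, by positivity, fun x hx => ⟨z, hz, le_of_lt hx⟩⟩
      apply mem_nhdsWithin_of_mem_nhds
      have hcont : ContinuousAt (fun x => φ x z) (t0, c) := by
        simp only [hφ]
        refine tendsto_finsetSum _ fun e _ => ?_
        refine Tendsto.mul ?_ (tendsto_finsetProd _ fun j _ => ?_)
        · exact ((continuous_apply e).comp continuous_snd).continuousAt
        · have h1 : ContinuousAt (fun x : ℂ × ((Fin J → Fin L) → ℂ) => 1 + z / (x.1 - P j)) (t0, c) := by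
            refine continuousAt_const.add (continuousAt_const.div (by fun_prop) (hne j))
          have h2 : (1 + z / (t0 - P j)) ∈ slitPlane := by
            apply slit_of
            refine (reg_bound hδ ht0 j hz).trans_lt ?_
            rw [div_lt_one hδ]; exact hrδ
          exact ((h1.clog h2).div_const _).pow _
      have : ‖φ (t0, c) z‖ / 2 < ‖φ (t0, c) z‖ := half_lt_self (norm_pos_iff.2 hzne)
      exact hcont.norm.eventually_const_lt this
  obtain ⟨η, hη, h⟩ := main
  refine ⟨η, hη, fun t0 ht0 c => ?_⟩
  rcases eq_or_ne c 0 with rfl | hc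
  · exact ⟨0, by simpa using hr.le, by simp⟩
  have hcn : ‖c‖ ≠ 0 := norm_ne_zero_iff.2 hc
  obtain ⟨z, hz, hz'⟩ := h (t0, ((‖c‖⁻¹ : ℝ) : ℂ) • c) ⟨ht0, by
    simp [norm_smul, hcn]⟩
  refine ⟨z, hz, ?_⟩
  have e : φ (t0, ((‖c‖⁻¹ : ℝ) : ℂ) • c) z = ((‖c‖⁻¹ : ℝ) : ℂ) * ∑ e, c e * ∏ j, lt t0 (P j) z ^ (e j : ℕ) := by
    simp only [hφ, Pi.smul_apply, smul_eq_mul, Finset.mul_sum, mul_assoc]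
  rw [e, norm_mul, norm_real, Real.norm_of_nonneg (by positivity)] at hz'
  rw [inv_mul_eq_div, le_div_iff₀ (by positivity)] at hz'
  exact hz'
end MT
end partE3

section partE4
open Filter Topology Complex

namespace MT

lemma subst_coeffs {J : ℕ} (L : ℕ) (hL : 0 < L) (q : Fin L × Fin L → ℤ) (hq : q ≠ 0) (β β' : Fin J → ℤ)
    (hnp : NonProp β β') :
    ∃ c : (Fin J → Fin (2 * L)) → ℂ, 1 ≤ ‖c‖ ∧ ∀ x : Fin J → ℂ,
      ∑ e, c e * ∏ j, x j ^ (e j : ℕ) =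
      ∑ s : Fin L × Fin L, (q s : ℂ) * ((∑ j, (β j : ℂ) * x j) ^ (s.1 : ℕ) * (∑ j, (β' j : ℂ) * x j) ^ (s.2 : ℕ)) := by
  classical
  set lin : (Fin J → ℤ) → MvPolynomial (Fin J) ℤ := fun β => ∑ j, MvPolynomial.C (β j) * MvPolynomial.X j with hlin
  have hlind : ∀ β, (lin β).totalDegree ≤ 1 := by
    intro β
    refine MvPolynomial.totalDegree_finsetSum_le fun j _ => ?_
    refine (MvPolynomial.totalDegree_mul _ _).trans ?_
    rw [MvPolynomial.totalDegree_C, MvPolynomial.totalDegree_X]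
  set p : MvPolynomial (Fin J) ℤ := ∑ s : Fin L × Fin L, MvPolynomial.C (q s) * ((lin β) ^ (s.1 : ℕ) * (lin β') ^ (s.2 : ℕ)) with hp
  have hdeg : p.totalDegree ≤ 2 * (L - 1) := by
    refine MvPolynomial.totalDegree_finsetSum_le fun s _ => ?_
    refine (MvPolynomial.totalDegree_mul _ _).trans ?_
    rw [MvPolynomial.totalDegree_C, zero_add]
    refine (MvPolynomial.totalDegree_mul _ _).trans ?_
    have h1 := (MvPolynomial.totalDegree_pow (lin β) (s.1 : ℕ)).trans (Nat.mul_le_mul_left _ (hlind β))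
    have h2 := (MvPolynomial.totalDegree_pow (lin β') (s.2 : ℕ)).trans (Nat.mul_le_mul_left _ (hlind β'))
    have := s.1.2
    have := s.2.2
    omega
  have hevlin : ∀ (β : Fin J → ℤ) (x : Fin J → ℂ), MvPolynomial.aeval x (lin β) = ∑ j, (β j : ℂ) * x j := by
    intro β x
    simp [hlin]
  have hev : ∀ x : Fin J → ℂ, MvPolynomial.aeval x p = 
      ∑ s : Fin L × Fin L, (q s : ℂ) * ((∑ j, (β j : ℂ) * x j) ^ (s.1 : ℕ) * (∑ j, (β' j : ℂ) * x j) ^ (s.2 : ℕ)) := by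
    intro x
    rw [hp, map_sum]
    refine Finset.sum_congr rfl fun s _ => ?_
    rw [map_mul, map_mul, map_pow, map_pow, hevlin, hevlin]
    simp
  set ex : (Fin J → Fin (2 * L)) → (Fin J →₀ ℕ) := fun e => Finsupp.equivFunOnFinite.symm fun j => (e j : ℕ) with hex
  have hexinj : Function.Injective ex := by
    intro e e' h
    have h2 := Finsupp.equivFunOnFinite.symm.injective h
    funext j
    exact Fin.ext (congrFun h2 j)
  have hrange : ∀ d ∈ p.support, ∃ e, ex e = d := by
    intro d hd
    have h1 : ∀ j, d j < 2 * L := by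
      intro j
      have h2 := MvPolynomial.le_totalDegree hd
      have h3 : d j ≤ d.sum fun _ e => e := by
        by_cases hj : j ∈ d.support
        · exact Finset.single_le_sum (f := fun j => d j) (fun _ _ => Nat.zero_le _) hj
        · simp only [Finsupp.mem_support_iff, not_not] at hj; omega
      omega
    exact ⟨fun j => ⟨d j, h1 j⟩, by ext j; simp [hex]⟩
  have hsum : ∀ x : Fin J → ℂ, ∑ e, ((p.coeff (ex e) : ℤ) : ℂ) * ∏ j, x j ^ (e j : ℕ) = MvPolynomial.aeval x p := by
    intro x
    rw [MvPolynomial.aeval_eq_eval₂Hom, MvPolynomial.coe_eval₂Hom, MvPolynomial.eval₂_eq']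
    have : ∑ e, ((p.coeff (ex e) : ℤ) : ℂ) * ∏ j, x j ^ (e j : ℕ) = ∑ d ∈ Finset.univ.map ⟨ex, hexinj⟩, ((p.coeff d : ℤ) : ℂ) * ∏ j, x j ^ (d j) := by
      rw [Finset.sum_map]
      simp [hex]
    rw [this]
    symm
    simp only [algebraMap_int_eq, eq_intCast]
    refine Finset.sum_subset ?_ ?_
    · intro d hd
      obtain ⟨e, he⟩ := hrange d hd
      simp only [Finset.mem_map, Finset.mem_univ, true_and]
      exact ⟨e, he⟩
    · intro d _ hd
      rw [MvPolynomial.notMem_support_iff.1 hd]; simp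
  have hpne : p ≠ 0 := by
    intro hp0
    obtain ⟨i, j, hij⟩ := hnp
    have hijne : i ≠ j := by rintro rfl; apply hij; ring
    have hsol : ∀ u v : ℂ, ∃ x : Fin J → ℂ, ∑ j, (β j : ℂ) * x j = u ∧ ∑ j, (β' j : ℂ) * x j = v := by
      intro u v
      set Δ : ℂ := (β i : ℂ) * β' j - β j * β' i with hΔ
      have hΔ0 : Δ ≠ 0 := by rw [hΔ]; exact_mod_cast hij
      have hs : ∀ (b : Fin J → ℤ) (a a' : ℂ), ∑ k, (b k : ℂ) * (if k = i then a else if k = j then a' else 0) = b i * a + b j * a' := by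
        intro b a a'
        have : ∀ k, (b k : ℂ) * (if k = i then a else if k = j then a' else 0) = (if k = i then b i * a else 0) + (if k = j then b j * a' else 0) := by
          intro k
          by_cases h1 : k = i
          · subst h1; simp [hijne]
          · by_cases h2 : k = j
            · subst h2; simp [h1]
            · simp [h1, h2]
        simp only [this, Finset.sum_add_distrib, Finset.sum_ite_eq', Finset.mem_univ, if_true]
      refine ⟨fun k => if k = i then (u * β' j - v * β j) / Δ else if k = j then (v * β i - u * β' i) / Δ else 0, ?_, ?_⟩
      · rw [hs]; field_simp; rw [hΔ]; ring
      · rw [hs]; field_simp; rw [hΔ]; ring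
    set q2 : MvPolynomial (Fin 2) ℂ := ∑ s : Fin L × Fin L, MvPolynomial.monomial (Finsupp.equivFunOnFinite.symm ![(s.1 : ℕ), (s.2 : ℕ)]) (q s : ℂ) with hq2
    have hq20 : q2 = 0 := by
      apply MvPolynomial.funext
      intro y
      obtain ⟨x, hx1, hx2⟩ := hsol (y 0) (y 1)
      have h1 := hev x
      rw [hp0, map_zero, hx1, hx2] at h1
      rw [hq2, map_sum, map_zero]
      rw [h1]
      refine Finset.sum_congr rfl fun s _ => ?_
      rw [MvPolynomial.eval_monomial, Finsupp.prod_fintype _ _ (by simp)]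
      simp [Fin.prod_univ_two]
    apply hq
    funext s
    have := congrArg (MvPolynomial.coeff (Finsupp.equivFunOnFinite.symm ![(s.1 : ℕ), (s.2 : ℕ)])) hq20
    rw [hq2, MvPolynomial.coeff_sum] at this
    simp only [MvPolynomial.coeff_monomial, MvPolynomial.coeff_zero] at this
    rw [Finset.sum_eq_single s] at this
    · rw [if_pos rfl] at this
      exact_mod_cast this
    · intro s' _ hne'
      rw [if_neg]
      intro h
      apply hne'
      have h2 := Finsupp.equivFunOnFinite.symm.injective h
      exact Prod.ext (Fin.ext (by simpa using congrFun h2 0)) (Fin.ext (by simpa using congrFun h2 1))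
    · simp
  refine ⟨fun e => ((p.coeff (ex e) : ℤ) : ℂ), ?_, fun x => by rw [hsum, hev]⟩
  obtain ⟨d, hd⟩ := MvPolynomial.support_nonempty.2 hpne
  obtain ⟨e, he⟩ := hrange d hd
  refine le_trans ?_ (norm_le_pi_norm _ e)
  rw [he, norm_intCast]
  have : p.coeff d ≠ 0 := MvPolynomial.mem_support_iff.1 hd
  exact_mod_cast Int.one_le_abs this
end MT
end partE4

section partE5
open Filter Topology Complex

namespace MT

lemma lt_norm_le {J : ℕ} {P : Fin J → ℂ} {δ : ℝ} (hδ : 0 < δ) {t0 : ℂ} (ht : t0 ∈ Reg P δ) (j : Fin J)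
    {z : ℂ} (hz : ‖z‖ ≤ δ / 2) : ‖lt t0 (P j) z‖ ≤ 1 := by
  have h1 : ‖z / (t0 - P j)‖ ≤ 1 / 2 := by
    have := reg_bound hδ ht j hz
    have e : δ / 2 / δ = 1 / 2 := by field_simp
    rwa [e] at this
  have h2 := Complex.norm_log_one_add_half_le_self h1
  have hpi := Real.pi_gt_three
  have h3 : ‖(2 * Real.pi * I : ℂ)‖ = 2 * Real.pi := by
    simp [abs_of_pos Real.pi_pos]
  rw [lt, norm_div, h3, div_le_one (by positivity)]
  linarith

lemma lt_diff {J : ℕ} {P : Fin J → ℂ} {δ : ℝ} (hδ : 0 < δ) {t0 : ℂ} (ht : t0 ∈ Reg P δ) (j : Fin J) :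
    DifferentiableOn ℂ (lt t0 (P j)) (Metric.ball 0 δ) := by
  intro z hz
  have hz' : ‖z‖ < δ := by simpa using hz
  have h1 : ‖z / (t0 - P j)‖ < 1 := by
    have := reg_bound hδ ht j (le_refl ‖z‖)
    exact this.trans_lt ((div_lt_one hδ).2 hz')
  unfold lt
  exact ((DifferentiableAt.clog (f := fun z => 1 + z / (t0 - P j)) (x := z) (by fun_prop) (slit_of h1)).div_const _).differentiableWithinAt

lemma cell {J : ℕ} (P : Fin J → ℂ) (hP : Function.Injective P) {δ : ℝ} (hδ : 0 < δ) (l : ℕ) (hl : 0 < l) :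
    ∃ C : ℝ, 0 < C ∧ ∀ t0 ∈ Reg P δ, ∀ B : ℝ, 1 ≤ B → ∀ β β' : Fin J → ℤ, NonProp β β' →
      (∀ j, |(β j : ℝ)| ≤ B) → (∀ j, |(β' j : ℝ)| ≤ B) →
      ∀ ρ : ℝ, 0 ≤ ρ → ρ ≤ δ / 16 → (8 * ρ / δ) ^ (2 * l) * (2 * (J * B)) ^ 8 ≤ 1 → ∀ Z : Finset ℂ,
      (∀ z ∈ Z, ‖z‖ ≤ ρ ∧ (∃ n : ℤ, ∑ j, (β j : ℂ) * lt t0 (P j) z = n) ∧ 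
        (∃ n : ℤ, ∑ j, (β' j : ℂ) * lt t0 (P j) z = n)) →
      (Z.card : ℝ) ≤ C * (1 + Real.log (J * B)) := by
  classical
  obtain ⟨η, hη, hlow⟩ := compact_lower P hP hδ (2 * (2 * l)) (r := δ / 16) (by positivity) (by linarith)
  set K0 : ℝ := 16 * (l : ℝ) ^ 4 / η with hK0
  have hlog2 : 0 < Real.log 2 := Real.log_pos (by norm_num)
  have hl1 : (1 : ℝ) ≤ l := by exact_mod_cast hl
  refine ⟨(|Real.log K0| + 8 * l) / Real.log 2 + 2 * l ^ 2, by positivity, ?_⟩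
  intro t0 ht0 B hB β β' hnp hβ hβ' ρ hρ0 hρδ hρ Z hZ
  have hJ : 1 ≤ (J : ℝ) := by
    obtain ⟨i, -⟩ := hnp
    exact_mod_cast (Nat.one_le_iff_ne_zero.2 (by rintro rfl; exact i.elim0))
  set M : ℝ := J * B with hM
  have hM1 : 1 ≤ M := by nlinarith
  have hlogM : 0 ≤ Real.log M := Real.log_nonneg hM1
  set u : (Fin J → ℤ) → ℂ → ℂ := fun b z => ∑ j, (b j : ℂ) * lt t0 (P j) z with hu
  have hub : ∀ b : Fin J → ℤ, (∀ j, |(b j : ℝ)| ≤ B) → ∀ z, ‖z‖ ≤ δ / 2 → ‖u b z‖ ≤ M := by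
    intro b hb z hz
    refine (norm_sum_le _ _).trans ?_
    refine (Finset.sum_le_sum (g := fun _ => B) fun j _ => ?_).trans (by simp [hM])
    rw [norm_mul, norm_intCast]
    have := lt_norm_le hδ ht0 j hz
    calc |(b j : ℝ)| * ‖lt t0 (P j) z‖ ≤ B * 1 := mul_le_mul (hb j) this (norm_nonneg _) (by linarith)
      _ = B := mul_one _
  have hud : ∀ b : Fin J → ℤ, DifferentiableOn ℂ (u b) (Metric.ball 0 δ) := by
    intro b
    refine DifferentiableOn.fun_sum fun j _ => ?_
    exact (lt_diff hδ ht0 j).const_mul _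
  by_cases hcard : Z.card ≤ 2 * l ^ 2
  · have h1 : (Z.card : ℝ) ≤ 2 * l ^ 2 := by exact_mod_cast hcard
    have h2 : 0 ≤ (|Real.log K0| + 8 * l) / Real.log 2 := by positivity
    nlinarith [mul_nonneg (add_nonneg h2 (by positivity : (0:ℝ) ≤ 2 * l ^ 2)) hlogM]
  push Not at hcard
  obtain ⟨Z0, hZ0, hZ0c⟩ := Finset.exists_subset_card_eq hcard.le
  have hZ1 := fun z hz => (hZ z hz).1
  choose! n hn using fun z hz => (hZ z hz).2.1
  choose! n' hn' using fun z hz => (hZ z hz).2.2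
  set L := 2 * l with hL
  -- Siegel
  set A : Matrix Z0 (Fin L × Fin L) ℤ := fun z s => n z ^ (s.1 : ℕ) * n' z ^ (s.2 : ℕ) with hA
  have hc1 : Fintype.card Z0 = 2 * l ^ 2 := by rw [Fintype.card_coe, hZ0c]
  have hc2 : Fintype.card (Fin L × Fin L) = 4 * l ^ 2 := by
    simp [hL]; ring
  have hl2 : 0 < l ^ 2 := by positivity
  obtain ⟨q, hq0, hqA, hqn⟩ := Int.Matrix.exists_ne_zero_int_vec_norm_le A (by rw [hc1, hc2]; omega)
    (by rw [hc1]; omega)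
  have hnb : ∀ z ∈ Z, |(n z : ℝ)| ≤ M ∧ |(n' z : ℝ)| ≤ M := by
    intro z hz
    have h2 : ‖z‖ ≤ δ / 2 := by have := hZ1 z hz; linarith
    constructor
    · have := hub β hβ z h2
      rw [hu] at this; simp only at this
      rw [hn z hz, norm_intCast] at this; exact this
    · have := hub β' hβ' z h2
      rw [hu] at this; simp only at this
      rw [hn' z hz, norm_intCast] at this; exact this
  have hpow : ∀ (a b : ℝ), 0 ≤ a → a ≤ M → 0 ≤ b → b ≤ M → ∀ s : Fin L × Fin L, a ^ (s.1 : ℕ) * b ^ (s.2 : ℕ) ≤ M ^ (2 * L) := by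
    intro a b ha haM hb hbM s
    calc a ^ (s.1 : ℕ) * b ^ (s.2 : ℕ) ≤ M ^ (s.1 : ℕ) * M ^ (s.2 : ℕ) := by gcongr
      _ = M ^ ((s.1 : ℕ) + (s.2 : ℕ)) := by rw [pow_add]
      _ ≤ M ^ (2 * L) := pow_le_pow_right₀ hM1 (by have := s.1.2; have := s.2.2; omega)
  have hM2L : 1 ≤ M ^ (2 * L) := one_le_pow₀ hM1
  have hqb : ∀ s, |(q s : ℝ)| ≤ 4 * l ^ 2 * M ^ (2 * L) := by
    have hexp : ((Fintype.card Z0 : ℝ) / (Fintype.card (Fin L × Fin L) - Fintype.card Z0)) = 1 := by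
      rw [hc1, hc2]; push_cast
      have : (l : ℝ) ^ 2 ≠ 0 := by positivity
      field_simp; norm_num
    rw [hexp, Real.rpow_one, hc2] at hqn
    have h1 : (4 * l ^ 2 : ℝ) * M ^ (2 * L) ≥ ‖q‖ := by
      refine hqn.trans ?_
      push_cast
      gcongr
      refine max_le hM2L ?_
      rw [Matrix.norm_le_iff (by positivity)]
      intro z s
      have := hnb z.1 (hZ0 z.2)
      rw [hA]; simp only
      rw [norm_mul, norm_pow, norm_pow, Int.norm_eq_abs, Int.norm_eq_abs]
      exact hpow _ _ (abs_nonneg _) this.1 (abs_nonneg _) this.2 s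
    intro s
    have h2 := norm_le_pi_norm q s
    rw [Int.norm_eq_abs] at h2
    linarith
  set φ : ℂ → ℂ := fun z => ∑ s : Fin L × Fin L, (q s : ℂ) * (u β z ^ (s.1 : ℕ) * u β' z ^ (s.2 : ℕ)) with hφ
  have hφd : DifferentiableOn ℂ φ (Metric.ball 0 δ) := by
    refine DifferentiableOn.fun_sum fun s _ => ?_
    exact (((hud β).fun_pow _).fun_mul ((hud β').fun_pow _)).const_mul _
  set Bd : ℝ := 16 * l ^ 4 * M ^ (8 * l) with hBd
  have hφB : ∀ z, ‖z‖ ≤ δ / 2 → ‖φ z‖ ≤ Bd := by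
    intro z hz
    refine (norm_sum_le _ _).trans ?_
    refine (Finset.sum_le_sum (g := fun _ => 4 * l ^ 2 * M ^ (2 * L) * M ^ (2 * L)) fun s _ => ?_).trans ?_
    · rw [norm_mul, norm_intCast, norm_mul, norm_pow, norm_pow]
      exact mul_le_mul (hqb s) (hpow _ _ (norm_nonneg _) (hub β hβ z hz) (norm_nonneg _) (hub β' hβ' z hz) s)
        (by positivity) (by positivity)
    · rw [Finset.sum_const, Finset.card_univ, hc2, nsmul_eq_mul, hBd]
      push_cast
      have : M ^ (8 * l) = M ^ (2 * L) * M ^ (2 * L) := by rw [← pow_add]; congr 1; omega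
      rw [this]
      apply le_of_eq; ring
  have hφn : ∀ z ∈ Z, ∃ N : ℤ, φ z = N := by
    intro z hz
    refine ⟨∑ s : Fin L × Fin L, q s * (n z ^ (s.1 : ℕ) * n' z ^ (s.2 : ℕ)), ?_⟩
    have h1 : u β z = n z := hn z hz
    have h2 : u β' z = n' z := hn' z hz
    simp only [hφ, h1, h2]
    push_cast; rfl
  have hφZ0 : ∀ z ∈ Z0, φ z = 0 := by
    intro z hz
    have h1 : u β z = n z := hn z (hZ0 hz)
    have h2 : u β' z = n' z := hn' z (hZ0 hz)
    have h3 := congrFun hqA ⟨z, hz⟩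
    rw [Matrix.mulVec, dotProduct] at h3
    simp only [hφ, h1, h2]
    simp only [hA, Pi.zero_apply] at h3
    have h4 : ((∑ s : Fin L × Fin L, n z ^ (s.1 : ℕ) * n' z ^ (s.2 : ℕ) * q s : ℤ) : ℂ) = 0 := by rw [h3]; simp
    push_cast at h4
    rw [← h4]
    exact Finset.sum_congr rfl fun s _ => by ring
  have hφZ : ∀ z ∈ Z, φ z = 0 := by
    intro z hz
    have h1 := schwarz Z0 φ δ (δ/2) ρ ρ Bd hρ0 (by linarith) (by linarith) hρ0 (by linarith) hφd hφB
      (fun z hz => hZ1 z (hZ0 hz)) hφZ0 z (hZ1 z hz)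
    rw [hZ0c] at h1
    have h2 : (ρ + ρ) / (δ / 2 - ρ) ≤ 8 * ρ / δ := by
      rw [div_le_div_iff₀ (by linarith) hδ]
      nlinarith
    have h3 : ((ρ + ρ) / (δ / 2 - ρ)) ^ (2 * l ^ 2) ≤ ((8 * ρ / δ) ^ (2 * l)) ^ l := by
      rw [← pow_mul, show 2 * l * l = 2 * l ^ 2 by ring]
      exact pow_le_pow_left₀ (div_nonneg (by linarith) (by linarith)) h2 _
    have h4 : ((8 * ρ / δ) ^ (2 * l)) ^ l * ((2 * M) ^ 8) ^ l ≤ 1 := by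
      rw [← mul_pow]
      exact pow_le_one₀ (by positivity) hρ
    have h5 : ‖φ z‖ < 1 := by
      have h6 : ‖φ z‖ ≤ Bd * ((8 * ρ / δ) ^ (2 * l)) ^ l := h1.trans (by gcongr)
      have h9 : Bd < ((2 * M) ^ 8) ^ l := by
        have e : ((2 * M) ^ 8) ^ l = (2 ^ l) ^ 8 * M ^ (8 * l) := by
          rw [← pow_mul, mul_pow, ← pow_mul, mul_comm 8 l]
        have hll : (l : ℝ) < 2 ^ l := by exact_mod_cast Nat.lt_two_pow_self
        have hll2 : (2 : ℝ) ≤ 2 ^ l := by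
          calc (2:ℝ) = 2 ^ 1 := by norm_num
            _ ≤ 2 ^ l := pow_le_pow_right₀ (by norm_num) hl
        have h8 : (16 : ℝ) * l ^ 4 < (2 ^ l) ^ 8 := by
          calc (16 : ℝ) * l ^ 4 = 2 ^ 4 * l ^ 4 := by norm_num
            _ < 2 ^ 4 * (2 ^ l) ^ 4 := by gcongr
            _ ≤ (2 ^ l) ^ 4 * (2 ^ l) ^ 4 := by gcongr
            _ = _ := by rw [← pow_add]
        rw [e, hBd]
        exact mul_lt_mul_of_pos_right h8 (by positivity)
      rcases (by positivity : 0 ≤ ((8 * ρ / δ) ^ (2 * l)) ^ l).eq_or_lt with h0 | h0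
      · rw [← h0, mul_zero] at h6; linarith
      · have := mul_lt_mul_of_pos_right h9 h0
        linarith
    obtain ⟨N, hN⟩ := hφn z hz
    rw [hN, norm_intCast] at h5
    have : |N| < 1 := by exact_mod_cast h5
    rw [Int.abs_lt_one_iff] at this
    rw [hN, this, Int.cast_zero]
  obtain ⟨c, hc1', hcx⟩ := subst_coeffs L (by omega) q hq0 β β' hnp
  obtain ⟨z, hz, hzl⟩ := hlow t0 ht0 c
  rw [hcx (fun j => lt t0 (P j) z)] at hzl
  have h1 := schwarz Z φ δ (δ/2) ρ (δ/16) Bd hρ0 (by linarith) (by linarith) (by linarith) (by linarith) hφd hφB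
      hZ1 hφZ z hz
  have h2 : (δ / 16 + ρ) / (δ / 2 - ρ) ≤ 1 / 2 := by
    rw [div_le_div_iff₀ (by linarith) (by norm_num)]; linarith
  have h3 : ((δ / 16 + ρ) / (δ / 2 - ρ)) ^ Z.card ≤ (1/2) ^ Z.card :=
    pow_le_pow_left₀ (div_nonneg (by linarith) (by linarith)) h2 _
  have h4 : η ≤ Bd * (1/2) ^ Z.card := by
    calc η ≤ η * ‖c‖ := by nlinarith
      _ ≤ ‖φ z‖ := hzl
      _ ≤ _ := h1.trans (by gcongr)
  have h5 : (2:ℝ) ^ Z.card ≤ K0 * M ^ (8 * l) := by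
    rw [hK0, div_mul_eq_mul_div, le_div_iff₀ hη]
    rw [one_div, inv_pow, ← div_eq_mul_inv, le_div_iff₀ (by positivity)] at h4
    linarith
  have hK0p : 0 < K0 := by positivity
  have h6 := Real.log_le_log (by positivity) h5
  rw [Real.log_mul hK0p.ne' (by positivity), Real.log_pow, Real.log_pow] at h6
  have h7 : (Z.card : ℝ) ≤ (|Real.log K0| + 8 * l * Real.log M) / Real.log 2 := by
    rw [le_div_iff₀ hlog2]
    have := le_abs_self (Real.log K0)
    push_cast at h6
    linarith
  have h8 : (|Real.log K0| + 8 * l * Real.log M) / Real.log 2 ≤ (|Real.log K0| + 8 * l) / Real.log 2 * (1 + Real.log M) := by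
    rw [div_mul_eq_mul_div]
    gcongr
    nlinarith [mul_nonneg (abs_nonneg (Real.log K0)) hlogM]
  refine h7.trans (h8.trans ?_)
  gcongr
  have : 0 ≤ (2:ℝ) * l ^ 2 := by positivity
  linarith
end MT
end partE5

section partE6
open Filter Topology Complex

namespace MT

lemma integral_log {J : ℕ} {P : Fin J → ℂ} {δ : ℝ} (hδ : 0 < δ) {t0 t : ℂ} (h0 : t0 ∈ Reg P δ) (h1 : t ∈ Reg P δ)
    (β : Fin J → ℤ) (h : ∏ j, (t0 - P j) ^ β j = ∏ j, (t - P j) ^ β j) :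
    ∃ n : ℤ, ∑ j, (β j : ℂ) * lt t0 (P j) (t - t0) = n := by
  have hne : ∀ t ∈ Reg P δ, ∀ j, t - P j ≠ 0 := fun t ht j h => by
    have := ht.2 j; rw [h, norm_zero] at this; linarith
  have e1 : ∀ j, 1 + (t - t0) / (t0 - P j) = (t - P j) / (t0 - P j) := by
    intro j; have := hne t0 h0 j; field_simp; ring
  have h2 : exp (∑ j, (β j : ℂ) * log (1 + (t - t0) / (t0 - P j))) = 1 := by
    rw [Complex.exp_sum]
    have : ∀ j, exp ((β j : ℂ) * log (1 + (t - t0) / (t0 - P j))) = (t - P j) ^ β j / (t0 - P j) ^ β j := by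
      intro j
      rw [Complex.exp_int_mul, e1, exp_log (div_ne_zero (hne t h1 j) (hne t0 h0 j)), div_zpow]
    simp only [this]
    rw [Finset.prod_div_distrib, h, div_self]
    exact Finset.prod_ne_zero_iff.2 fun j _ => zpow_ne_zero _ (hne t h1 j)
  obtain ⟨n, hn⟩ := Complex.exp_eq_one_iff.1 h2
  refine ⟨n, ?_⟩
  have h3 := two_pi_I_ne
  rw [← mul_left_inj' h3, ← hn, Finset.sum_mul]
  refine Finset.sum_congr rfl fun j _ => ?_
  unfold lt
  field_simp

lemma fourth_root (D : ℕ) (hD : 1 ≤ D) : ∃ N : ℕ, 1 ≤ N ∧ D ≤ N ^ 4 ∧ N ^ 4 ≤ 16 * D := by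
  classical
  have hex : ∃ N : ℕ, D ≤ N ^ 4 := ⟨D, Nat.le_self_pow (by norm_num) D⟩
  refine ⟨Nat.find hex, ?_, Nat.find_spec hex, ?_⟩
  · by_contra h
    have : Nat.find hex = 0 := by omega
    have h2 := Nat.find_spec hex
    rw [this] at h2; omega
  · set N := Nat.find hex with hN
    rcases Nat.lt_or_ge N 2 with h | h
    · have : N ^ 4 ≤ 1 ^ 4 := Nat.pow_le_pow_left (by omega) 4
      omega
    · have h2 := Nat.find_min hex (m := N - 1) (by omega)
      have h3 : N ^ 4 ≤ (2 * (N - 1)) ^ 4 := Nat.pow_le_pow_left (by omega) 4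
      rw [mul_pow] at h3
      omega

set_option maxHeartbeats 1000000 in
lemma bigcount {J : ℕ} (P : Fin J → ℂ) (hP : Function.Injective P) {δ : ℝ} (hδ : 0 < δ) (C0 : ℝ) (hC0 : 1 ≤ C0) (C1 : ℕ) :
    ∃ Dmax : ℕ, ∀ D : ℕ, 1 ≤ D → ∀ β β' : Fin J → ℤ, NonProp β β' →
      (∀ j, |(β j : ℝ)| ≤ C0 * D ^ C1) → (∀ j, |(β' j : ℝ)| ≤ C0 * D ^ C1) → ∀ S : Finset ℂ,
      (∀ t ∈ S, t ∈ Reg P δ) → ∀ γ γ' : ℂ, (∀ t ∈ S, ∏ j, (t - P j) ^ β j = γ) →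
      (∀ t ∈ S, ∏ j, (t - P j) ^ β' j = γ') → D ≤ 2 * S.card → D ≤ Dmax := by
  classical
  set l := 16 * C1 + 1 with hl
  obtain ⟨C, hC, hcell⟩ := cell P hP hδ l (by omega)
  set C3 : ℝ := 2 * ((J + 1 : ℝ) * C0) with hC3
  have hC3' : 2 ≤ C3 := by
    have : (0:ℝ) ≤ J := by positivity
    rw [hC3]; nlinarith
  set c0 : ℝ := 1 / (2 * C3 ^ 8) with hc0
  have hC38 : 1 ≤ C3 ^ 8 := one_le_pow₀ (by linarith)
  have hc0p : 0 < c0 := by positivity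
  have hc0h : c0 ≤ 1 / 2 := by
    rw [hc0]; apply one_div_le_one_div_of_le <;> linarith
  set C2 : ℝ := 32 / (δ ^ 2 * c0) + 3 with hC2
  set C4 : ℝ := 1 + Real.log ((J + 1 : ℝ) * C0) + 4 * C1 with hC4
  have hlog0 : 0 ≤ Real.log ((J + 1 : ℝ) * C0) := Real.log_nonneg (by rw [hC3] at hC3'; linarith)
  set C5 : ℝ := 2 * (C2 ^ 2 * (C * C4)) with hC5
  refine ⟨⌈16 * C5⌉₊ ^ 4, ?_⟩
  intro D hD β β' hnp hβ hβ' S hS γ γ' hγ hγ' hcard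
  obtain ⟨N, hN1, hDN, hND⟩ := fourth_root D hD
  have hN1' : (1:ℝ) ≤ N := by exact_mod_cast hN1
  have hD1' : (1:ℝ) ≤ D := by exact_mod_cast hD
  have hDN' : (D:ℝ) ≤ N ^ 4 := by exact_mod_cast hDN
  set B : ℝ := C0 * D ^ C1 with hB
  have hDC : (1:ℝ) ≤ D ^ C1 := one_le_pow₀ hD1'
  have hB1 : 1 ≤ B := by rw [hB]; nlinarith
  set ρ : ℝ := δ * c0 / (8 * N) with hρ
  have hρp : 0 < ρ := by positivity
  have hx : 8 * ρ / δ = c0 / N := by rw [hρ]; field_simp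
  have hρδ : ρ ≤ δ / 16 := by
    have : c0 / N ≤ 1 / 2 := (div_le_self hc0p.le hN1').trans hc0h
    rw [← hx, div_le_iff₀ hδ] at this
    linarith
  have hcond : (8 * ρ / δ) ^ (2 * l) * (2 * (J * B)) ^ 8 ≤ 1 := by
    rw [hx, div_pow]
    have h1 : c0 ^ (2 * l) ≤ c0 := by
      calc c0 ^ (2 * l) ≤ c0 ^ 1 := pow_le_pow_of_le_one hc0p.le (by linarith) (by omega)
        _ = c0 := pow_one _
    have h2 : (2 * (J * B)) ^ 8 ≤ C3 ^ 8 * (N : ℝ) ^ (2 * l) := by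
      have : 2 * ((J:ℝ) * B) ≤ C3 * D ^ C1 := by
        rw [hB, hC3]
        have : (0:ℝ) ≤ 2 * (C0 * D ^ C1) := by positivity
        nlinarith
      calc (2 * (J * B)) ^ 8 ≤ (C3 * (D:ℝ) ^ C1) ^ 8 := pow_le_pow_left₀ (by positivity) this 8
        _ = C3 ^ 8 * (D : ℝ) ^ (8 * C1) := by rw [mul_pow, ← pow_mul, mul_comm C1]
        _ ≤ C3 ^ 8 * (N : ℝ) ^ (2 * l) := by
          gcongr
          calc (D : ℝ) ^ (8 * C1) ≤ ((N:ℝ) ^ 4) ^ (8 * C1) := by gcongr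
            _ = (N:ℝ) ^ (32 * C1) := by rw [← pow_mul]; congr 1; ring
            _ ≤ (N : ℝ) ^ (2 * l) := pow_le_pow_right₀ hN1' (by omega)
    calc c0 ^ (2 * l) / (N:ℝ) ^ (2 * l) * (2 * (J * B)) ^ 8 ≤ c0 / (N:ℝ) ^ (2 * l) * (C3 ^ 8 * (N : ℝ) ^ (2 * l)) := by gcongr
      _ = c0 * C3 ^ 8 := by field_simp
      _ = 1 / 2 := by rw [hc0]; field_simp
      _ ≤ 1 := by norm_num
  set s : ℝ := ρ / 2 with hs
  have hsp : 0 < s := by positivity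
  set g : ℂ → ℤ × ℤ := fun t => (⌊t.re / s⌋, ⌊t.im / s⌋) with hg
  have hJB : 1 + Real.log (J * B) ≤ C4 * N := by
    have hJ : 1 ≤ (J : ℝ) := by
      obtain ⟨i, -⟩ := hnp
      exact_mod_cast (Nat.one_le_iff_ne_zero.2 (by rintro rfl; exact i.elim0))
    have h1 : (J : ℝ) * B ≤ ((J + 1 : ℝ) * C0) * D ^ C1 := by
      rw [hB]
      have : (0:ℝ) ≤ C0 * D ^ C1 := by positivity
      nlinarith
    have h2 := Real.log_le_log (by positivity) h1
    rw [Real.log_mul (x := (J + 1 : ℝ) * C0) (by positivity) (by positivity), Real.log_pow] at h2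
    have h3 : Real.log D ≤ 4 * N := by
      have := Real.log_le_log (by linarith) hDN'
      rw [Real.log_pow] at this
      have h4 := Real.log_le_self (x := (N:ℝ)) (by linarith)
      push_cast at this
      linarith
    have h4 : (C1 : ℝ) * Real.log D ≤ C1 * (4 * N) := by gcongr
    rw [hC4]
    nlinarith
  have hfib : ∀ a ∈ S.image g, ((S.filter fun t => g t = a).card : ℝ) ≤ C * (C4 * N) := by
    intro a ha
    obtain ⟨t0, ht0, rfl⟩ := Finset.mem_image.1 ha
    set Z : Finset ℂ := (S.filter fun t => g t = g t0).image (fun t => t - t0) with hZ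
    have hZc : Z.card = (S.filter fun t => g t = g t0).card := 
      Finset.card_image_of_injective _ (sub_left_injective)
    rw [← hZc]
    refine (hcell t0 (hS t0 ht0) B hB1 β β' hnp hβ hβ' ρ hρp.le hρδ hcond Z ?_).trans (by gcongr)
    intro z hz
    obtain ⟨t, ht, rfl⟩ := Finset.mem_image.1 hz
    obtain ⟨htS, htg⟩ := Finset.mem_filter.1 ht
    refine ⟨?_, integral_log hδ (hS t0 ht0) (hS t htS) β (by rw [hγ t0 ht0, hγ t htS]),
      integral_log hδ (hS t0 ht0) (hS t htS) β' (by rw [hγ' t0 ht0, hγ' t htS])⟩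
    have hfl : ∀ x y : ℝ, ⌊x / s⌋ = ⌊y / s⌋ → |x - y| ≤ s := by
      intro x y hxy
      have := Int.abs_sub_lt_one_of_floor_eq_floor hxy
      rw [← sub_div, abs_div, abs_of_pos hsp, div_lt_one hsp] at this
      exact this.le
    have h1 := hfl _ _ (congrArg Prod.fst htg)
    have h2 := hfl _ _ (congrArg Prod.snd htg)
    have h3 := norm_le_abs_re_add_abs_im (t - t0)
    rw [sub_re, sub_im] at h3
    have : s + s = ρ := by rw [hs]; ring
    linarith
  set k : ℕ := ⌈1 / (δ * s)⌉₊ with hk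
  have hk1 : (k : ℝ) ≤ 1 / (δ * s) + 1 := (Nat.ceil_lt_add_one (by positivity)).le
  have hk2 : 1 / (δ * s) ≤ k := Nat.le_ceil _
  have himg : S.image g ⊆ Finset.Icc (-(k:ℤ)) k ×ˢ Finset.Icc (-(k:ℤ)) k := by
    intro a ha
    obtain ⟨t, ht, rfl⟩ := Finset.mem_image.1 ha
    have hfl : ∀ x : ℝ, |x| ≤ ‖t‖ → ⌊x / s⌋ ∈ Finset.Icc (-(k:ℤ)) k := by
      intro x hx
      have h1 : |x / s| ≤ k := by
        rw [abs_div, abs_of_pos hsp]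
        refine le_trans ?_ hk2
        rw [div_le_div_iff₀ hsp (by positivity)]
        have := (hS t ht).1
        have h2 := hx.trans this
        rw [le_div_iff₀ hδ] at h2
        nlinarith
      rw [abs_le] at h1
      rw [Finset.mem_Icc]
      constructor
      · rw [Int.le_floor]; push_cast; linarith
      · have := Int.floor_le (x / s)
        exact_mod_cast this.trans h1.2
    exact Finset.mem_product.2 ⟨hfl _ (abs_re_le_norm t), hfl _ (abs_im_le_norm t)⟩
  have hcells : ((S.image g).card : ℝ) ≤ (C2 * N) ^ 2 := by
    have h1 := Finset.card_le_card himg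
    rw [Finset.card_product, Int.card_Icc] at h1
    have h2 : ((k:ℤ) + 1 - -(k:ℤ)).toNat = 2 * k + 1 := by omega
    rw [h2] at h1
    have h3 : ((S.image g).card : ℝ) ≤ (2 * k + 1) ^ 2 := by
      rw [pow_two]; exact_mod_cast h1
    have h4 : (2 * k + 1 : ℝ) ≤ C2 * N := by
      have h5 : 1 / (δ * s) = 16 / (δ ^ 2 * c0) * N := by
        rw [hs, hρ]; field_simp; norm_num
      have h6 : C2 * N = 2 * (16 / (δ ^ 2 * c0) * N) + 3 * N := by rw [hC2]; ring
      rw [h5] at hk1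
      rw [h6]
      linarith
    exact h3.trans (pow_le_pow_left₀ (by positivity) h4 2)
  have htot : (S.card : ℝ) ≤ (C2 * N) ^ 2 * (C * (C4 * N)) := by
    rw [Finset.card_eq_sum_card_image g S]
    push_cast
    refine (Finset.sum_le_sum hfib).trans ?_
    rw [Finset.sum_const, nsmul_eq_mul]
    gcongr
  have hDle : (D:ℝ) ≤ C5 * N ^ 3 := by
    have : (D:ℝ) ≤ 2 * S.card := by exact_mod_cast hcard
    calc (D:ℝ) ≤ 2 * ((C2 * N) ^ 2 * (C * (C4 * N))) := by linarith
      _ = _ := by rw [hC5]; ring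
  have hN4 : (N:ℝ) ^ 4 ≤ 16 * D := by exact_mod_cast hND
  have hNle : (N:ℝ) ≤ 16 * C5 := by
    have h1 : (N:ℝ) ^ 3 * N ≤ (N:ℝ) ^ 3 * (16 * C5) := by
      calc (N:ℝ) ^ 3 * N = N ^ 4 := by ring
        _ ≤ 16 * (C5 * (N:ℝ) ^ 3) := hN4.trans (by linarith)
        _ = _ := by ring
    exact le_of_mul_le_mul_left h1 (by positivity)
  have hN5 : N ≤ ⌈16 * C5⌉₊ := by
    have := hNle.trans (Nat.le_ceil _)
    exact_mod_cast this
  exact hDN.trans (Nat.pow_le_pow_left hN5 4)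
end MT
end partE6

section partE7
open NumberField Height Real
open scoped IntermediateField

namespace MT

lemma emb_posLog_le {N : Type} [Field N] [NumberField N] (x : N) (hx : x ≠ 0) :
    ∑ φ : N →+* ℂ, log⁺ ‖φ x‖ ≤ logHeight₁ x := by
  obtain ⟨T, hT⟩ := exists_goodT {x} (by simpa using hx)
  have h := pl_sum_posLog (hT x (by simp))
  rw [Fintype.sum_sum_type] at h
  simp only [pv_inl] at h
  rw [← h]
  have : 0 ≤ ∑ v : T, log⁺ (pv T (.inr v) x) := Finset.sum_nonneg fun _ _ => posLog_nonneg
  linarith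

lemma logHeight_sub_le' {K : Type} [Field K] [NumberField K] {E : Type} [Field E] [NumberField E] [Algebra K E]
    (x : E) (p : K) : logHeight₁ (x - algebraMap K E p) ≤ logHeight₁ x + Module.finrank ℚ E * (log 2 + logHeight₁ p) := by
  have h := logHeight₁_sub_le x (algebraMap K E p)
  rw [NumberField.totalWeight_eq_finrank, logHeight_ext] at h
  have hm : Module.finrank ℚ K * Module.finrank K E = Module.finrank ℚ E :=
    Module.finrank_mul_finrank _ _ _
  have h1 : (1:ℝ) ≤ Module.finrank ℚ K := by
    exact_mod_cast Module.finrank_pos (R := ℚ) (M := K)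
  have h2 : (Module.finrank K E : ℝ) ≤ Module.finrank ℚ E := by
    rw [← hm]; push_cast; nlinarith [Nat.cast_nonneg (α := ℝ) (Module.finrank K E)]
  have h3 := zero_le_logHeight₁ p
  nlinarith

set_option maxHeartbeats 1000000 in
lemma caseA_bound {K : Type} [Field K] [NumberField K] {J s : ℕ} (P : Fin J → K) (hP : Function.Injective P)
    (c : Fin s → K) (hc : ∀ l, c l ≠ 0) (H : ℝ) (hH : 0 ≤ H) :
    ∃ Dmax : ℕ, ∀ (E : Type) [Field E] [NumberField E] [Algebra K E] (a : E), K⟮a⟯ = ⊤ →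
      logHeight₁ a ≤ Module.finrank ℚ E * H → (∀ j, a ≠ algebraMap K E (P j)) →
      ∀ (β β' : Fin J → ℤ) (b b' : Fin s → ℤ), NonProp β β' → 
      IsRel (fun j => a - algebraMap K E (P j)) (fun l => algebraMap K E (c l)) β b →
      IsRel (fun j => a - algebraMap K E (P j)) (fun l => algebraMap K E (c l)) β' b' → 
      Module.finrank K E ≤ Dmax := by
  classical
  obtain ⟨ι⟩ : Nonempty (K →+* ℂ) := inferInstance
  set k : ℕ := Module.finrank ℚ K with hk
  have hk1 : 1 ≤ k := Module.finrank_pos (R := ℚ) (M := K)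
  set hx : Fin J → ℝ := fun j => H + (log 2 + logHeight₁ (P j)) with hhx
  have hx0 : ∀ j, 0 ≤ hx j := fun j => by
    have := zero_le_logHeight₁ (P j)
    have := log_nonneg (by norm_num : (1:ℝ) ≤ 2)
    simp only [hhx]; linarith
  set C6 : ℝ := ∑ j, hx j + ∑ l, logHeight₁ (c l) with hC6
  have hC60 : 0 ≤ C6 := add_nonneg (Finset.sum_nonneg fun j _ => hx0 j) (Finset.sum_nonneg fun l _ => zero_le_logHeight₁ _)
  set q0 : ℕ := ⌈24 * C6⌉₊ + 2 with hq0
  have hq0' : 24 * C6 ≤ q0 := by rw [hq0]; push_cast; have := Nat.le_ceil (24 * C6); linarith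
  set W0 : ℝ := H + ∑ j, hx j with hW0
  have hW00 : 0 ≤ W0 := add_nonneg hH (Finset.sum_nonneg fun j _ => hx0 j)
  set lam : ℝ := 2 * k * W0 + 1 with hlam
  have hlam0 : 0 < lam := by positivity
  set δ : ℝ := exp (-lam) with hδ
  set C1 : ℕ := 2 + 3 * (J + s) with hC1
  set C0 : ℝ := 4 * k ^ C1 * q0 ^ (J + s) with hC0
  have hk1' : (1:ℝ) ≤ k := by exact_mod_cast hk1
  have hq1' : (1:ℝ) ≤ q0 := by rw [hq0]; push_cast; have := Nat.cast_nonneg (α := ℝ) ⌈24 * C6⌉₊; linarith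
  have hC01 : 1 ≤ C0 := by
    have h1 : (1:ℝ) ≤ k ^ C1 := one_le_pow₀ hk1'
    have h2 : (1:ℝ) ≤ q0 ^ (J + s) := one_le_pow₀ hq1'
    rw [hC0]; nlinarith
  obtain ⟨Dmax, hD⟩ := bigcount (fun j => ι (P j)) (fun i j h => hP (ι.injective h)) (δ := δ) (exp_pos _) C0 hC01 C1
  refine ⟨Dmax, ?_⟩
  intro E _ _ _ a ha hHa hne β β' b b' hnp hr hr'
  have : FiniteDimensional K E := FiniteDimensional.right ℚ K E
  set D := Module.finrank K E with hDdef
  have hD1 : 1 ≤ D := Module.finrank_pos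
  have hm : k * D = Module.finrank ℚ E := Module.finrank_mul_finrank _ _ _
  set d : ℝ := (Module.finrank ℚ E : ℝ) with hd
  have hdk : d = k * D := by rw [hd, ← hm]; push_cast; rfl
  have hD1' : (1:ℝ) ≤ D := by exact_mod_cast hD1
  have hd1 : 1 ≤ d := by rw [hdk]; nlinarith
  set x : Fin J → E := fun j => a - algebraMap K E (P j) with hxdef
  have hxne : ∀ j, x j ≠ 0 := fun j => sub_ne_zero.2 (hne j)
  have hcne : ∀ l, algebraMap K E (c l) ≠ 0 := fun l => by simpa using hc l
  have hhtx : ∀ j, logHeight₁ (x j) ≤ d * hx j := by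
    intro j
    have := logHeight_sub_le' a (P j)
    simp only [hhx, hxdef]
    nlinarith
  have hhtc : ∀ l, logHeight₁ (algebraMap K E (c l)) ≤ d * logHeight₁ (c l) := by
    intro l
    rw [logHeight_ext]
    have := zero_le_logHeight₁ (c l)
    gcongr
    rw [hdk]; nlinarith
  have hsumh : ∑ j, logHeight₁ (x j) + ∑ l, logHeight₁ (algebraMap K E (c l)) ≤ d * C6 := by
    rw [hC6, mul_add, Finset.mul_sum, Finset.mul_sum]
    exact add_le_add (Finset.sum_le_sum fun j _ => hhtx j) (Finset.sum_le_sum fun l _ => hhtc l)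
  obtain ⟨γ, γ', g, g', hγ, hγ', hnp', hγb, hγb'⟩ := smallrel2 hxne hcne (q0 * (Module.finrank ℚ E) ^ 3) (by
      have : 1 ≤ (Module.finrank ℚ E) ^ 3 := Nat.one_le_pow _ _ (Module.finrank_pos)
      have : 2 ≤ q0 := by omega
      nlinarith) (by
      push_cast
      rw [← hd]
      calc _ ≤ 24 * d ^ 2 * (d * C6) := by gcongr
        _ = 24 * C6 * d ^ 3 := by ring
        _ ≤ q0 * d ^ 3 := by gcongr) hr hr' hnp
  have hbd : 4 * (Module.finrank ℚ E : ℝ) ^ 2 * ((q0 * (Module.finrank ℚ E) ^ 3 : ℕ) : ℝ) ^ (Fintype.card (Fin J) + Fintype.card (Fin s)) = C0 * D ^ C1 := by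
    push_cast
    rw [← hd, hdk, hC0, hC1, Fintype.card_fin, Fintype.card_fin]
    generalize J + s = n
    ring
  rw [hbd] at hγb hγb'
  -- good embeddings
  set Fb : Finset (E →+* ℂ) := Finset.univ.filter fun φ => φ.comp (algebraMap K E) = ι with hFb
  have hFc : Fb.card = D := by
    have h1 := sum_emb_ext (N := K) (M := E) (fun φ => if φ = ι then 1 else 0)
    rw [Finset.sum_ite_eq' Finset.univ ι] at h1
    simp only [Finset.mem_univ, if_true, mul_one] at h1
    rw [Finset.sum_boole] at h1
    exact_mod_cast h1
  have hFι : ∀ φ ∈ Fb, ∀ y : K, φ (algebraMap K E y) = ι y := by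
    intro φ hφ y
    exact congrArg (fun f : K →+* ℂ => f y) (Finset.mem_filter.1 hφ).2
  set W : (E →+* ℂ) → ℝ := fun φ => log⁺ ‖φ a‖ + ∑ j, log⁺ ‖φ (x j)⁻¹‖ with hW
  have hWnn : ∀ φ, 0 ≤ W φ := fun φ => add_nonneg posLog_nonneg (Finset.sum_nonneg fun _ _ => posLog_nonneg)
  have hWsum : ∑ φ ∈ Fb, W φ ≤ d * W0 := by
    calc ∑ φ ∈ Fb, W φ ≤ ∑ φ, W φ := Finset.sum_le_sum_of_subset_of_nonneg (Finset.subset_univ _) fun φ _ _ => hWnn φ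
      _ = ∑ φ : E →+* ℂ, log⁺ ‖φ a‖ + ∑ j, ∑ φ : E →+* ℂ, log⁺ ‖φ (x j)⁻¹‖ := by
        simp only [hW]; rw [Finset.sum_add_distrib, Finset.sum_comm]
      _ ≤ d * H + ∑ j, d * hx j := by
        refine add_le_add ?_ (Finset.sum_le_sum fun j _ => ?_)
        · rcases eq_or_ne a 0 with rfl | h0
          · simp; positivity
          · exact (emb_posLog_le a h0).trans hHa
        · refine (emb_posLog_le _ (inv_ne_zero (hxne j))).trans ?_
          rw [logHeight₁_inv]; exact hhtx j
      _ = d * W0 := by rw [← Finset.mul_sum, hW0, mul_add]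
  set G : Finset (E →+* ℂ) := Fb.filter fun φ => φ a ∈ Reg (fun j => ι (P j)) δ with hG
  set Bad : Finset (E →+* ℂ) := Fb.filter fun φ => ¬ φ a ∈ Reg (fun j => ι (P j)) δ with hBad
  have hbadW : ∀ φ ∈ Bad, lam ≤ W φ := by
    intro φ hφ
    obtain ⟨hφF, hφR⟩ := Finset.mem_filter.1 hφ
    rw [Reg, Set.mem_setOf_eq, not_and_or] at hφR
    rcases hφR with h | h
    · push Not at h
      have h1 : exp lam < ‖φ a‖ := by
        rw [hδ, one_div, ← exp_neg, neg_neg] at h; exact h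
      have h2 : lam < log ‖φ a‖ := by
        rw [lt_log_iff_exp_lt ((exp_pos _).trans h1)]; exact h1
      have h3 : log ‖φ a‖ ≤ log⁺ ‖φ a‖ := le_max_right _ _
      have h4 : 0 ≤ ∑ j, log⁺ ‖φ (x j)⁻¹‖ := Finset.sum_nonneg fun _ _ => posLog_nonneg
      simp only [hW]; linarith
    · push Not at h
      obtain ⟨j, hj⟩ := h
      have e : φ (x j) = φ a - ι (P j) := by
        simp only [hxdef]; rw [map_sub, hFι φ hφF]
      rw [← e] at hj
      have hpos : 0 < ‖φ (x j)‖ := norm_pos_iff.2 ((map_ne_zero φ).2 (hxne j))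
      have h1 : exp lam < ‖φ (x j)⁻¹‖ := by
        rw [map_inv₀, norm_inv, lt_inv_comm₀ (exp_pos _) hpos, ← exp_neg]; exact hj
      have h2 : lam < log ‖φ (x j)⁻¹‖ := by
        rw [lt_log_iff_exp_lt ((exp_pos _).trans h1)]; exact h1
      have h3 : log ‖φ (x j)⁻¹‖ ≤ log⁺ ‖φ (x j)⁻¹‖ := le_max_right _ _
      have h4 : log⁺ ‖φ (x j)⁻¹‖ ≤ ∑ j, log⁺ ‖φ (x j)⁻¹‖ := 
        Finset.single_le_sum (f := fun j => log⁺ ‖φ (x j)⁻¹‖) (fun _ _ => posLog_nonneg) (Finset.mem_univ j)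
      have h5 : 0 ≤ log⁺ ‖φ a‖ := posLog_nonneg
      simp only [hW]; linarith
  have hBadc : 2 * Bad.card ≤ D := by
    have h1 : (Bad.card : ℝ) * lam ≤ d * W0 := by
      rw [← nsmul_eq_mul, ← Finset.sum_const]
      refine (Finset.sum_le_sum hbadW).trans (le_trans ?_ hWsum)
      exact Finset.sum_le_sum_of_subset_of_nonneg (Finset.filter_subset _ _) fun φ _ _ => hWnn φ
    have h2 : 2 * (Bad.card : ℝ) * lam ≤ D * lam := by
      rw [hdk] at h1
      calc 2 * (Bad.card : ℝ) * lam = 2 * (Bad.card * lam) := by ring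
        _ ≤ 2 * (k * D * W0) := by linarith
        _ ≤ D * lam := by rw [hlam]; nlinarith
    have h3 := le_of_mul_le_mul_right h2 hlam0
    exact_mod_cast h3
  have hGc : D ≤ 2 * G.card := by
    have := Finset.card_filter_add_card_filter_not (s := Fb) (fun φ => φ a ∈ Reg (fun j => ι (P j)) δ)
    rw [hFc] at this
    change G.card + Bad.card = D at this
    omega
  have hinj : Set.InjOn (fun φ : E →+* ℂ => φ a) G := by
    intro φ hφ ψ hψ h
    have hφF := (Finset.mem_filter.1 hφ).1
    have hψF := (Finset.mem_filter.1 hψ).1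
    let _ := ι.toAlgebra
    let φ' : E →ₐ[K] ℂ := { φ with commutes' := fun r => hFι φ hφF r }
    let ψ' : E →ₐ[K] ℂ := { ψ with commutes' := fun r => hFι ψ hψF r }
    have hadj : Algebra.adjoin K {a} = ⊤ := by
      have h1 := IntermediateField.adjoin_simple_toSubalgebra_of_isAlgebraic (Algebra.IsAlgebraic.isAlgebraic (R := K) a)
      rw [← h1, ha, IntermediateField.top_toSubalgebra]
    have hpq : φ' = ψ' := AlgHom.ext_of_adjoin_eq_top hadj (fun r hr0 => by
      rw [Set.mem_singleton_iff] at hr0; subst hr0; exact h)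
    exact RingHom.ext fun y => congrArg (fun f : E →ₐ[K] ℂ => f y) hpq
  have hprod : ∀ (γ : Fin J → ℤ) (g : Fin s → ℤ), IsRel x (fun l => algebraMap K E (c l)) γ g →
      ∀ t ∈ G.image (fun φ : E →+* ℂ => φ a), ∏ j, (t - ι (P j)) ^ γ j = (ι (∏ l, c l ^ g l))⁻¹ := by
    intro γ g hr t ht
    obtain ⟨φ, hφ, rfl⟩ := Finset.mem_image.1 ht
    have hφF := (Finset.mem_filter.1 hφ).1
    have h1 := congrArg φ hr
    rw [map_one, map_mul, map_prod, map_prod] at h1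
    refine eq_inv_of_mul_eq_one_left ?_
    rw [← h1, map_prod]
    congr 1
    · refine Finset.prod_congr rfl fun j _ => ?_
      simp only [hxdef]
      rw [map_zpow₀, map_sub, hFι φ hφF]
    · refine Finset.prod_congr rfl fun j _ => ?_
      rw [map_zpow₀, map_zpow₀, hFι φ hφF]
  refine hD D hD1 γ γ' hnp' hγb hγb' (G.image fun φ : E →+* ℂ => φ a) ?_ _ _ (hprod γ g hγ) (hprod γ' g' hγ') ?_
  · intro t ht
    obtain ⟨φ, hφ, rfl⟩ := Finset.mem_image.1 ht
    exact (Finset.mem_filter.1 hφ).2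
  · rw [Finset.card_image_of_injOn hinj]; exact hGc

end MT
end partE7

section partF1
open NumberField Height Real

namespace MT

section local1
variable {N : Type} [Field N] [NumberField N] {T : Finset (FinitePlace N)}

noncomputable def ew {T : Finset (FinitePlace N)} : Pl T → ℝ := Sum.elim (fun _ => 1) (fun _ => 0)

lemma ew_nonneg (w : Pl T) : 0 ≤ ew w := by
  rcases w with w | w <;> simp [ew]

lemma sum_ew : ∑ w : Pl T, ew w = Module.finrank ℚ N := by
  rw [Fintype.sum_sum_type]
  simp [ew, card_emb]

lemma pv_add_le' (w : Pl T) (x y : N) :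
    pv T w (x + y) ≤ exp (ew w * log 2) * max (pv T w x) (pv T w y) := by
  rcases w with w | w
  · have : exp (ew (Sum.inl w : Pl T) * log 2) = 2 := by simp [ew, exp_log]
    rw [this, two_mul]
    exact ((pv T (.inl w)).add_le x y).trans (add_le_add (le_max_left _ _) (le_max_right _ _))
  · have : exp (ew (Sum.inr w : Pl T) * log 2) = 1 := by simp [ew]
    rw [this, one_mul]
    exact pv_inr_add_le w x y

lemma pv_sum_le (w : Pl T) {ι : Type} (s : Finset ι) (x : ι → N) (M C : ℝ) (hC : 0 ≤ C)
    (hs : log (s.card : ℝ) ≤ C) (h : ∀ i ∈ s, pv T w (x i) ≤ exp M) :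
    pv T w (∑ i ∈ s, x i) ≤ exp (ew w * C + M) := by
  classical
  rcases w with w | w
  · have e : ew (Sum.inl w : Pl T) = 1 := by simp [ew]
    rw [e, one_mul, exp_add]
    refine ((pv T (.inl w)).sum_le s x).trans ?_
    refine (Finset.sum_le_sum h).trans ?_
    rw [Finset.sum_const, nsmul_eq_mul]
    gcongr
    rcases Nat.eq_zero_or_pos s.card with h0 | h0
    · rw [h0]; simp; positivity
    · rw [← log_le_iff_le_exp (by exact_mod_cast h0)]; exact hs
  · have e : ew (Sum.inr w : Pl T) = 0 := by simp [ew]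
    rw [e, zero_mul, zero_add]
    induction s using Finset.induction_on with
    | empty => simp; positivity
    | insert a s ha ih =>
      rw [Finset.sum_insert ha]
      refine (pv_inr_add_le w _ _).trans (max_le (h a (by simp)) ?_)
      by_cases hs0 : s.card = 0
      · rw [Finset.card_eq_zero] at hs0; subst hs0; simp; positivity
      · refine ih ?_ fun i hi => h i (by simp [hi])
        refine le_trans ?_ hs
        apply log_le_log (by exact_mod_cast Nat.pos_of_ne_zero hs0)
        exact_mod_cast Finset.card_le_card (Finset.subset_insert _ _)

lemma pv_int_le {K : Type} [Field K] [NumberField K] [Algebra K N] (w : Pl T) (x : 𝓞 K) (C : ℝ)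
    (h : house (x : K) ≤ exp C) : pv T w (algebraMap K N x) ≤ exp (ew w * C) := by
  rcases w with w | w
  · have e : ew (Sum.inl w : Pl T) = 1 := by simp [ew]
    rw [e, one_mul, pv_inl]
    exact (norm_embedding_le_house (x : K) (w.comp (algebraMap K N))).trans h
  · have e : ew (Sum.inr w : Pl T) = 0 := by simp [ew]
    rw [e, zero_mul, exp_zero]
    refine pv_inr_integral_le w ?_
    exact (RingOfIntegers.isIntegral_coe x).algebraMap

lemma pv_natCast_le (w : Pl T) (k : ℕ) (C : ℝ)  (h : (k : ℝ) ≤ exp C) : 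
    pv T w (k : N) ≤ exp (ew w * C) := by
  rcases w with w | w
  · have e : ew (Sum.inl w : Pl T) = 1 := by simp [ew]
    rw [e, one_mul, pv_inl]
    simpa using h
  · have e : ew (Sum.inr w : Pl T) = 0 := by simp [ew]
    rw [e, zero_mul, exp_zero]
    exact pv_inr_integral_le w (isIntegral_algebraMap (R := ℤ) (x := (k : ℤ)) |> fun h => by simpa using h)

noncomputable def lam (T : Finset (FinitePlace N)) (w : Pl T) (a p : N) : ℝ :=
  log⁺ (pv T w a) - log (pv T w (a - p))

lemma sum_lam {a p : N} (ha : GoodT T a) (hp : GoodT T (a - p)) :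
    ∑ w : Pl T, lam T w a p = logHeight₁ a := by
  unfold lam
  rw [Finset.sum_sub_distrib, pl_sum_log hp, pl_sum_posLog ha, sub_zero]

lemma pv_sub_eq (w : Pl T) {a p : N} (hp : a ≠ p) :
    pv T w (a - p) = exp (log⁺ (pv T w a) - lam T w a p) := by
  unfold lam
  rw [sub_sub_cancel, exp_log]
  exact (pv T w).pos (sub_ne_zero.2 hp)

lemma pv_le_exp_posLog (w : Pl T) (a : N) : pv T w a ≤ exp (log⁺ (pv T w a)) := by
  rcases eq_or_ne a 0 with rfl | h
  · simp; 
  · rw [← log_le_iff_le_exp ((pv T w).pos h)]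
    exact le_max_right _ _

noncomputable def cw {ι : Type} [Fintype ι] {T : Finset (FinitePlace N)} (P : ι → N) (w : Pl T) : ℝ :=
  2 * (ew w * log 2) + ∑ j, log⁺ (pv T w (P j)) + ∑ i, ∑ j, |log (pv T w (P i - P j))|

variable {ι : Type} [Fintype ι] {P : ι → N}

lemma cw_nonneg (w : Pl T) : 0 ≤ cw P w := by
  have h1 := ew_nonneg w
  have h2 := log_nonneg (by norm_num : (1:ℝ) ≤ 2)
  have h3 : 0 ≤ ∑ j, log⁺ (pv T w (P j)) := Finset.sum_nonneg fun _ _ => posLog_nonneg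
  have h4 : 0 ≤ ∑ i, ∑ j, |log (pv T w (P i - P j))| := 
    Finset.sum_nonneg fun _ _ => Finset.sum_nonneg fun _ _ => abs_nonneg _
  unfold cw; positivity

lemma lam_ge (w : Pl T) (a : N) (j : ι) (hj : a ≠ P j) : - cw P w ≤ lam T w a (P j) := by
  have h0 := pv_add_le' w a (-(P j))
  rw [← sub_eq_add_neg, AbsoluteValue.map_neg] at h0
  have h1 : max (pv T w a) (pv T w (P j)) ≤ exp (log⁺ (pv T w a) + log⁺ (pv T w (P j))) := by
    have a1 : 0 ≤ log⁺ (pv T w a) := posLog_nonneg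
    have a2 : 0 ≤ log⁺ (pv T w (P j)) := posLog_nonneg
    refine max_le ((pv_le_exp_posLog w a).trans ?_) ((pv_le_exp_posLog w (P j)).trans ?_)
    · apply exp_le_exp.2; linarith
    · apply exp_le_exp.2; linarith
  have h2 : pv T w (a - P j) ≤ exp (ew w * log 2 + (log⁺ (pv T w a) + log⁺ (pv T w (P j)))) := by
    rw [exp_add]
    exact h0.trans (by gcongr)
  rw [pv_sub_eq w hj, exp_le_exp] at h2
  have h3 : log⁺ (pv T w (P j)) ≤ ∑ j, log⁺ (pv T w (P j)) := 
    Finset.single_le_sum (f := fun j => log⁺ (pv T w (P j))) (fun _ _ => posLog_nonneg) (Finset.mem_univ j)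
  have h4 : 0 ≤ ∑ i, ∑ j, |log (pv T w (P i - P j))| := 
    Finset.sum_nonneg fun _ _ => Finset.sum_nonneg fun _ _ => abs_nonneg _
  have h5 : 0 ≤ ew w * log 2 := mul_nonneg (ew_nonneg w) (log_nonneg (by norm_num))
  unfold cw; linarith

lemma lam_two (w : Pl T) (a : N) (i j : ι) (hij : P i ≠ P j) (hi : a ≠ P i) (hj : a ≠ P j) :
    lam T w a (P i) ≤ cw P w ∨ lam T w a (P j) ≤ cw P w := by
  set δ := ew w * log 2 with hδ
  have h5 : 0 ≤ δ := mul_nonneg (ew_nonneg w) (log_nonneg (by norm_num))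
  set M := ∑ j, log⁺ (pv T w (P j)) with hM
  have hMi : ∀ i, log⁺ (pv T w (P i)) ≤ M := fun i => 
    Finset.single_le_sum (f := fun j => log⁺ (pv T w (P j))) (fun _ _ => posLog_nonneg) (Finset.mem_univ i)
  have hM0 : 0 ≤ M := Finset.sum_nonneg fun _ _ => posLog_nonneg
  have h4 : |log (pv T w (P i - P j))| ≤ ∑ i, ∑ j, |log (pv T w (P i - P j))| := by
    refine le_trans ?_ (Finset.single_le_sum (f := fun i => ∑ j, |log (pv T w (P i - P j))|) (fun _ _ => Finset.sum_nonneg fun _ _ => abs_nonneg _) (Finset.mem_univ i))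
    exact Finset.single_le_sum (f := fun j => |log (pv T w (P i - P j))|) (fun _ _ => abs_nonneg _) (Finset.mem_univ j)
  have hcw : cw P w = 2 * δ + M + ∑ i, ∑ j, |log (pv T w (P i - P j))| := rfl
  by_cases hL : log⁺ (pv T w a) ≤ δ + M
  · by_contra hcon
    push Not at hcon
    obtain ⟨c1, c2⟩ := hcon
    have h0 := pv_add_le' w (a - P j) (-(a - P i))
    rw [AbsoluteValue.map_neg] at h0
    have e : a - P j + -(a - P i) = P i - P j := by ring
    rw [e] at h0
    have hp := (pv T w).pos (sub_ne_zero.2 hij)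
    have h6 : pv T w (P i - P j) < exp (δ + (log⁺ (pv T w a) - cw P w)) := by
      refine h0.trans_lt ?_
      rw [exp_add, ← hδ]
      apply mul_lt_mul_of_pos_left _ (exp_pos _)
      rw [pv_sub_eq w hi, pv_sub_eq w hj]
      apply max_lt <;> apply exp_lt_exp.2 <;> linarith
    rw [← log_lt_iff_lt_exp hp] at h6
    have := neg_abs_le (log (pv T w (P i - P j)))
    linarith
  · push Not at hL
    left
    have hP : 0 ≤ log⁺ (pv T w (P i)) := posLog_nonneg
    have hpos : 0 < log⁺ (pv T w a) := by linarith
    have ha : log⁺ (pv T w a) = log (pv T w a) := by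
      rw [posLog] at hpos ⊢
      rcases max_choice 0 (log (pv T w a)) with h | h
      · rw [h] at hpos; exact absurd hpos (lt_irrefl _)
      · exact h
    have ha0 : a ≠ 0 := by
      rintro rfl
      simp at hpos
    have hap := (pv T w).pos ha0
    have h0 := pv_add_le' w (a - P i) (P i)
    rw [sub_add_cancel, ← hδ] at h0
    have h7 : exp δ * pv T w (P i) < pv T w a := by
      calc exp δ * pv T w (P i) ≤ exp δ * exp (log⁺ (pv T w (P i))) := by gcongr; exact pv_le_exp_posLog _ _
        _ = exp (δ + log⁺ (pv T w (P i))) := by rw [exp_add]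
        _ < exp (log⁺ (pv T w a)) := by apply exp_lt_exp.2; have := hMi i; linarith
        _ = pv T w a := by rw [ha, exp_log hap]
    have h8 : pv T w a ≤ exp δ * pv T w (a - P i) := by
      rcases max_choice (pv T w (a - P i)) (pv T w (P i)) with h | h
      · rwa [h] at h0
      · rw [h] at h0; linarith
    rw [pv_sub_eq w hi, ← exp_add] at h8
    have h9 := (log_le_iff_le_exp hap).2 h8
    have h10 := abs_nonneg (log (pv T w (P i - P j)))
    rw [← ha] at h9
    linarith

lemma sum_cw (hP : ∀ j, P j = 0 ∨ GoodT T (P j)) (hPP : ∀ i j, P i - P j = 0 ∨ GoodT T (P i - P j)) :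
    ∑ w : Pl T, cw P w ≤ Module.finrank ℚ N * (2 * log 2) + ∑ j, logHeight₁ (P j) + 
      ∑ i, ∑ j, 2 * logHeight₁ (P i - P j) := by
  unfold cw
  rw [Finset.sum_add_distrib, Finset.sum_add_distrib, ← Finset.mul_sum, ← Finset.sum_mul, sum_ew]
  have h1 : ∑ w : Pl T, ∑ j, log⁺ (pv T w (P j)) ≤ ∑ j, logHeight₁ (P j) := by
    rw [Finset.sum_comm]
    refine Finset.sum_le_sum fun j _ => ?_
    rcases hP j with h | h
    · rw [h]; simp
    · rw [pl_sum_posLog h]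
  have h2 : ∑ w : Pl T, ∑ i, ∑ j, |log (pv T w (P i - P j))| ≤ ∑ i, ∑ j, 2 * logHeight₁ (P i - P j) := by
    rw [Finset.sum_comm]
    refine Finset.sum_le_sum fun i _ => ?_
    rw [Finset.sum_comm]
    refine Finset.sum_le_sum fun j _ => ?_
    rcases hPP i j with h | h
    · rw [h]; simp
    · rw [pl_sum_abs_log h]
  linarith

end local1
end MT
end partF1

section partF2
open NumberField Height Real Polynomial

namespace MT

section rootl
variable {N : Type} [Field N] [NumberField N] {T : Finset (FinitePlace N)}

lemma root_step (w : Pl T) (a : N) (V : N[X]) (M : ℝ) (hM : 0 ≤ M)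
    (hD : exp (ew w * log 2) ≤ pv T w a) (h : ∀ i, pv T w (((X - C a) * V).coeff i) ≤ M) (i : ℕ) :
    pv T w (V.coeff i) ≤ exp (ew w * log 2) / pv T w a * M := by
  set D := exp (ew w * log 2) with hDd
  have hD0 : 0 < D := exp_pos _
  have ha : 0 < pv T w a := hD0.trans_le hD
  have key : ∀ i : ℕ, pv T w (a * V.coeff i) ≤ D * M := by
    intro i
    induction i with
    | zero =>
      have h0 := h 0
      have e : ((X - C a) * V).coeff 0 = -(a * V.coeff 0) := by
        rw [mul_coeff_zero]; simp
      rw [e, AbsoluteValue.map_neg] at h0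
      have h1 : 1 ≤ D := one_le_exp (mul_nonneg (ew_nonneg w) (log_nonneg (by norm_num)))
      nlinarith
    | succ k ih =>
      have h0 := h (k + 1)
      have e : a * V.coeff (k+1) = V.coeff k + -(((X - C a) * V).coeff (k + 1)) := by
        rw [sub_mul, coeff_sub, coeff_X_mul, coeff_C_mul]; ring
      rw [e]
      refine (pv_add_le' w _ _).trans ?_
      rw [AbsoluteValue.map_neg]
      apply mul_le_mul_of_nonneg_left _ hD0.le
      refine max_le ?_ h0
      rw [map_mul] at ih
      have : pv T w (V.coeff k) * D ≤ M * D := by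
        calc _ ≤ pv T w (V.coeff k) * pv T w a := by gcongr
          _ ≤ _ := by linarith
      exact le_of_mul_le_mul_right this hD0
  have := key i
  rw [map_mul] at this
  rw [div_mul_eq_mul_div, le_div_iff₀ ha]; linarith

lemma root_local (w : Pl T) (a : N) (m : ℕ) (V : N[X]) (hV : V ≠ 0) (M : ℝ)
    (h : ∀ i, pv T w (((X - C a) ^ m * V).coeff i) ≤ exp M) :
    log (pv T w V.leadingCoeff) + m * log⁺ (pv T w a) ≤ m * (ew w * log 2) + M := by
  have hpos : 0 < pv T w V.leadingCoeff := (pv T w).pos (leadingCoeff_ne_zero.2 hV)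
  have hδ : 0 ≤ ew w * log 2 := mul_nonneg (ew_nonneg w) (log_nonneg (by norm_num))
  by_cases hD : exp (ew w * log 2) ≤ pv T w a
  · have hap : 0 < pv T w a := (exp_pos _).trans_le hD
    have hl := (le_log_iff_exp_le hap).2 hD
    have hpl : log⁺ (pv T w a) = log (pv T w a) := by
      rw [posLog]; exact max_eq_right (hδ.trans hl)
    have key : ∀ (m : ℕ) (M : ℝ), (∀ i, pv T w (((X - C a) ^ m * V).coeff i) ≤ exp M) → 
        ∀ i, pv T w (V.coeff i) ≤ exp (m * (ew w * log 2 - log (pv T w a)) + M) := by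
      intro m
      induction m with
      | zero => intro M h i; simpa using h i
      | succ k ih =>
        intro M h i
        have := ih (ew w * log 2 - log (pv T w a) + M) (fun i => by
          refine (root_step w a ((X - C a) ^ k * V) (exp M) (exp_pos _).le hD (fun i => ?_) i).trans (le_of_eq ?_)
          · rw [← mul_assoc, ← pow_succ']; exact h i
          · rw [exp_add, exp_sub, exp_log hap]) i
        refine this.trans (le_of_eq ?_)
        push_cast; ring_nf
    have := key m M h V.natDegree
    rw [← log_le_iff_le_exp (by exact hpos)] at this
    change log (pv T w V.leadingCoeff) ≤ _ at this
    rw [hpl]; nlinarith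
  · push Not at hD
    have hpl : log⁺ (pv T w a) ≤ ew w * log 2 := by
      rcases eq_or_ne a 0 with rfl | ha
      · simpa using hδ
      · rw [posLog]; refine max_le hδ ?_
        exact ((log_lt_iff_lt_exp ((pv T w).pos ha)).2 hD).le
    have h1 : pv T w V.leadingCoeff ≤ exp M := by
      have := h ((X - C a) ^ m * V).natDegree
      change pv T w (leadingCoeff _) ≤ _ at this
      rwa [leadingCoeff_mul, leadingCoeff_pow, leadingCoeff_X_sub_C, one_pow, one_mul] at this
    rw [← log_le_iff_le_exp hpos] at h1
    have : m * log⁺ (pv T w a) ≤ m * (ew w * log 2) := by gcongr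
    linarith

/-- multiplicity of a root of large height is bounded -/
lemma root_mult {K : Type} [Field K] [NumberField K] [Algebra K N] (U : (𝓞 K)[X]) (hU : U ≠ 0) (a : N)
    (m : ℕ) (M : ℝ) (hM : ∀ i, house (U.coeff i : K) ≤ exp M)
    (h : (X - C a) ^ m ∣ U.map ((algebraMap K N).comp (algebraMap (𝓞 K) K))) :
    m * logHeight₁ a ≤ Module.finrank ℚ N * (m * log 2 + M) := by
  classical
  obtain ⟨V, hV⟩ := h
  set U' := U.map ((algebraMap K N).comp (algebraMap (𝓞 K) K)) with hU'
  have hinj : Function.Injective ((algebraMap K N).comp (algebraMap (𝓞 K) K)) := by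
    rw [RingHom.coe_comp]
    exact (algebraMap K N).injective.comp RingOfIntegers.coe_injective
  have hU0 : U' ≠ 0 := by rwa [hU', Ne, Polynomial.map_eq_zero_iff hinj]
  have hV0 : V ≠ 0 := by rintro rfl; rw [mul_zero] at hV; exact hU0 hV
  rcases eq_or_ne a 0 with rfl | ha0
  · rw [logHeight₁_zero, mul_zero]
    have : 0 ≤ M := by
      have h1 := hM U.natDegree
      have h2 := one_le_house_of_isIntegral (K := K) (α := (U.leadingCoeff : K)) (RingOfIntegers.isIntegral_coe _)
        (by simpa using hU)
      have := h2.trans h1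
      rwa [one_le_exp_iff] at this
    have := log_nonneg (by norm_num : (1:ℝ) ≤ 2)
    positivity
  obtain ⟨T, hT⟩ := exists_goodT {a, V.leadingCoeff} (by
    intro x hx; simp only [Finset.mem_insert, Finset.mem_singleton] at hx
    rcases hx with rfl | rfl
    · exact ha0
    · exact leadingCoeff_ne_zero.2 hV0)
  have h1 := pl_sum_log (hT V.leadingCoeff (by simp))
  have h2 := pl_sum_posLog (hT a (by simp))
  have h3 : ∀ w : Pl T, log (pv T w V.leadingCoeff) + m * log⁺ (pv T w a) ≤ m * (ew w * log 2) + ew w * M := by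
    intro w
    apply root_local w a m V hV0
    intro i
    rw [← hV, hU', coeff_map]
    exact pv_int_le w _ M (hM i)
  have h4 := Finset.sum_le_sum (s := Finset.univ) fun w _ => h3 w
  rw [Finset.sum_add_distrib, h1, ← Finset.mul_sum, h2, Finset.sum_add_distrib, ← Finset.mul_sum, ← Finset.sum_mul, ← Finset.sum_mul, sum_ew] at h4
  linarith

end rootl
end MT
end partF2

section partF3
open NumberField Height Real Polynomial

namespace MT

section theta
variable {R : Type} [CommRing R]

noncomputable def th (U : R[X]) : R[X] := X * derivative U

lemma th_coeff (U : R[X]) (n : ℕ) : (th U).coeff n = n * U.coeff n := by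
  unfold th
  cases n with
  | zero => simp
  | succ n => rw [coeff_X_mul, coeff_derivative]; push_cast; ring

lemma thk_coeff (U : R[X]) (k n : ℕ) : (th^[k] U).coeff n = (n : R) ^ k * U.coeff n := by
  induction k generalizing U with
  | zero => simp
  | succ k ih => rw [Function.iterate_succ_apply, ih, th_coeff]; ring

lemma thk_map {S : Type} [CommRing S] (f : R →+* S) (U : R[X]) (k : ℕ) :
    (th^[k] U).map f = th^[k] (U.map f) := by
  ext n; simp [thk_coeff]

lemma th_dvd (a : R) (m : ℕ) (U : R[X]) (h : (X - C a) ^ m ∣ U) : (X - C a) ^ (m - 1) ∣ th U := by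
  obtain ⟨V, rfl⟩ := h
  unfold th
  rw [derivative_mul, derivative_X_sub_C_pow]
  refine Dvd.dvd.mul_left (dvd_add ?_ ?_) _
  · exact Dvd.dvd.mul_right (Dvd.intro_left _ rfl) _
  · exact Dvd.dvd.mul_right (pow_dvd_pow _ (Nat.sub_le _ _)) _

lemma thk_dvd (a : R) (m k : ℕ) (U : R[X]) (h : (X - C a) ^ m ∣ U) : (X - C a) ^ (m - k) ∣ th^[k] U := by
  induction k generalizing U m with
  | zero => simpa using h
  | succ k ih =>
    rw [Function.iterate_succ_apply]
    have := ih _ _ (th_dvd a m U h)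
    rwa [Nat.sub_sub, add_comm 1 k] at this

end theta

lemma wron_ne {K : Type} [Field K] [CharZero K] {r : ℕ} (q : Fin r → K[X]) (hq : LinearIndependent K q) :
    (Matrix.of fun (i k : Fin r) => th^[(k : ℕ)] (q i)).det ≠ 0 := by
  classical
  intro hdet
  obtain ⟨g, hg0, hg⟩ := Matrix.exists_mulVec_eq_zero_iff.2 hdet
  have hgi : ∀ i, ∑ k : Fin r, th^[(k : ℕ)] (q i) * g k = 0 := fun i => congrFun hg i
  set t := Finset.univ.sup (fun k => (g k).natDegree) with ht
  have hgt : ∀ k, (g k).natDegree ≤ t := fun k => Finset.le_sup (f := fun k => (g k).natDegree) (Finset.mem_univ k)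
  -- the indicial polynomial
  set Q : K[X] := ∑ k : Fin r, C ((g k).coeff t) * X ^ (k : ℕ) with hQ
  have hQc : ∀ k : Fin r, Q.coeff k = (g k).coeff t := by
    intro k
    rw [hQ, finsetSum_coeff]
    simp only [coeff_C_mul, coeff_X_pow]
    rw [Finset.sum_eq_single k]
    · simp
    · intro b _ hb
      have : (k:ℕ) ≠ b := fun h => hb (Fin.ext h.symm)
      simp [this]
    · simp
  have hQ0 : Q ≠ 0 := by
    intro h0
    obtain ⟨k0, hk0⟩ := Function.ne_iff.1 hg0
    obtain ⟨k1, -, hk1⟩ := Finset.exists_mem_eq_sup Finset.univ ⟨k0, Finset.mem_univ _⟩ (fun k => (g k).natDegree)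
    have hz : ∀ k, (g k).coeff t = 0 := fun k => by rw [← hQc, h0, coeff_zero]
    have h1 := hz k1
    rw [ht, hk1] at h1
    have h2 : g k1 = 0 := leadingCoeff_eq_zero.1 h1
    have h3 : t = 0 := by rw [ht, hk1, h2, natDegree_zero]
    apply hk0
    have h4 := hz k0
    have h5 := hgt k0
    rw [h3] at h4 h5
    have := eq_C_of_natDegree_le_zero h5
    rw [this, h4]; simp
  have hQd : Q.natDegree < r := by
    have hr : 0 < r := by
      obtain ⟨k0, -⟩ := Function.ne_iff.1 hg0
      exact k0.pos
    rw [hQ]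
    refine (natDegree_sum_le_of_forall_le (n := r - 1) _ _ fun k _ => ?_).trans_lt (by omega)
    refine (natDegree_C_mul_X_pow_le _ _).trans ?_
    have := k.2; omega
  -- degrees are roots
  set V := Submodule.span K (Set.range q) with hV
  have hLV : ∀ U ∈ V, ∑ k : Fin r, th^[(k : ℕ)] U * g k = 0 := by
    intro U hU
    have hadd : ∀ (k : ℕ) (U U' : K[X]), th^[k] (U + U') = th^[k] U + th^[k] U' := by
      intro k U U'; ext n; simp [thk_coeff, mul_add]
    have hsm : ∀ (k : ℕ) (c : K) (U : K[X]), th^[k] (c • U) = c • th^[k] U := by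
      intro k c U; ext n; simp [thk_coeff]; ring
    refine Submodule.span_induction ?_ ?_ ?_ ?_ hU
    · rintro _ ⟨i, rfl⟩; exact hgi i
    · refine Finset.sum_eq_zero fun k _ => ?_
      have : th^[(k:ℕ)] (0 : K[X]) = 0 := by ext n; simp [thk_coeff]
      rw [this, zero_mul]
    · intro x y _ _ hx hy
      simp only [hadd, add_mul, Finset.sum_add_distrib, hx, hy, add_zero]
    · intro c x _ hx
      simp only [hsm, smul_mul_assoc, ← Finset.smul_sum, hx, smul_zero]
  have hdeg : ∀ U ∈ V, U ≠ 0 → Q.IsRoot (U.natDegree : K) := by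
    intro U hU hU0
    have h1 := congrArg (fun W => coeff W (U.natDegree + t)) (hLV U hU)
    simp only [finsetSum_coeff, coeff_zero] at h1
    have h2 : ∀ k : Fin r, (th^[(k : ℕ)] U * g k).coeff (U.natDegree + t) = 
        (U.natDegree : K) ^ (k : ℕ) * U.leadingCoeff * (g k).coeff t := by
      intro k
      rw [coeff_mul_add_eq_of_natDegree_le ?_ (hgt k), thk_coeff]
      · rfl
      · rw [natDegree_le_iff_coeff_eq_zero]
        intro n hn
        rw [thk_coeff, coeff_eq_zero_of_natDegree_lt hn, mul_zero]
    simp only [h2] at h1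
    have h3 : U.leadingCoeff * Q.eval (U.natDegree : K) = 0 := by
      rw [← h1, hQ, eval_finsetSum, Finset.mul_sum]
      refine Finset.sum_congr rfl fun k _ => ?_
      simp; ring
    exact (mul_eq_zero.1 h3).resolve_left (leadingCoeff_ne_zero.2 hU0)
  set D : Finset ℕ := Q.roots.toFinset.preimage (fun n : ℕ => (n : K)) (Nat.cast_injective.injOn) with hD
  have hDmem : ∀ U ∈ V, U ≠ 0 → U.natDegree ∈ D := by
    intro U hU hU0
    rw [hD, Finset.mem_preimage, Multiset.mem_toFinset, mem_roots hQ0]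
    exact hdeg U hU hU0
  have hDc : D.card < r := by
    calc D.card ≤ Q.roots.toFinset.card := Finset.card_le_card_of_injOn (fun n : ℕ => (n : K))
          (fun n hn => by simpa [hD] using hn) (Nat.cast_injective.injOn)
      _ ≤ Q.natDegree := (Multiset.toFinset_card_le _).trans (card_roots' _)
      _ < r := hQd
  let φ : V →ₗ[K] (D → K) := LinearMap.pi (fun n : D => (lcoeff K n.1).comp V.subtype)
  have hφ : Function.Injective φ := by
    rw [injective_iff_map_eq_zero]
    intro U hU
    by_contra hne
    have hne' : (U : K[X]) ≠ 0 := fun h => hne (Subtype.ext h)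
    have := congrFun hU ⟨_, hDmem U U.2 hne'⟩
    exact leadingCoeff_ne_zero.2 hne' this
  have h1 := LinearMap.finrank_le_finrank_of_injective hφ
  rw [Module.finrank_fintype_fun_eq_card, Fintype.card_coe, finrank_span_eq_card hq, Fintype.card_fin] at h1
  omega

section len
variable {K : Type} [Field K] [NumberField K]

noncomputable def len (U : (𝓞 K)[X]) : ℝ := ∑ i ∈ U.support, house (U.coeff i : K)

lemma house_zero' : house (0 : K) = 0 := by simpa using house_intCast (K := K) 0
lemma house_one' : house (1 : K) = 1 := by simpa using house_intCast (K := K) 1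
lemma house_neg' (x : K) : house (-x) = house x := by
  unfold house; rw [map_neg, norm_neg]

lemma len_eq (U : (𝓞 K)[X]) (s : Finset ℕ) (h : U.support ⊆ s) : len U = ∑ i ∈ s, house (U.coeff i : K) := by
  refine Finset.sum_subset h fun i _ hi => ?_
  rw [notMem_support_iff.1 hi]; simpa using house_zero'

lemma len_nonneg (U : (𝓞 K)[X]) : 0 ≤ len U := Finset.sum_nonneg fun _ _ => house_nonneg _

lemma house_coeff_le_len (U : (𝓞 K)[X]) (i : ℕ) : house (U.coeff i : K) ≤ len U := by
  rw [len_eq U (U.support ∪ {i}) Finset.subset_union_left]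
  exact Finset.single_le_sum (f := fun i => house (U.coeff i : K)) (fun _ _ => house_nonneg _) (by simp)

lemma len_add (U V : (𝓞 K)[X]) : len (U + V) ≤ len U + len V := by
  classical
  rw [len_eq (U + V) (U.support ∪ V.support) support_add, len_eq U (U.support ∪ V.support) Finset.subset_union_left,
    len_eq V (U.support ∪ V.support) Finset.subset_union_right, ← Finset.sum_add_distrib]
  refine Finset.sum_le_sum fun i _ => ?_
  simp only [RingOfIntegers.coe_eq_algebraMap, coeff_add, map_add]; exact house_add_le _ _

lemma len_zero : len (0 : (𝓞 K)[X]) = 0 := by simp [len]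

lemma len_sum {ι : Type} (s : Finset ι) (f : ι → (𝓞 K)[X]) : len (∑ i ∈ s, f i) ≤ ∑ i ∈ s, len (f i) := by
  classical
  induction s using Finset.induction_on with
  | empty => simp [len_zero]
  | insert a s ha ih => 
    rw [Finset.sum_insert ha, Finset.sum_insert ha]
    exact (len_add _ _).trans (by gcongr)

lemma len_monomial (n : ℕ) (c : 𝓞 K) : len (monomial n c) = house (c : K) := by
  rw [len_eq _ {n} (support_monomial_subset n c)]; simp

lemma len_mul (U V : (𝓞 K)[X]) : len (U * V) ≤ len U * len V := by
  have : U * V = ∑ i ∈ U.support, ∑ j ∈ V.support, monomial (i + j) (U.coeff i * V.coeff j) := by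
    conv_lhs => rw [U.as_sum_support, V.as_sum_support]
    rw [Finset.sum_mul_sum]
    simp only [monomial_mul_monomial]
  rw [this]
  refine (len_sum _ _).trans ?_
  unfold len
  rw [Finset.sum_mul_sum]
  refine Finset.sum_le_sum fun i _ => (len_sum _ _).trans (Finset.sum_le_sum fun j _ => ?_)
  rw [len_monomial]; simp only [RingOfIntegers.coe_eq_algebraMap, map_mul]
  exact house_mul_le _ _

lemma len_one : len (1 : (𝓞 K)[X]) = 1 := by
  rw [← monomial_zero_one, len_monomial]; simpa using house_one'

lemma len_neg (U : (𝓞 K)[X]) : len (-U) = len U := by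
  unfold len; rw [support_neg]
  refine Finset.sum_congr rfl fun i _ => ?_
  simp only [RingOfIntegers.coe_eq_algebraMap, coeff_neg, map_neg, house_neg']

lemma len_prod {ι : Type} (s : Finset ι) (f : ι → (𝓞 K)[X]) : len (∏ i ∈ s, f i) ≤ ∏ i ∈ s, len (f i) := by
  classical
  induction s using Finset.induction_on with
  | empty => simp [len_one]
  | insert a s ha ih => 
    rw [Finset.prod_insert ha, Finset.prod_insert ha]
    refine (len_mul _ _).trans ?_
    have := len_nonneg (f a)
    gcongr

lemma len_det {r : ℕ} (M : Matrix (Fin r) (Fin r) (𝓞 K)[X]) (L : ℝ) (hL : ∀ i j, len (M i j) ≤ L) :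
    len M.det ≤ r.factorial * L ^ r := by
  rw [Matrix.det_apply]
  refine (len_sum _ _).trans ?_
  have : ∀ σ ∈ (Finset.univ : Finset (Equiv.Perm (Fin r))), len (Equiv.Perm.sign σ • ∏ i, M (σ i) i) ≤ L ^ r := by
    intro σ _
    have h1 : len (Equiv.Perm.sign σ • ∏ i, M (σ i) i) = len (∏ i, M (σ i) i) := by
      rcases Int.units_eq_one_or (Equiv.Perm.sign σ) with h | h
      · rw [h, one_smul]
      · rw [h, Units.neg_smul, one_smul, len_neg]
    rw [h1]
    refine (len_prod _ _).trans ?_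
    refine (Finset.prod_le_prod (fun _ _ => len_nonneg _) fun i _ => hL _ _).trans ?_
    simp
  refine (Finset.sum_le_sum this).trans ?_
  rw [Finset.sum_const, Finset.card_univ, Fintype.card_perm, Fintype.card_fin, nsmul_eq_mul]

lemma len_thk (U : (𝓞 K)[X]) (d1 k : ℕ) (hd : U.natDegree ≤ d1) (M : ℝ) (hM : ∀ i, house (U.coeff i : K) ≤ M) :
    len (th^[k] U) ≤ (d1 + 1) * (d1 ^ k * M) := by
  have hM0 : 0 ≤ M := (house_nonneg _).trans (hM 0)
  have hs : (th^[k] U).support ⊆ Finset.range (d1 + 1) := by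
    intro i hi
    rw [Finset.mem_range]
    by_contra h
    rw [mem_support_iff, thk_coeff, coeff_eq_zero_of_natDegree_lt (by omega), mul_zero] at hi
    exact hi rfl
  rw [len_eq _ _ hs]
  have : ∀ i ∈ Finset.range (d1 + 1), house ((th^[k] U).coeff i : K) ≤ d1 ^ k * M := by
    intro i hi
    rw [Finset.mem_range] at hi
    rw [thk_coeff, RingOfIntegers.coe_eq_algebraMap, map_mul, map_pow, map_natCast, ← Nat.cast_pow, house_nat_mul]
    have h1 : ((i ^ k : ℕ) : ℝ) ≤ d1 ^ k := by
      push_cast; gcongr; omega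
    exact mul_le_mul h1 (hM i) (house_nonneg _) (by positivity)
  refine (Finset.sum_le_sum this).trans ?_
  rw [Finset.sum_const, Finset.card_range, nsmul_eq_mul]; push_cast; rfl

end len
end MT
end partF3

section partF4
open NumberField Height Real Polynomial

namespace MT

noncomputable def zM (d d1 : ℕ) (M : ℝ) : ℝ :=
  log ((d + 1).factorial) + (d + 1) * ((d + 1) * log (d1 + 1) + M)

lemma zero_est {K : Type} [Field K] [NumberField K] {N : Type} [Field N] [NumberField N] [Algebra K N]
    (d d1 : ℕ) (P : Fin (d + 1) → (𝓞 K)[X]) (hdeg : ∀ b, (P b).natDegree ≤ d1) (M : ℝ) (hM0 : 0 ≤ M)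
    (hM : ∀ b i, house ((P b).coeff i : K) ≤ exp M) (a a' : N) (m : ℕ)
    (hF : ∑ b : Fin (d + 1), C (a' ^ (b : ℕ)) * (P b).map ((algebraMap K N).comp (algebraMap (𝓞 K) K)) ≠ 0)
    (hdvd : (X - C a) ^ m ∣ ∑ b : Fin (d + 1), C (a' ^ (b : ℕ)) * (P b).map ((algebraMap K N).comp (algebraMap (𝓞 K) K))) :
    ((m - d : ℕ) : ℝ) * logHeight₁ a ≤ Module.finrank ℚ N * ((m - d : ℕ) * log 2 + zM d d1 M) := by
  classical
  set iK := algebraMap (𝓞 K) K with hiK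
  set iN := (algebraMap K N).comp iK with hiN
  set F := ∑ b : Fin (d + 1), C (a' ^ (b : ℕ)) * (P b).map iN with hFd
  obtain ⟨κ, e0, he0, hspan, hli⟩ := exists_linearIndependent' K (fun b => (P b).map iK)
  have : Finite κ := Finite.of_injective e0 he0
  obtain ⟨r, ⟨e1⟩⟩ := Finite.exists_equiv_fin κ
  set e : Fin r → Fin (d + 1) := e0 ∘ e1.symm with he
  have hinj : Function.Injective e := he0.comp e1.symm.injective
  have hr : r ≤ d + 1 := by simpa using Fintype.card_le_of_injective e hinj
  have hli' : LinearIndependent K (fun i => (P (e i)).map iK) := hli.comp _ e1.symm.injective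
  have hsp : ∀ b, ∃ c : Fin r → K, ∑ i, c i • (P (e i)).map iK = (P b).map iK := by
    intro b
    rw [← Submodule.mem_span_range_iff_exists_fun]
    have h1 : (P b).map iK ∈ Submodule.span K (Set.range (fun b => (P b).map iK)) := Submodule.subset_span ⟨b, rfl⟩
    rw [← hspan] at h1
    have hrange : Set.range ((fun b => (P b).map iK) ∘ e0) = Set.range (fun i => (P (e i)).map iK) := by
      apply Set.ext; intro x; constructor
      · rintro ⟨i, rfl⟩; exact ⟨e1 i, by simp [he]⟩
      · rintro ⟨i, rfl⟩; exact ⟨e1.symm i, rfl⟩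
    rw [hrange] at h1
    exact h1
  choose c hc using hsp
  set Q : Fin r → N := fun i => ∑ b : Fin (d + 1), a' ^ (b : ℕ) * algebraMap K N (c b i) with hQ
  have hFQ : F = ∑ i, C (Q i) * (P (e i)).map iN := by
    have h1 : ∀ b, (P b).map iN = ∑ i, C (algebraMap K N (c b i)) * (P (e i)).map iN := by
      intro b
      have := congrArg (Polynomial.map (algebraMap K N)) (hc b)
      rw [Polynomial.map_map, Polynomial.map_sum] at this
      rw [← hiN] at this
      rw [← this]
      refine Finset.sum_congr rfl fun i _ => ?_
      rw [smul_eq_C_mul, Polynomial.map_mul, map_C, Polynomial.map_map]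
    rw [hFd]
    simp only [hQ]
    conv_lhs => enter [2, b]; rw [h1 b, Finset.mul_sum]
    rw [Finset.sum_comm]
    refine Finset.sum_congr rfl fun i _ => ?_
    rw [map_sum, Finset.sum_mul]
    refine Finset.sum_congr rfl fun b _ => ?_
    rw [C_mul, mul_assoc]
  obtain ⟨i0, hi0⟩ : ∃ i, Q i ≠ 0 := by
    by_contra h
    push Not at h
    apply hF
    rw [hFQ]
    exact Finset.sum_eq_zero fun i _ => by rw [h i, C_0, zero_mul]
  set Mo : Matrix (Fin r) (Fin r) (𝓞 K)[X] := Matrix.of fun i k => th^[(k : ℕ)] (P (e i)) with hMo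
  have hdet0 : Mo.det ≠ 0 := by
    intro h0
    apply wron_ne _ hli'
    have h1 := congrArg (Polynomial.mapRingHom iK) h0
    rw [RingHom.map_det, map_zero] at h1
    rw [← h1]
    congr 1
    ext1 i k
    simp [hMo, thk_map]
  set MN : Matrix (Fin r) (Fin r) N[X] := Matrix.of fun i k => th^[(k : ℕ)] ((P (e i)).map iN) with hMN
  have hdetN : Mo.det.map iN = MN.det := by
    have := RingHom.map_det (Polynomial.mapRingHom iN) Mo
    rw [coe_mapRingHom] at this
    rw [this]
    congr 1
    ext1 i k
    simp [hMo, hMN, thk_map]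
  have hvec : Matrix.vecMul (fun i => C (Q i)) MN = fun k : Fin r => th^[(k : ℕ)] F := by
    ext1 k
    rw [hFQ]
    ext1 n
    simp [Matrix.vecMul, dotProduct, hMN, thk_coeff, finsetSum_coeff, Finset.mul_sum]
    refine Finset.sum_congr rfl fun i _ => by ring
  have hdvdW : (X - C a) ^ (m - d) ∣ MN.det := by
    have h1 : C (Q i0) * MN.det = Matrix.vecMul (fun k : Fin r => th^[(k : ℕ)] F) MN.adjugate i0 := by
      rw [← hvec, Matrix.vecMul_vecMul, Matrix.mul_adjugate, Matrix.vecMul_smul, Matrix.vecMul_one]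
      simp [mul_comm]
    have h2 : (X - C a) ^ (m - d) ∣ C (Q i0) * MN.det := by
      rw [h1]
      rw [Matrix.vecMul, dotProduct]
      refine Finset.dvd_sum fun k _ => Dvd.dvd.mul_right ?_ _
      refine (pow_dvd_pow _ ?_).trans (thk_dvd a m k F hdvd)
      have := k.2; omega
    rwa [(isUnit_C.2 (IsUnit.mk0 _ hi0)).dvd_mul_left] at h2
  rw [← hdetN] at hdvdW
  refine root_mult Mo.det hdet0 a (m - d) (zM d d1 M) (fun i => ?_) hdvdW
  refine (house_coeff_le_len _ i).trans ?_
  have hd1 : (1:ℝ) ≤ d1 + 1 := by have := Nat.cast_nonneg (α := ℝ) d1; linarith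
  have hexp : (1:ℝ) ≤ exp M := one_le_exp hM0
  have hL : ∀ i j, len (Mo i j) ≤ (d1 + 1) ^ (d + 1) * exp M := by
    intro i j
    refine (len_thk (P (e i)) d1 j (hdeg _) (exp M) (hM _)).trans ?_
    rw [← mul_assoc, pow_succ']
    gcongr
    calc (d1 : ℝ) ^ (j : ℕ) ≤ (d1 + 1) ^ (j : ℕ) := by gcongr; linarith
      _ ≤ (d1 + 1) ^ d := by
        apply pow_le_pow_right₀ hd1
        have := j.2; omega
  refine (len_det Mo _ hL).trans ?_
  have hLL : (1:ℝ) ≤ (d1 + 1) ^ (d + 1) * exp M := one_le_mul_of_one_le_of_one_le (one_le_pow₀ hd1) hexp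
  calc (r.factorial : ℝ) * ((d1 + 1) ^ (d + 1) * exp M) ^ r
      ≤ (d + 1).factorial * ((d1 + 1) ^ (d + 1) * exp M) ^ (d + 1) := by
        gcongr
    _ = exp (zM d d1 M) := by
        unfold zM
        rw [exp_add, exp_log (by positivity)]
        congr 1
        have : ((d:ℝ) + 1) = ((d + 1 : ℕ) : ℝ) := by push_cast; rfl
        rw [this, exp_nat_mul, exp_add, exp_nat_mul, exp_log (by linarith)]

end MT
end partF4

section partF5
open NumberField Height Real Polynomial

namespace MT

lemma binom_taylor {R : Type} [CommRing R] (a P : R) (x m d1 : ℕ) (hx : x ≤ d1) :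
    (x.choose m : R) * a ^ (x - m) = ∑ i ∈ Finset.range (d1 + 1),
      ((x.choose i : R) * P ^ (x - i)) * ((i.choose m : R) * (a - P) ^ (i - m)) := by
  have h1 : ∀ (b : R) (n : ℕ), (hasseDeriv m ((X : R[X]) ^ n)).eval b = (n.choose m : R) * b ^ (n - m) := by
    intro b n
    rw [← monomial_one_right_eq_X_pow, hasseDeriv_monomial, eval_monomial, mul_one]
  have h2 : (taylor P ((X : R[X]) ^ x)) = ∑ i ∈ Finset.range (d1 + 1), C ((x.choose i : R) * P ^ (x - i)) * X ^ i := by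
    rw [taylor_X_pow, add_pow]
    have : Finset.range (x + 1) ⊆ Finset.range (d1 + 1) := Finset.range_mono (by omega)
    rw [← Finset.sum_subset this]
    · refine Finset.sum_congr rfl fun i _ => ?_
      simp; ring
    · intro i _ hi
      rw [Finset.mem_range, not_lt] at hi
      rw [Nat.choose_eq_zero_of_lt (by omega)]; simp
  rw [← h1, ← taylor_coeff]
  have h3 : taylor a ((X : R[X]) ^ x) = taylor (a - P) (taylor P (X ^ x)) := by
    rw [taylor_taylor, sub_add_cancel]
  rw [h3, h2, taylor_coeff, map_sum, eval_finsetSum]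
  refine Finset.sum_congr rfl fun i _ => ?_
  rw [← smul_eq_C_mul, map_smul, eval_smul, h1, smul_eq_mul]

section nu
variable {K : Type} [Field K] [NumberField K] {N : Type} [Field N] [NumberField N] [Algebra K N]

noncomputable def nu (d1 d2 : ℕ) (p : ℕ → ℕ → 𝓞 K) (m : ℕ) (a a' : N) : N :=
  ∑ x ∈ Finset.range (d1 + 1), ∑ y ∈ Finset.range (d2 + 1),
    algebraMap K N (p x y) * (((x.choose m : N) * a ^ (x - m)) * a' ^ y)

noncomputable def tt (d1 d2 : ℕ) (p : ℕ → ℕ → 𝓞 K) (P P' : 𝓞 K) (i i' : ℕ) : 𝓞 K :=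
  ∑ x ∈ Finset.range (d1 + 1), ∑ y ∈ Finset.range (d2 + 1),
    p x y * (((x.choose i : 𝓞 K) * P ^ (x - i)) * ((y.choose i' : 𝓞 K) * P' ^ (y - i')))

lemma nu_expand (d1 d2 : ℕ) (p : ℕ → ℕ → 𝓞 K) (m : ℕ) (a a' : N) (P P' : 𝓞 K) :
    nu d1 d2 p m a a' = ∑ i ∈ Finset.range (d1 + 1), ∑ i' ∈ Finset.range (d2 + 1),
      algebraMap K N (tt d1 d2 p P P' i i') * (((i.choose m : N) * (a - algebraMap K N P) ^ (i - m)) * (a' - algebraMap K N P') ^ i') := by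
  have e : ∀ i i', algebraMap K N (tt d1 d2 p P P' i i') = ∑ x ∈ Finset.range (d1 + 1), ∑ y ∈ Finset.range (d2 + 1),
    algebraMap K N (p x y) * (((x.choose i : N) * (algebraMap K N P) ^ (x - i)) * ((y.choose i' : N) * (algebraMap K N P') ^ (y - i'))) := by
    intro i i'
    simp only [tt, RingOfIntegers.coe_eq_algebraMap, map_sum, map_mul, map_pow, map_natCast]
  simp only [e, Finset.sum_mul]
  have e2 : nu d1 d2 p m a a' = ∑ x ∈ Finset.range (d1 + 1), ∑ y ∈ Finset.range (d2 + 1), 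
      ∑ i ∈ Finset.range (d1 + 1), ∑ i' ∈ Finset.range (d2 + 1),
      algebraMap K N (p x y) * (((x.choose i : N) * (algebraMap K N P) ^ (x - i)) * ((y.choose i' : N) * (algebraMap K N P') ^ (y - i'))) * (((i.choose m : N) * (a - algebraMap K N P) ^ (i - m)) * (a' - algebraMap K N P') ^ i') := by
    unfold nu
    refine Finset.sum_congr rfl fun x hx => Finset.sum_congr rfl fun y hy => ?_
    rw [Finset.mem_range] at hx hy
    have h2 := binom_taylor a' (algebraMap K N P') y 0 d2 (by omega)
    simp only [Nat.choose_zero_right, Nat.cast_one, one_mul, Nat.sub_zero] at h2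
    rw [binom_taylor a (algebraMap K N P) x m d1 (by omega), h2, Finset.sum_mul_sum, Finset.mul_sum]
    refine Finset.sum_congr rfl fun i _ => ?_
    rw [Finset.mul_sum]
    refine Finset.sum_congr rfl fun i' _ => ?_
    ring
  rw [e2]
  conv_lhs => enter [2, x]; rw [Finset.sum_comm]
  rw [Finset.sum_comm]
  refine Finset.sum_congr rfl fun i _ => ?_
  conv_lhs => enter [2, x]; rw [Finset.sum_comm]
  rw [Finset.sum_comm]

noncomputable def GG (d1 d2 : ℕ) (M h0 : ℝ) : ℝ :=
  2 * log ((d1 + 1) * (d2 + 1)) + (d1 + d2) * (2 * log 2 + h0) + M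

lemma choose_le_exp (x m d1 : ℕ) (hx : x ≤ d1) : (x.choose m : ℝ) ≤ exp (d1 * log 2) := by
  rw [exp_nat_mul, exp_log (by norm_num)]
  calc (x.choose m : ℝ) ≤ (2:ℝ) ^ x := by exact_mod_cast Nat.choose_le_two_pow x m
    _ ≤ 2 ^ d1 := pow_le_pow_right₀ (by norm_num) hx

lemma house_choose_pow (P : 𝓞 K) (h0 : ℝ) (h00 : 0 ≤ h0) (hP : house (P : K) ≤ exp h0) (x i d1 : ℕ) (hx : x ≤ d1) :
    house (((x.choose i : 𝓞 K) * P ^ (x - i) : 𝓞 K) : K) ≤ exp (d1 * log 2 + d1 * h0) := by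
  rw [RingOfIntegers.coe_eq_algebraMap, map_mul, map_natCast, house_nat_mul, map_pow, exp_add]
  refine mul_le_mul (choose_le_exp x i d1 hx) ?_ (house_nonneg _) (exp_pos _).le
  refine (house_pow_le _ _).trans ?_
  calc house (P : K) ^ (x - i) ≤ exp h0 ^ (x - i) := by
        have := house_nonneg (P : K)
        gcongr
    _ ≤ exp h0 ^ d1 := pow_le_pow_right₀ (one_le_exp h00) (by omega)
    _ = _ := by rw [exp_nat_mul]

lemma house_tt (d1 d2 : ℕ) (p : ℕ → ℕ → 𝓞 K) (M h0 : ℝ) (h00 : 0 ≤ h0)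
    (hp : ∀ x y, house (p x y : K) ≤ exp M) (P P' : 𝓞 K) (hP : house (P : K) ≤ exp h0) (hP' : house (P' : K) ≤ exp h0)
    (i i' : ℕ) : house (tt d1 d2 p P P' i i' : K) ≤ exp (log ((d1 + 1) * (d2 + 1)) + (d1 + d2) * (log 2 + h0) + M) := by
  have h1 : ∀ x ∈ Finset.range (d1 + 1), ∀ y ∈ Finset.range (d2 + 1), 
      house ((p x y * (((x.choose i : 𝓞 K) * P ^ (x - i)) * ((y.choose i' : 𝓞 K) * P' ^ (y - i'))) : 𝓞 K) : K) ≤ exp ((d1 + d2) * (log 2 + h0) + M) := by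
    intro x hx y hy
    rw [Finset.mem_range] at hx hy
    have a1 := house_choose_pow P h0 h00 hP x i d1 (by omega)
    have a2 := house_choose_pow P' h0 h00 hP' y i' d2 (by omega)
    rw [RingOfIntegers.coe_eq_algebraMap] at a1 a2 ⊢
    rw [map_mul]
    rw [map_mul (algebraMap (𝓞 K) K) ((x.choose i : 𝓞 K) * P ^ (x - i))]
    refine (house_mul_le _ _).trans ?_
    calc _ ≤ exp M * (exp (d1 * log 2 + d1 * h0) * exp (d2 * log 2 + d2 * h0)) := by
          refine mul_le_mul (hp x y) ((house_mul_le _ _).trans ?_) (house_nonneg _) (exp_pos _).le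
          exact mul_le_mul a1 a2 (house_nonneg _) (exp_pos _).le
      _ = _ := by rw [← exp_add, ← exp_add]; ring_nf
  unfold tt
  rw [RingOfIntegers.coe_eq_algebraMap, map_sum]
  refine (house_sum_le_sum_house _ _).trans ?_
  have h2 : ∀ x ∈ Finset.range (d1 + 1), house ((algebraMap (𝓞 K) K) (∑ y ∈ Finset.range (d2 + 1),
    p x y * (((x.choose i : 𝓞 K) * P ^ (x - i)) * ((y.choose i' : 𝓞 K) * P' ^ (y - i'))))) ≤ (d2 + 1) * exp ((d1 + d2) * (log 2 + h0) + M) := by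
    intro x hx
    rw [map_sum]
    refine (house_sum_le_sum_house _ _).trans ?_
    refine (Finset.sum_le_sum fun y hy => h1 x hx y hy).trans ?_
    rw [Finset.sum_const, Finset.card_range, nsmul_eq_mul]; push_cast; rfl
  refine (Finset.sum_le_sum h2).trans ?_
  rw [Finset.sum_const, Finset.card_range, nsmul_eq_mul, add_assoc (log _), exp_add (log _), exp_log (by positivity)]
  push_cast; apply le_of_eq; ring

variable {T : Finset (FinitePlace N)}

lemma log_count (d1 d2 : ℕ) : log (((Finset.range (d1 + 1) ×ˢ Finset.range (d2 + 1)).card : ℕ) : ℝ) = log ((d1 + 1) * (d2 + 1)) := by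
  rw [Finset.card_product, Finset.card_range, Finset.card_range]; push_cast; rfl

lemma log_count_nonneg (d1 d2 : ℕ) : 0 ≤ log (((d1:ℝ) + 1) * (d2 + 1)) := by
  apply log_nonneg
  have := Nat.cast_nonneg (α := ℝ) d1
  have := Nat.cast_nonneg (α := ℝ) d2
  nlinarith

lemma nu_bound1 (w : Pl T) (d1 d2 : ℕ) (p : ℕ → ℕ → 𝓞 K) (M h0 : ℝ) (h00 : 0 ≤ h0)
    (hp : ∀ x y, house (p x y : K) ≤ exp M) (m : ℕ) (a a' : N) :
    pv T w (nu d1 d2 p m a a') ≤ exp (ew w * GG d1 d2 M h0 + d1 * log⁺ (pv T w a) + d2 * log⁺ (pv T w a')) := by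
  set L := log⁺ (pv T w a) with hL
  set L' := log⁺ (pv T w a') with hL'
  have hL0 : 0 ≤ L := posLog_nonneg
  have hL0' : 0 ≤ L' := posLog_nonneg
  have hl2 := log_nonneg (by norm_num : (1:ℝ) ≤ 2)
  have hcount := log_count_nonneg d1 d2
  unfold nu
  rw [← Finset.sum_product']
  have key := pv_sum_le w (Finset.range (d1 + 1) ×ˢ Finset.range (d2 + 1)) 
    (fun z => algebraMap K N (p z.1 z.2) * (((z.1.choose m : N) * a ^ (z.1 - m)) * a' ^ z.2))
    (ew w * M + (ew w * (d1 * log 2) + d1 * L + d2 * L')) (log ((d1 + 1) * (d2 + 1))) hcount (log_count d1 d2).le (by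
      rintro ⟨x, y⟩ hxy
      rw [Finset.mem_product, Finset.mem_range, Finset.mem_range] at hxy
      obtain ⟨hx, hy⟩ := hxy
      simp only at hx hy ⊢
      rw [map_mul, map_mul, map_mul, map_pow, map_pow, exp_add, exp_add, exp_add]
      have b1 : pv T w a ^ (x - m) ≤ exp (d1 * L) := by
        calc pv T w a ^ (x - m) ≤ exp L ^ (x - m) := by
              have := (pv T w).nonneg a
              gcongr; exact pv_le_exp_posLog w a
          _ ≤ exp L ^ d1 := pow_le_pow_right₀ (one_le_exp hL0) (by omega)
          _ = _ := by rw [exp_nat_mul]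
      have b2 : pv T w a' ^ y ≤ exp (d2 * L') := by
        calc pv T w a' ^ y ≤ exp L' ^ y := by
              have := (pv T w).nonneg a'
              gcongr; exact pv_le_exp_posLog w a'
          _ ≤ exp L' ^ d2 := pow_le_pow_right₀ (one_le_exp hL0') (by omega)
          _ = _ := by rw [exp_nat_mul]
      have n1 := (pv T w).nonneg a
      have n2 := (pv T w).nonneg a'
      have n3 := (pv T w).nonneg (x.choose m : N)
      have n4 := (pv T w).nonneg (algebraMap K N (p x y))
      gcongr
      · exact pv_int_le w _ M (hp x y)
      · exact pv_natCast_le w _ _ (choose_le_exp x m d1 (by omega)))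
  refine key.trans (exp_le_exp.2 ?_)
  have he := ew_nonneg w
  have : 0 ≤ ew w * (log ((d1 + 1) * (d2 + 1)) + d1 * log 2 + d2 * (2 * log 2) + (d1 + d2) * h0) := by positivity
  unfold GG
  linarith

lemma nu_bound2 (w : Pl T) (d1 d2 : ℕ) (p : ℕ → ℕ → 𝓞 K) (M h0 : ℝ) (h00 : 0 ≤ h0)
    (hp : ∀ x y, house (p x y : K) ≤ exp M) (m : ℕ) (a a' : N) (P P' : 𝓞 K) (hP : house (P : K) ≤ exp h0) (hP' : house (P' : K) ≤ exp h0)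
    (haP : a ≠ algebraMap K N P) (haP' : a' ≠ algebraMap K N P') (β β' n κ g : ℝ) (hβ : 0 < β) (hβ' : 0 < β') (hn : 0 < n)
    (hvan : ∀ i ≤ d1, ∀ i' ≤ d2, i / β + n * i' / β' < κ → tt d1 d2 p P P' i i' = 0)
    (hg : 0 ≤ g) (hg1 : g ≤ β * lam T w a (algebraMap K N P)) (hg2 : n * g ≤ β' * lam T w a' (algebraMap K N P')) :
    pv T w (nu d1 d2 p m a a') ≤ exp (ew w * GG d1 d2 M h0 + d1 * log⁺ (pv T w a) + d2 * log⁺ (pv T w a')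
      - κ * g + m * lam T w a (algebraMap K N P)) := by
  set L := log⁺ (pv T w a) with hL
  set L' := log⁺ (pv T w a') with hL'
  set l := lam T w a (algebraMap K N P) with hl
  set l' := lam T w a' (algebraMap K N P') with hl'
  have hL0 : 0 ≤ L := posLog_nonneg
  have hL0' : 0 ≤ L' := posLog_nonneg
  have hl2 := log_nonneg (by norm_num : (1:ℝ) ≤ 2)
  have hcount := log_count_nonneg d1 d2
  rw [nu_expand d1 d2 p m a a' P P']
  rw [← Finset.sum_product']
  set Mt := log (((d1:ℝ) + 1) * (d2 + 1)) + (d1 + d2) * (log 2 + h0) + M with hMt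
  have key := pv_sum_le w (Finset.range (d1 + 1) ×ˢ Finset.range (d2 + 1)) 
    (fun z => algebraMap K N (tt d1 d2 p P P' z.1 z.2) * (((z.1.choose m : N) * (a - algebraMap K N P) ^ (z.1 - m)) * (a' - algebraMap K N P') ^ z.2))
    (ew w * Mt + (ew w * (d1 * log 2) + (d1 * L + d2 * L' - κ * g + m * l))) (log ((d1 + 1) * (d2 + 1))) hcount (log_count d1 d2).le (by
      rintro ⟨i, i'⟩ hxy
      rw [Finset.mem_product, Finset.mem_range, Finset.mem_range] at hxy
      obtain ⟨hx, hy⟩ := hxy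
      simp only at hx hy ⊢
      by_cases hv : i / β + n * i' / β' < κ
      · rw [hvan i (by omega) i' (by omega) hv]; simp; positivity
      push Not at hv
      by_cases him : i < m
      · rw [Nat.choose_eq_zero_of_lt him]; simp; positivity
      push Not at him
      rw [map_mul, map_mul, map_mul, map_pow, map_pow, pv_sub_eq w haP, pv_sub_eq w haP', ← exp_nat_mul, ← exp_nat_mul]
      have n3 := (pv T w).nonneg (i.choose m : N)
      have n4 := (pv T w).nonneg (algebraMap K N (tt d1 d2 p P P' i i'))
      have hfin : ((i - m : ℕ) : ℝ) * (L - l) + i' * (L' - l') ≤ d1 * L + d2 * L' - κ * g + m * l := by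
        rw [Nat.cast_sub him]
        have r1 : ((i:ℝ) - m) * L ≤ d1 * L := by
          apply mul_le_mul_of_nonneg_right _ hL0
          have : (i:ℝ) ≤ d1 := by exact_mod_cast (by omega : i ≤ d1)
          have := Nat.cast_nonneg (α := ℝ) m
          linarith
        have r2 : (i':ℝ) * L' ≤ d2 * L' := by
          apply mul_le_mul_of_nonneg_right _ hL0'
          exact_mod_cast (by omega : i' ≤ d2)
        have r3 : κ * g ≤ i * l + i' * l' := by
          calc κ * g ≤ (i / β + n * i' / β') * g := by gcongr
            _ = i / β * g + i' / β' * (n * g) := by ring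
            _ ≤ i / β * (β * l) + i' / β' * (β' * l') := by gcongr
            _ = _ := by field_simp
        linarith
      have q1 := pv_int_le w (tt d1 d2 p P P' i i') Mt (house_tt d1 d2 p M h0 h00 hp P P' hP hP' i i')
      have q2 := pv_natCast_le w (i.choose m) _ (choose_le_exp i m d1 (by omega))
      rw [mul_assoc (pv T w (i.choose m : N)), ← exp_add, exp_add (ew w * Mt), exp_add (ew w * (d1 * log 2))]
      refine mul_le_mul q1 (mul_le_mul q2 (exp_le_exp.2 hfin) (exp_pos _).le (exp_pos _).le) (mul_nonneg n3 (exp_pos _).le) (exp_pos _).le)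
  refine key.trans (exp_le_exp.2 ?_)
  have he := ew_nonneg w
  have : 0 ≤ ew w * (d2 * log 2) := by positivity
  unfold GG
  linarith

end nu
end MT
end partF5

section partF6
open Real
open scoped ComplexConjugate

namespace MT
section geo
variable {J : ℕ}

lemma geoA (β β' : Fin J → ℤ) (h : NonProp β β') : ∃ x y : ℂ,
    (∑ j, (x * β j + y * β' j) ^ 2 = 0) ∧ ∑ j, ‖x * β j + y * β' j‖ ^ 2 = 1 := by
  set G : ℂ := ∑ j, (β j : ℂ) ^ 2 with hG
  set H : ℂ := ∑ j, (β j : ℂ) * β' j with hH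
  set G' : ℂ := ∑ j, (β' j : ℂ) ^ 2 with hG'
  have hG0 : G ≠ 0 := by
    intro h0
    have h1 : ∑ j, (β j) ^ 2 = 0 := by
      rw [hG] at h0; exact_mod_cast h0
    rw [Finset.sum_eq_zero_iff_of_nonneg (fun i _ => sq_nonneg _)] at h1
    obtain ⟨i, j, hij⟩ := h
    have a := h1 i (Finset.mem_univ _)
    have b := h1 j (Finset.mem_univ _)
    rw [sq_eq_zero_iff] at a b
    rw [a, b] at hij; simp at hij
  obtain ⟨s, hs⟩ := IsAlgClosed.exists_pow_nat_eq (H ^ 2 - G * G') (n := 2) (by norm_num)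
  set z : ℂ := (-H + s) / G with hz
  have hz0 : G * z ^ 2 + 2 * H * z + G' = 0 := by
    rw [hz]; field_simp
    linear_combination hs
  have hsum : ∑ j, (z * β j + 1 * β' j) ^ 2 = 0 := by
    rw [← hz0, hG, hH, hG', Finset.sum_mul, Finset.mul_sum, Finset.sum_mul, ← Finset.sum_add_distrib, ← Finset.sum_add_distrib]
    exact Finset.sum_congr rfl fun j _ => by ring
  set Q : ℝ := ∑ j, ‖z * β j + 1 * β' j‖ ^ 2 with hQ
  have hQ0 : 0 < Q := by
    apply lt_of_le_of_ne (Finset.sum_nonneg fun _ _ => by positivity)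
    intro h0
    have h1 := (Finset.sum_eq_zero_iff_of_nonneg (fun i _ => by positivity)).1 h0.symm
    obtain ⟨i, j, hij⟩ := h
    have a := h1 i (Finset.mem_univ _)
    have b := h1 j (Finset.mem_univ _)
    rw [sq_eq_zero_iff, norm_eq_zero] at a b
    apply hij
    have : ((β i * β' j - β j * β' i : ℤ) : ℂ) = 0 := by
      push_cast
      linear_combination (β i : ℂ) * b - (β j : ℂ) * a
    exact_mod_cast this
  set t : ℝ := (√Q)⁻¹ with ht
  have ht2 : t ^ 2 * Q = 1 := by
    rw [ht, inv_pow, sq_sqrt hQ0.le]; field_simp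
  refine ⟨t * z, t * 1, ?_, ?_⟩
  · have : ∀ j, ((t:ℂ) * z * β j + t * 1 * β' j) ^ 2 = t ^ 2 * (z * β j + 1 * β' j) ^ 2 := fun j => by ring
    simp_rw [this]
    rw [← Finset.mul_sum, hsum, mul_zero]
  · have : ∀ j, ‖(t:ℂ) * z * β j + t * 1 * β' j‖ ^ 2 = t ^ 2 * ‖z * β j + 1 * β' j‖ ^ 2 := fun j => by
      have : (t:ℂ) * z * β j + t * 1 * β' j = t * (z * β j + 1 * β' j) := by ring
      rw [this, norm_mul, mul_pow, Complex.norm_real, Real.norm_eq_abs, sq_abs]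
    simp_rw [this]
    rw [← Finset.mul_sum]; exact ht2

/-- same direction -/
def SD (B : Fin J → ℂ) (j j' : Fin J) : Prop := B j ≠ 0 ∧ ∃ t : ℝ, 0 < t ∧ B j' = t * B j

lemma SD.pos1 {B : Fin J → ℂ} {j j' : Fin J} (h : SD B j j') : 0 < ‖B j‖ := norm_pos_iff.2 h.1
lemma SD.pos2 {B : Fin J → ℂ} {j j' : Fin J} (h : SD B j j') : 0 < ‖B j'‖ := by
  obtain ⟨h1, t, ht, h2⟩ := h
  rw [norm_pos_iff, h2]
  exact mul_ne_zero (by exact_mod_cast ht.ne') h1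

open Classical in
lemma geoB (B : Fin J → ℂ) (h1 : ∑ j, B j = 0) (h2 : ∑ j, B j ^ 2 = 0) (h3 : ∑ j, ‖B j‖ ^ 2 = 1) :
    ∃ k0 : ℝ, 0 < k0 ∧ 2 < k0 * ∑ j, ‖B j‖ ∧
      k0 ^ 2 * (∑ j, ∑ j', if SD B j j' then ‖B j‖ * ‖B j'‖ else 0) < 2 := by
  set T := ∑ j, ‖B j‖ with hT
  set S := ∑ j, ∑ j', if SD B j j' then ‖B j‖ * ‖B j'‖ else 0 with hS
  have hS0 : 0 ≤ S := Finset.sum_nonneg fun _ _ => Finset.sum_nonneg fun _ _ => by split_ifs <;> positivity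
  have hex : ∃ j, B j ≠ 0 := by
    by_contra! h
    simp [h] at h3
  have hT0 : 0 < T := by
    obtain ⟨j, hj⟩ := hex
    exact lt_of_lt_of_le (norm_pos_iff.2 hj) (Finset.single_le_sum (f := fun j => ‖B j‖) (fun _ _ => norm_nonneg _) (Finset.mem_univ j))
  have hs : ∀ j, B j ≠ 0 → 2 * (∑ j', if SD B j j' then ‖B j'‖ else 0) < T := by
    intro j hj
    have hnj := norm_pos_iff.2 hj
    set u : ℂ := conj (B j) / ‖B j‖ with hu
    have hu1 : ‖u‖ = 1 := by
      rw [hu, norm_div, RCLike.norm_conj, Complex.norm_real, norm_norm]; field_simp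
    have hz : ∀ i, ‖u * B i‖ = ‖B i‖ := fun i => by rw [norm_mul, hu1, one_mul]
    have hR : ∀ i, SD B j i → (u * B i).re = ‖B i‖ := by
      rintro i ⟨_, t, ht, e⟩
      have : u * B i = ((t * ‖B j‖ : ℝ) : ℂ) := by
        rw [e, hu]
        have hne : ((‖B j‖ : ℝ) : ℂ) ≠ 0 := by exact_mod_cast hnj.ne'
        have := Complex.conj_mul' (B j)
        push_cast
        field_simp
        linear_combination (t : ℂ) * this
      rw [this, Complex.ofReal_re, e, norm_mul, Complex.norm_real, Real.norm_of_nonneg ht.le]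
    have hsum0 : ∑ i, (u * B i).re = 0 := by
      rw [← Complex.re_sum, ← Finset.mul_sum, h1, mul_zero, Complex.zero_re]
    have hnn : ∀ i, 0 ≤ (if SD B j i then 0 else (‖B i‖ + (u * B i).re)) := by
      intro i; split_ifs
      · exact le_rfl
      · have := Complex.abs_re_le_norm (u * B i)
        rw [hz] at this
        linarith [neg_abs_le (u * B i).re]
    have hsplit : T - 2 * (∑ i, if SD B j i then ‖B i‖ else 0) = ∑ i, (if SD B j i then 0 else (‖B i‖ + (u * B i).re)) := by
      have : ∀ i, (if SD B j i then 0 else (‖B i‖ + (u * B i).re)) = ‖B i‖ - 2 * (if SD B j i then ‖B i‖ else 0) + (u * B i).re := by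
        intro i; split_ifs with hh
        · rw [hR i hh]; ring
        · ring
      rw [Finset.sum_congr rfl fun i _ => this i, Finset.sum_add_distrib, Finset.sum_sub_distrib, hsum0, ← Finset.mul_sum]
      ring
    by_contra! hcon
    have hzero : ∑ i, (if SD B j i then 0 else (‖B i‖ + (u * B i).re)) = 0 :=
      le_antisymm (by rw [← hsplit]; linarith) (Finset.sum_nonneg fun i _ => hnn i)
    rw [Finset.sum_eq_zero_iff_of_nonneg (fun i _ => hnn i)] at hzero
    have hre : ∀ i, (u * B i).re ^ 2 = ‖B i‖ ^ 2 := by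
      intro i
      by_cases hh : SD B j i
      · rw [hR i hh]
      · have := hzero i (Finset.mem_univ _)
        rw [if_neg hh] at this
        have : (u * B i).re = - ‖B i‖ := by linarith
        rw [this]; ring
    have him : ∀ i, (u * B i).im ^ 2 = 0 := by
      intro i
      have := Complex.sq_norm (u * B i)
      rw [hz, Complex.normSq_apply] at this
      have := hre i
      nlinarith
    have hfin : ∑ i, (u * B i) ^ 2 = 0 := by
      have : ∀ i, (u * B i) ^ 2 = u ^ 2 * B i ^ 2 := fun i => by ring
      simp_rw [this]; rw [← Finset.mul_sum, h2, mul_zero]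
    have hfin2 := congrArg Complex.re hfin
    rw [Complex.re_sum] at hfin2
    have : ∀ i, ((u * B i) ^ 2).re = ‖B i‖ ^ 2 := by
      intro i
      rw [sq, Complex.mul_re, ← sq, ← sq, him i, hre i, sub_zero]
    simp_rw [this] at hfin2
    rw [h3] at hfin2; simp at hfin2
  have hST : 2 * S < T ^ 2 := by
    have e : 2 * S = ∑ j, ‖B j‖ * (2 * ∑ j', if SD B j j' then ‖B j'‖ else 0) := by
      rw [hS, Finset.mul_sum]
      refine Finset.sum_congr rfl fun j _ => ?_
      rw [Finset.mul_sum, Finset.mul_sum, Finset.mul_sum]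
      refine Finset.sum_congr rfl fun j' _ => ?_
      split_ifs <;> ring
    rw [e, sq, hT, Finset.sum_mul, ← hT]
    obtain ⟨j, hj⟩ := hex
    refine Finset.sum_lt_sum (fun i _ => ?_) ⟨j, Finset.mem_univ _, ?_⟩
    · by_cases hi : B i = 0
      · simp [hi]
      · exact mul_le_mul_of_nonneg_left (hs i hi).le (norm_nonneg _)
    · exact mul_lt_mul_of_pos_left (hs j hj) (norm_pos_iff.2 hj)
  set δ := (2 - 4 * S / T ^ 2) / (S + 1) with hδ
  have hnum : 0 < 2 - 4 * S / T ^ 2 := by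
    rw [sub_pos, div_lt_iff₀ (by positivity)]; linarith
  have hδ0 : 0 < δ := by positivity
  have hδ1 : δ * S < 2 - 4 * S / T ^ 2 := by
    rw [hδ, div_mul_eq_mul_div, div_lt_iff₀ (by positivity)]; nlinarith
  refine ⟨√(4 / T ^ 2 + δ), by positivity, ?_, ?_⟩
  · have : 2 / T < √(4 / T ^ 2 + δ) := by
      apply lt_sqrt_of_sq_lt
      have : (2 / T) ^ 2 = 4 / T ^ 2 := by rw [div_pow]; norm_num
      linarith
    rwa [div_lt_iff₀ hT0] at this
  · rw [sq_sqrt (by positivity)]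
    have : (4 / T ^ 2 + δ) * S = 4 * S / T ^ 2 + δ * S := by ring
    linarith

lemma geoC1 (u v : ℂ) (hu : u ≠ 0) (hR : ¬ ∃ t : ℝ, 0 < t ∧ v = t * u) : ∃ C : ℝ, 0 ≤ C ∧
    ∀ x y : ℝ, 0 ≤ x → 0 ≤ y → x * ‖u‖ ≤ C * ‖x * u - y * v‖ := by
  by_cases hv : v = 0
  · refine ⟨1, zero_le_one, fun x y hx hy => ?_⟩
    rw [hv, mul_zero, sub_zero, norm_mul, Complex.norm_real, Real.norm_of_nonneg hx, one_mul]
  have hv0 := norm_pos_iff.2 hv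
  have hu0 := norm_pos_iff.2 hu
  set w := u * conj v with hw
  have hwn : ‖w‖ = ‖u‖ * ‖v‖ := by rw [hw, norm_mul, RCLike.norm_conj]
  have key : ∀ x y : ℝ, ((x * u - y * v) * conj v) = x * w - ((y * ‖v‖ ^ 2 : ℝ) : ℂ) := by
    intro x y
    have := Complex.mul_conj' v
    push_cast
    rw [hw]; linear_combination (-(y:ℂ)) * this
  have keyn : ∀ x y : ℝ, ‖(x * w - ((y * ‖v‖ ^ 2 : ℝ) : ℂ))‖ = ‖x * u - y * v‖ * ‖v‖ := by
    intro x y; rw [← key, norm_mul, RCLike.norm_conj]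
  by_cases him : w.im = 0
  · have hre : w.re < 0 := by
      by_contra! h
      rcases h.lt_or_eq with h | h
      · apply hR
        refine ⟨‖v‖ ^ 2 / w.re, by positivity, ?_⟩
        have hwr : w = (w.re : ℂ) := Complex.ext (by simp) (by simp [him])
        have hne : (w.re : ℂ) ≠ 0 := by exact_mod_cast h.ne'
        push_cast
        rw [div_mul_eq_mul_div, eq_div_iff hne, ← hwr, hw]
        linear_combination u * Complex.mul_conj' v
      · have : w = 0 := Complex.ext (by simp [← h]) (by simp [him])
        rw [this, norm_zero] at hwn
        have := mul_pos hu0 hv0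
        linarith
    have hwn2 : ‖w‖ = -w.re := by
      have hwr : w = (w.re : ℂ) := Complex.ext (by simp) (by simp [him])
      rw [hwr, Complex.norm_real, Real.norm_of_nonpos hre.le, Complex.ofReal_re]
    refine ⟨1, zero_le_one, fun x y hx hy => ?_⟩
    have h1 := Complex.abs_re_le_norm (x * w - ((y * ‖v‖ ^ 2 : ℝ) : ℂ))
    rw [keyn, Complex.sub_re, Complex.ofReal_re, Complex.re_ofReal_mul] at h1
    have h2 := neg_abs_le (x * w.re - y * ‖v‖ ^ 2)
    have h3 : x * (‖u‖ * ‖v‖) = - (x * w.re) := by rw [← hwn, hwn2]; ring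
    have h4 : 0 ≤ y * ‖v‖ ^ 2 := by positivity
    have : x * ‖u‖ * ‖v‖ ≤ ‖x * u - y * v‖ * ‖v‖ := by linarith
    rw [one_mul]; exact le_of_mul_le_mul_right this hv0
  · have hi0 := abs_pos.2 him
    refine ⟨‖u‖ * ‖v‖ / |w.im|, by positivity, fun x y hx hy => ?_⟩
    have h1 := Complex.abs_im_le_norm (x * w - ((y * ‖v‖ ^ 2 : ℝ) : ℂ))
    rw [keyn, Complex.sub_im, Complex.ofReal_im, Complex.im_ofReal_mul, sub_zero, abs_mul, abs_of_nonneg hx] at h1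
    rw [div_mul_eq_mul_div, le_div_iff₀ hi0]
    nlinarith

lemma geoC (B : Fin J → ℂ) : ∃ C : ℝ, 0 ≤ C ∧ ∀ j j', B j ≠ 0 → ¬ SD B j j' →
    ∀ x y : ℝ, 0 ≤ x → 0 ≤ y → x * ‖B j‖ ≤ C * ‖x * B j - y * B j'‖ := by
  have : ∀ j j', ∃ C : ℝ, 0 ≤ C ∧ (B j ≠ 0 → ¬ SD B j j' →
    ∀ x y : ℝ, 0 ≤ x → 0 ≤ y → x * ‖B j‖ ≤ C * ‖x * B j - y * B j'‖) := by
    intro j j'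
    by_cases h : B j ≠ 0 ∧ ¬ SD B j j'
    · obtain ⟨C, h1, h2⟩ := geoC1 (B j) (B j') h.1 (fun hh => h.2 ⟨h.1, hh⟩)
      exact ⟨C, h1, fun _ _ => h2⟩
    · exact ⟨0, le_rfl, fun h1 h2 => absurd ⟨h1, h2⟩ h⟩
  choose C hC hC2 using this
  refine ⟨∑ j, ∑ j', C j j', Finset.sum_nonneg fun _ _ => Finset.sum_nonneg fun _ _ => hC _ _, ?_⟩
  intro j j' h1 h2 x y hx hy
  refine (hC2 j j' h1 h2 x y hx hy).trans ?_
  gcongr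
  calc C j j' ≤ ∑ j', C j j' := Finset.single_le_sum (f := fun j' => C j j') (fun _ _ => hC _ _) (Finset.mem_univ j')
    _ ≤ _ := Finset.single_le_sum (f := fun j => ∑ j', C j j') (fun _ _ => Finset.sum_nonneg fun _ _ => hC _ _) (Finset.mem_univ j)

/-- isolate the main term -/
lemma one_big (B : Fin J → ℂ) (c : ℝ) (l : Fin J → ℝ) (hl : ∀ j, -c ≤ l j) (j0 : Fin J) (x : ℝ)
    (h0 : |l j0 - x| ≤ c) (h : ∀ j, j ≠ j0 → l j ≤ c) : ‖∑ j, B j * l j - x * B j0‖ ≤ (∑ j, ‖B j‖) * c := by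
  have e : ∑ j, B j * (l j : ℂ) - x * B j0 = ∑ j, B j * ((l j - if j = j0 then x else 0 : ℝ) : ℂ) := by
    push_cast
    simp_rw [mul_sub]
    rw [Finset.sum_sub_distrib]
    congr 1
    rw [Finset.sum_eq_single j0]
    · simp [mul_comm]
    · intro b _ hb; simp [hb]
    · simp
  rw [e, Finset.sum_mul]
  refine (norm_sum_le _ _).trans (Finset.sum_le_sum fun j _ => ?_)
  rw [norm_mul, Complex.norm_real, Real.norm_eq_abs]
  apply mul_le_mul_of_nonneg_left _ (norm_nonneg _)
  split_ifs with hj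
  · rw [hj]; exact h0
  · rw [sub_zero, abs_le]; exact ⟨hl j, h j hj⟩

lemma geoD (B : Fin J → ℂ) : ∃ C : ℝ, 0 ≤ C ∧ ∀ (c n : ℝ) (l l' : Fin J → ℝ), 0 ≤ c → 1 ≤ n →
    (∀ j, -c ≤ l j) → (∀ j, -c ≤ l' j) → (∀ i j, i ≠ j → l i ≤ c ∨ l j ≤ c) →
    (∀ i j, i ≠ j → l' i ≤ c ∨ l' j ≤ c) →
    ∃ g : ℝ, 0 ≤ g ∧ (g = 0 ∨ ∃ j j', SD B j j' ∧ g ≤ ‖B j‖ * l j ∧ n * g ≤ ‖B j'‖ * l' j') ∧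
      ∑ j, ‖B j‖ * l j ≤ g + C * (c + ‖∑ j, B j * l' j - n * ∑ j, B j * l j‖ / n) := by
  obtain ⟨C, hC0, hC⟩ := geoC B
  set T := ∑ j, ‖B j‖ with hT
  have hT0 : 0 ≤ T := Finset.sum_nonneg fun _ _ => norm_nonneg _
  refine ⟨(C + 1) * (2 * T + 1) + T, by positivity, ?_⟩
  intro c n l l' hc hn hl hl' h2 h2'
  set E := ‖∑ j, B j * (l' j : ℂ) - n * ∑ j, B j * (l j : ℂ)‖ with hE
  have hE0 : 0 ≤ E := norm_nonneg _
  have hn0 : 0 < n := by linarith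
  have hEn : 0 ≤ E / n := by positivity
  have hCbig : T * c + (C + 1) * (E / n + 2 * T * c) ≤ ((C + 1) * (2 * T + 1) + T) * (c + E / n) := by
    have : 0 ≤ (C + 1) * c + (C + 1) * (2 * T) * (E / n) + T * (E / n) := by positivity
    linarith
  by_cases hbig : ∃ j0, c < l j0 ∧ B j0 ≠ 0
  swap
  · push Not at hbig
    refine ⟨0, le_rfl, Or.inl rfl, ?_⟩
    have : ∑ j, ‖B j‖ * l j ≤ T * c := by
      rw [hT, Finset.sum_mul]
      refine Finset.sum_le_sum fun j _ => ?_
      by_cases hj : c < l j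
      · simp [hbig j hj]
      · exact mul_le_mul_of_nonneg_left (not_lt.1 hj) (norm_nonneg _)
    have : 0 ≤ (C + 1) * (E / n + 2 * T * c) := by positivity
    linarith
  obtain ⟨j0, hj0, hB0⟩ := hbig
  set x := l j0 with hx
  have hx0 : 0 ≤ x := by linarith
  have hoth : ∀ j, j ≠ j0 → l j ≤ c := by
    intro j hj
    rcases h2 j j0 hj with h | h
    · exact h
    · linarith
  have hZ := one_big B c l hl j0 x (by rw [← hx, sub_self, abs_zero]; exact hc) hoth
  have hS : ∑ j, ‖B j‖ * l j ≤ ‖B j0‖ * x + T * c := by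
    rw [← Finset.add_sum_erase _ _ (Finset.mem_univ j0), hT, Finset.sum_mul]
    refine add_le_add le_rfl ((Finset.sum_le_sum fun j hj => ?_).trans (Finset.sum_le_sum_of_subset_of_nonneg (Finset.erase_subset j0 _) fun _ _ _ => by positivity))
    exact mul_le_mul_of_nonneg_left (hoth j (Finset.ne_of_mem_erase hj)) (norm_nonneg _)
  obtain ⟨j1, -, hj1⟩ := Finset.exists_max_image Finset.univ l' ⟨j0, Finset.mem_univ _⟩
  set y := max (l' j1) 0 with hy
  have hy0 : 0 ≤ y := le_max_right _ _
  have hoth' : ∀ j, j ≠ j1 → l' j ≤ c := by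
    intro j hj
    rcases h2' j j1 hj with h | h
    · exact h
    · exact (hj1 j (Finset.mem_univ _)).trans h
  have hZ' := one_big B c l' hl' j1 y (by
    rcases le_total (l' j1) 0 with h | h
    · rw [hy, max_eq_right h, sub_zero, abs_of_nonpos h]; linarith [hl' j1]
    · rw [hy, max_eq_left h, sub_self, abs_zero]; exact hc) hoth'
  rw [← hT] at hZ hZ'
  have hmain : ‖((n * x : ℝ) : ℂ) * B j0 - y * B j1‖ ≤ E + 2 * n * T * c := by
    have e : ((n * x : ℝ) : ℂ) * B j0 - y * B j1 = (∑ j, B j * (l' j : ℂ) - y * B j1) - n * (∑ j, B j * (l j : ℂ) - x * B j0)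
      - (∑ j, B j * (l' j : ℂ) - n * ∑ j, B j * (l j : ℂ)) := by push_cast; ring
    rw [e]
    refine (norm_sub_le _ _).trans ?_
    have := norm_sub_le (∑ j, B j * (l' j : ℂ) - y * B j1) (n * (∑ j, B j * (l j : ℂ) - x * B j0))
    rw [norm_mul, Complex.norm_real, Real.norm_of_nonneg hn0.le] at this
    have h3 : n * ‖∑ j, B j * (l j : ℂ) - x * B j0‖ ≤ n * (T * c) := by gcongr
    have h4 : T * c ≤ n * (T * c) := le_mul_of_one_le_left (by positivity) hn
    linarith
  have hdiv : (E + 2 * n * T * c) / n = E / n + 2 * T * c := by field_simp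
  by_cases hR : SD B j0 j1
  · have hrev : n * (‖B j0‖ * x) - ‖B j1‖ * y ≤ E + 2 * n * T * c := by
      refine le_trans ?_ hmain
      have := norm_sub_norm_le (((n * x : ℝ) : ℂ) * B j0) (y * B j1)
      rw [norm_mul, norm_mul, Complex.norm_real, Complex.norm_real, Real.norm_of_nonneg hy0, Real.norm_of_nonneg (by positivity)] at this
      linarith
    have hrev2 : ‖B j0‖ * x - ‖B j1‖ * y / n ≤ E / n + 2 * T * c := by
      rw [← hdiv, le_div_iff₀ hn0, sub_mul, div_mul_cancel₀ _ hn0.ne']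
      linarith
    have hle : E / n + 2 * T * c ≤ (C + 1) * (E / n + 2 * T * c) :=
      le_mul_of_one_le_left (by positivity) (by linarith)
    have hnn1 : 0 ≤ ‖B j0‖ * x := by positivity
    have hnn2 : 0 ≤ ‖B j1‖ * y / n := by positivity
    refine ⟨min (‖B j0‖ * x) (‖B j1‖ * y / n), le_min hnn1 hnn2, ?_, ?_⟩
    · rcases le_total (l' j1) 0 with h | h
      · left; rw [hy, max_eq_right h]; simp [hnn1]
      · right
        refine ⟨j0, j1, hR, min_le_left _ _, ?_⟩
        have : min (‖B j0‖ * x) (‖B j1‖ * y / n) ≤ ‖B j1‖ * y / n := min_le_right _ _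
        rw [le_div_iff₀ hn0, hy, max_eq_left h] at this
        rw [hy, max_eq_left h]; linarith
    · rcases min_choice (‖B j0‖ * x) (‖B j1‖ * y / n) with h | h
      · rw [h]
        have : 0 ≤ (C + 1) * (E / n + 2 * T * c) := by positivity
        linarith
      · rw [h]; linarith
  · refine ⟨0, le_rfl, Or.inl rfl, ?_⟩
    have h5 := hC j0 j1 hB0 hR (n * x) y (by positivity) hy0
    have h6 : n * x * ‖B j0‖ ≤ C * (E + 2 * n * T * c) := h5.trans (by gcongr)
    have h7 : ‖B j0‖ * x ≤ C * (E / n + 2 * T * c) := by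
      rw [← hdiv, ← mul_div_assoc, le_div_iff₀ hn0]; linarith
    have : 0 ≤ E / n + 2 * T * c := by positivity
    linarith

end geo
end MT
end partF6

section partF7
open NumberField Height Real Polynomial

namespace MT
section siegel

lemma siegel0 (K : Type) [Field K] [NumberField K] : ∃ c1 : ℝ, ∀ (α β : Type) [Fintype α] [Fintype β] [DecidableEq α] [DecidableEq β]
    (a : Matrix α β (𝓞 K)) (_ : a ≠ 0) (p q : ℕ) (_ : 0 < p) (_ : p < q) (_ : Fintype.card α = p) (_ : Fintype.card β = q)
    (A : ℝ) (_ : ∀ k l, house ((algebraMap (𝓞 K) K) (a k l)) ≤ A),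
    ∃ ξ : β → 𝓞 K, ξ ≠ 0 ∧ a.mulVec ξ = 0 ∧ ∀ l, house (ξ l).1 ≤ c1 * ((c1 * q * A) ^ ((p : ℝ) / (q - p))) := by
  classical
  exact ⟨_, fun α β _ _ _ _ a ha p q h0p hpq ca cb A hA => 
    NumberField.house.exists_ne_zero_int_vec_house_le K a ha h0p hpq cb hA ca⟩

lemma siegel1 (K : Type) [Field K] [NumberField K] (η : ℝ) (hη : 0 < η) : ∃ C : ℝ, 0 ≤ C ∧ ∀ (α β : Type) [Fintype α] [Fintype β]
    (a : Matrix α β (𝓞 K)) (_ : (Fintype.card α : ℝ) ≤ (1 - η) * Fintype.card β) (_ : 0 < Fintype.card β)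
    (A : ℝ) (_ : 0 ≤ A) (_ : ∀ k l, house ((algebraMap (𝓞 K) K) (a k l)) ≤ exp A),
    ∃ ξ : β → 𝓞 K, ξ ≠ 0 ∧ a.mulVec ξ = 0 ∧ ∀ l, house (ξ l : K) ≤ exp (C + (C + log (Fintype.card β) + A) / η) := by
  classical
  obtain ⟨c1, hc⟩ := siegel0 K
  set C := log (max 1 |c1|) with hC
  have hm : (1:ℝ) ≤ max 1 |c1| := le_max_left _ _
  have hm0 : (0:ℝ) < max 1 |c1| := by linarith
  have hC0 : 0 ≤ C := log_nonneg hm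
  refine ⟨C, hC0, ?_⟩
  intro α β _ _ a hcard hpos A hA0 hA
  have hq1 : (1:ℝ) ≤ Fintype.card β := by exact_mod_cast hpos
  have hlq : 0 ≤ log (Fintype.card β : ℝ) := log_nonneg hq1
  by_cases hcase : a = 0 ∨ Fintype.card α = 0
  · refine ⟨1, ?_, ?_, ?_⟩
    · obtain ⟨b⟩ := Fintype.card_pos_iff.1 hpos
      intro h; have := congrFun h b; simp at this
    · rcases hcase with h | h
      · rw [h, Matrix.zero_mulVec]
      · ext i; exact ((Fintype.card_eq_zero_iff.1 h).false i).elim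
    · intro l
      have : house (((1 : β → 𝓞 K) l : 𝓞 K) : K) = 1 := by
        rw [Pi.one_apply, RingOfIntegers.coe_eq_algebraMap, map_one]
        exact house_one'
      rw [this]
      exact one_le_exp (by positivity)
  push Not at hcase
  obtain ⟨ha, hp⟩ := hcase
  have hlt : Fintype.card α < Fintype.card β := by
    have : (Fintype.card α : ℝ) < Fintype.card β := by nlinarith
    exact_mod_cast this
  obtain ⟨ξ, h1, h2, h3⟩ := hc α β a ha _ _ (Nat.pos_of_ne_zero hp) hlt rfl rfl _ hA
  refine ⟨ξ, h1, h2, fun l => ?_⟩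
  refine (h3 l).trans ?_
  set q : ℝ := (Fintype.card β : ℝ) with hq
  set p : ℝ := (Fintype.card α : ℝ) with hp'
  have hp0 : 0 ≤ p := Nat.cast_nonneg _
  have hqp : 0 < q - p := by nlinarith
  have he : p / (q - p) ≤ 1 / η := by
    rw [div_le_div_iff₀ hqp hη]; nlinarith
  have he0 : 0 ≤ p / (q - p) := by positivity
  have hbase : (1:ℝ) ≤ max 1 |c1| * q * exp A := by
    have := one_le_exp hA0
    have h5 : 1 ≤ max 1 |c1| * q := by nlinarith
    nlinarith
  have hfin : exp (C + (C + log q + A) / η) = max 1 |c1| * (max 1 |c1| * q * exp A) ^ (1 / η) := by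
    rw [exp_add, hC, exp_log hm0, rpow_def_of_pos (by positivity), log_mul (by positivity) (by positivity), log_mul (by positivity) (by positivity), log_exp]
    congr 2; ring
  rw [hfin]
  have h6 : |c1 * q * exp A| ≤ max 1 |c1| * q * exp A := by
    rw [abs_mul, abs_mul, abs_of_nonneg (exp_pos A).le, abs_of_nonneg (by linarith : 0 ≤ q)]
    have := le_max_right 1 |c1|
    gcongr
  calc c1 * (c1 * q * exp A) ^ (p / (q - p)) ≤ |c1| * |(c1 * q * exp A) ^ (p / (q - p))| := by
        rw [← abs_mul]; exact le_abs_self _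
    _ ≤ max 1 |c1| * (max 1 |c1| * q * exp A) ^ (p / (q - p)) := by
        refine mul_le_mul (le_max_right 1 |c1|) ?_ (abs_nonneg _) hm0.le
        exact (abs_rpow_le_abs_rpow _ _).trans (rpow_le_rpow (abs_nonneg _) h6 he0)
    _ ≤ _ := by gcongr

lemma count_lt (x : ℝ) (s : Finset ℕ) (hs : ∀ i ∈ s, (i : ℝ) < x) : (s.card : ℝ) ≤ max 0 x + 1 := by
  have h1 : s ⊆ Finset.range ⌈x⌉₊ := by
    intro i hi
    rw [Finset.mem_range, Nat.lt_ceil]; exact hs i hi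
  have h2 := Finset.card_le_card h1
  rw [Finset.card_range] at h2
  have h3 : (⌈x⌉₊ : ℝ) ≤ max 0 x + 1 := by
    rcases le_total x 0 with h | h
    · rw [Nat.ceil_eq_zero.2 h]; simp; positivity
    · rw [max_eq_right h]; exact (Nat.ceil_lt_add_one h).le
  have : (s.card : ℝ) ≤ ⌈x⌉₊ := by exact_mod_cast h2
  linarith

lemma tele (X : ℝ) (hX : 0 ≤ X) (N : ℕ) : ∑ i ∈ Finset.range N, max 0 (X - i) ≤ (X + 1) ^ 2 / 2 := by
  have h1 : ∀ i : ℕ, max 0 (X - i) ≤ (max 0 (X + 1 - i)) ^ 2 / 2 - (max 0 (X + 1 - (i + 1 : ℕ))) ^ 2 / 2 := by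
    intro i
    have e : X + 1 - (i + 1 : ℕ) = X - i := by push_cast; ring
    rw [e]
    rcases le_total (X - i) 0 with h | h
    · rw [max_eq_left h]
      have := sq_nonneg (max 0 (X + 1 - i))
      simp; positivity
    · rw [max_eq_right h, max_eq_right (by linarith)]
      nlinarith
  refine (Finset.sum_le_sum fun i _ => h1 i).trans ?_
  rw [Finset.sum_range_sub']
  have := sq_nonneg (max 0 (X + 1 - N))
  simp only [Nat.cast_zero, sub_zero]
  rw [max_eq_right (by linarith)]
  linarith

variable {K : Type} [Field K] [NumberField K] {J : ℕ}

open Classical in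
/-- the index set of the equations -/
noncomputable def eqs (b : Fin J → ℝ) (R : Fin J → Fin J → Prop) (n κ : ℝ) (d1 d2 : ℕ) : Finset (((Fin J × Fin J) × ℕ) × ℕ) :=
  ((Finset.univ ×ˢ Finset.range (d2 + 1)) ×ˢ Finset.range (d1 + 1)).filter
    (fun z => R z.1.1.1 z.1.1.2 ∧ (z.2 : ℝ) / b z.1.1.1 + n * z.1.2 / b z.1.1.2 < κ)

open Classical in
lemma eqs_card (b : Fin J → ℝ) (R : Fin J → Fin J → Prop) (hb : ∀ j j', R j j' → 0 < b j ∧ 0 < b j') (n k0 : ℝ) (hn : 1 ≤ n) (hk0 : 0 < k0) (d1 d : ℕ) :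
    ((eqs b R n (n * d * k0) d1 d).card : ℝ) ≤ ∑ j, ∑ j', if R j j' then 
      ((d + 1) + n * (k0 ^ 2 * (b j * b j') * d ^ 2 / 2 + b j * k0 * d + b j / b j' / 2)) else 0 := by
  unfold eqs
  rw [Finset.card_filter]
  push_cast
  rw [Finset.sum_product, Finset.sum_product, ← Finset.univ_product_univ, Finset.sum_product]
  refine Finset.sum_le_sum fun j _ => Finset.sum_le_sum fun j' _ => ?_
  simp only
  split_ifs with hR
  · obtain ⟨h1, h2⟩ := hb j j' hR
    have step : ∀ i' ∈ Finset.range (d + 1), (∑ i ∈ Finset.range (d1 + 1), if R j j' ∧ (i:ℝ) / b j + n * i' / b j' < n * d * k0 then (1:ℝ) else 0)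
        ≤ n * (b j / b j') * max 0 (d * k0 * b j' - i') + 1 := by
      intro i' _
      rw [← Finset.natCast_card_filter]
      refine (count_lt (n * (b j / b j') * (d * k0 * b j' - i')) _ ?_).trans ?_
      · intro i hi
        rw [Finset.mem_filter] at hi
        obtain ⟨-, -, hi⟩ := hi
        have : (i:ℝ) / b j < n * d * k0 - n * i' / b j' := by linarith
        rw [div_lt_iff₀ h1] at this
        refine this.trans_le (le_of_eq ?_)
        field_simp
      · have hz : 0 ≤ n * (b j / b j') := by positivity
        rw [mul_max_of_nonneg _ _ hz, mul_zero]
    refine (Finset.sum_le_sum step).trans ?_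
    rw [Finset.sum_add_distrib, ← Finset.mul_sum, Finset.sum_const, Finset.card_range, nsmul_eq_mul]
    have ht := tele (d * k0 * b j') (by positivity) (d + 1)
    have : n * (b j / b j') * ∑ i ∈ Finset.range (d + 1), max 0 (d * k0 * b j' - i) ≤ n * (b j / b j') * ((d * k0 * b j' + 1) ^ 2 / 2) := by gcongr
    have e : n * (b j / b j') * ((d * k0 * b j' + 1) ^ 2 / 2) = n * (k0 ^ 2 * (b j * b j') * d ^ 2 / 2 + b j * k0 * d + b j / b j' / 2) := by
      field_simp
      ring
    push_cast
    linarith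
  · refine le_of_eq (Finset.sum_eq_zero fun i _ => Finset.sum_eq_zero fun i' _ => ?_)
    rw [if_neg]; tauto

open Classical in
lemma siegelP (P : Fin J → 𝓞 K) (b : Fin J → ℝ) (R : Fin J → Fin J → Prop) (hb : ∀ j j', R j j' → 0 < b j ∧ 0 < b j')
    (k0 : ℝ) (hk0 : 0 < k0) (hS : k0 ^ 2 * (∑ j, ∑ j', if R j j' then b j * b j' else 0) < 2)
    (h0 : ℝ) (h00 : 0 ≤ h0) (hP : ∀ j, house (P j : K) ≤ exp h0) :
    ∃ d : ℕ, 0 < d ∧ ∃ C : ℝ, 0 ≤ C ∧ ∀ n : ℝ, 1 ≤ n → ∃ p : ℕ → ℕ → 𝓞 K, 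
      (∃ x ≤ ⌊n * d⌋₊, ∃ y ≤ d, p x y ≠ 0) ∧ (∀ x y, house (p x y : K) ≤ exp (C * n)) ∧
      ∀ j j', R j j' → ∀ i ≤ ⌊n * d⌋₊, ∀ i' ≤ d, (i : ℝ) / b j + n * i' / b j' < n * d * k0 → 
        tt ⌊n * d⌋₊ d p (P j) (P j') i i' = 0 := by
  set S := ∑ j, ∑ j', if R j j' then b j * b j' else 0 with hSdef
  set C1 := ∑ j, ∑ j', if R j j' then b j * k0 else 0 with hC1
  set C2 := ∑ j, ∑ j', if R j j' then b j / b j' / 2 else 0 with hC2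
  set C3 : ℝ := ∑ j : Fin J, ∑ j', if R j j' then (1:ℝ) else 0 with hC3
  have hC1n : 0 ≤ C1 := Finset.sum_nonneg fun j _ => Finset.sum_nonneg fun j' _ => by
    split_ifs with h
    · have := hb _ _ h; have := this.1; positivity
    · rfl
  have hC2n : 0 ≤ C2 := Finset.sum_nonneg fun j _ => Finset.sum_nonneg fun j' _ => by
    split_ifs with h
    · have := hb _ _ h; have := this.1; have := (hb _ _ h).2; positivity
    · rfl
  have hC3n : 0 ≤ C3 := Finset.sum_nonneg fun j _ => Finset.sum_nonneg fun j' _ => by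
    split_ifs <;> norm_num
  set ρ := k0 ^ 2 * S / 2 with hρ
  have hρ1 : ρ < 1 := by rw [hρ]; linarith
  set η := (1 - ρ) / 2 with hη
  have hη0 : 0 < η := by rw [hη]; linarith
  obtain ⟨d0, hd0⟩ := exists_nat_ge ((C1 + C2 + 2 * C3) / η)
  set d := d0 + 1 with hd
  have hd1 : (1:ℝ) ≤ d := by rw [hd]; push_cast; linarith [Nat.cast_nonneg (α := ℝ) d0]
  have hdbig : (C1 + C2 + 2 * C3) ≤ η * d := by
    rw [div_le_iff₀ hη0] at hd0
    rw [hd]; push_cast; nlinarith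
  obtain ⟨Cs, hCs0, hCs⟩ := siegel1 K η hη0
  have hl2 := log_nonneg (by norm_num : (1:ℝ) ≤ 2)
  refine ⟨d, by omega, Cs + (Cs + 2 * d + 2 * d * (log 2 + h0)) / η, by positivity, ?_⟩
  intro n hn
  set d1 := ⌊n * d⌋₊ with hd1'
  have hd1le : (d1 : ℝ) ≤ n * d := Nat.floor_le (by positivity)
  have hd1gt : n * d < d1 + 1 := Nat.lt_floor_add_one _
  have hdn : (d:ℝ) ≤ n * d := le_mul_of_one_le_left (by positivity) hn
  -- the matrix
  let a : Matrix (eqs b R n (n * d * k0) d1 d) (Fin (d1 + 1) × Fin (d + 1)) (𝓞 K) := fun z xy =>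
    (((xy.1 : ℕ).choose z.1.2 : 𝓞 K) * P z.1.1.1.1 ^ ((xy.1 : ℕ) - z.1.2)) * (((xy.2 : ℕ).choose z.1.1.2 : 𝓞 K) * P z.1.1.1.2 ^ ((xy.2 : ℕ) - z.1.1.2))
  have hcardβ : (Fintype.card (Fin (d1 + 1) × Fin (d + 1)) : ℝ) = (d1 + 1) * (d + 1) := by
    rw [Fintype.card_prod, Fintype.card_fin, Fintype.card_fin]; push_cast; rfl
  obtain ⟨ξ, hξ0, hξ, hξb⟩ := hCs _ _ a (by
      rw [hcardβ, Fintype.card_coe]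
      refine (eqs_card b R hb n k0 hn hk0 d1 d).trans ?_
      have e : (∑ j, ∑ j', if R j j' then 
          (((d:ℝ) + 1) + n * (k0 ^ 2 * (b j * b j') * d ^ 2 / 2 + b j * k0 * d + b j / b j' / 2)) else 0)
          = C3 * (d + 1) + n * (ρ * d ^ 2 + C1 * d + C2) := by
        rw [hC3, hρ, hSdef, hC1, hC2]
        simp only [Finset.sum_mul, Finset.mul_sum, Finset.sum_div, ← Finset.sum_add_distrib]
        refine Finset.sum_congr rfl fun j _ => Finset.sum_congr rfl fun j' _ => ?_
        split_ifs <;> ring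
      rw [e]
      have hn0 : 0 < n := by linarith
      have g1 : C3 * (d + 1) ≤ n * (2 * C3 * d) := by
        have : C3 * (d + 1) ≤ 2 * C3 * d := by nlinarith
        refine this.trans (le_mul_of_one_le_left (by positivity) hn)
      have g2 : C2 ≤ C2 * d := le_mul_of_one_le_right hC2n hd1
      have g3 : (C1 + C2 + 2 * C3) * d ≤ η * d * d := by gcongr
      have g4 : C3 * (d + 1) + n * (ρ * d ^ 2 + C1 * d + C2) ≤ n * (ρ * d ^ 2 + η * d * d) := by
        have : n * (2 * C3 * d) + n * (ρ * d ^ 2 + C1 * d + C2) ≤ n * (ρ * d ^ 2 + η * d * d) := by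
          rw [← mul_add]; apply mul_le_mul_of_nonneg_left _ hn0.le; linarith
        linarith
      refine g4.trans ?_
      have e2 : n * (ρ * d ^ 2 + η * d * d) = (1 - η) * (n * d * d) := by rw [hη]; ring
      rw [e2]
      have h1η : 0 ≤ 1 - η := by
        have hS0 : 0 ≤ S := Finset.sum_nonneg fun j _ => Finset.sum_nonneg fun j' _ => by
          split_ifs with h
          · have := hb _ _ h; exact mul_nonneg this.1.le this.2.le
          · rfl
        have : 0 ≤ ρ := by positivity
        rw [hη]; linarith
      apply mul_le_mul_of_nonneg_left _ h1η
      have := Nat.cast_nonneg (α := ℝ) d1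
      nlinarith) (by rw [Fintype.card_prod]; simp) ((d1 + d) * (log 2 + h0)) (by positivity) (by
      intro k l
      simp only [a]
      have a1 := house_choose_pow (P k.1.1.1.1) h0 h00 (hP _) l.1 k.1.2 d1 (by omega)
      have a2 := house_choose_pow (P k.1.1.1.2) h0 h00 (hP _) l.2 k.1.1.2 d (by omega)
      rw [RingOfIntegers.coe_eq_algebraMap] at a1 a2
      rw [map_mul]
      refine (house_mul_le _ _).trans ((mul_le_mul a1 a2 (house_nonneg _) (exp_pos _).le).trans (le_of_eq ?_))
      rw [← exp_add]; congr 1; ring)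
  refine ⟨fun x y => if h : x < d1 + 1 ∧ y < d + 1 then ξ (⟨x, h.1⟩, ⟨y, h.2⟩) else 0, ?_, ?_, ?_⟩
  · obtain ⟨⟨x, y⟩, hxy⟩ := Function.ne_iff.1 hξ0
    refine ⟨x, by omega, y, by omega, ?_⟩
    simp only
    rw [dif_pos ⟨x.2, y.2⟩]; exact hxy
  · intro x y
    simp only
    split_ifs with h
    · refine (hξb _).trans (exp_le_exp.2 ?_)
      rw [hcardβ]
      have hlog : log (((d1:ℝ) + 1) * (d + 1)) ≤ 2 * d * n := by
        rw [log_mul (by positivity) (by positivity)]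
        have q1 := log_le_sub_one_of_pos (by positivity : (0:ℝ) < d1 + 1)
        have q2 := log_le_sub_one_of_pos (by positivity : (0:ℝ) < (d:ℝ) + 1)
        linarith
      have hA : ((d1:ℝ) + d) * (log 2 + h0) ≤ (2 * d * (log 2 + h0)) * n := by
        have : (d1:ℝ) + d ≤ 2 * d * n := by linarith
        calc ((d1:ℝ) + d) * (log 2 + h0) ≤ (2 * d * n) * (log 2 + h0) := by gcongr
          _ = _ := by ring
      have hCn : Cs ≤ Cs * n := le_mul_of_one_le_right hCs0 hn
      rw [add_mul Cs, div_mul_eq_mul_div]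
      refine add_le_add hCn (div_le_div_of_nonneg_right ?_ hη0.le)
      linarith
    · rw [RingOfIntegers.coe_eq_algebraMap, map_zero, house_zero']; exact (exp_pos _).le
  · intro j j' hR i hi i' hi' hlt
    have hmem : (((j, j'), i'), i) ∈ eqs b R n (n * d * k0) d1 d := by
      unfold eqs
      rw [Finset.mem_filter]
      refine ⟨?_, hR, hlt⟩
      simp only [Finset.mem_product, Finset.mem_univ, Finset.mem_range, true_and]
      omega
    have hz := congrFun hξ ⟨_, hmem⟩
    rw [Matrix.mulVec, dotProduct, Fintype.sum_prod_type] at hz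
    unfold tt
    rw [Finset.sum_range]
    refine Eq.trans (Finset.sum_congr rfl fun x _ => ?_) hz
    rw [Finset.sum_range]
    refine Finset.sum_congr rfl fun y _ => ?_
    simp only
    rw [dif_pos ⟨x.2, y.2⟩]
    simp only [a]
    ring

end siegel
end MT
end partF7

section partF8
open NumberField Height Real Polynomial

namespace MT
section nonvan
variable {K : Type} [Field K] [NumberField K] {N : Type} [Field N] [NumberField N] [Algebra K N]

lemma nonvan (d1 d : ℕ) (p : ℕ → ℕ → 𝓞 K) (M : ℝ) (hM0 : 0 ≤ M) (hp : ∀ x y, house (p x y : K) ≤ exp M)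
    (x0 y0 : ℕ) (hx0 : x0 ≤ d1) (hy0 : y0 ≤ d) (hp0 : p x0 y0 ≠ 0) (a a' : N)
    (ha' : Module.finrank ℚ N * (log 2 + M) < logHeight₁ a') :
    ∃ m, nu d1 d p m a a' ≠ 0 ∧ 
      ((m - d : ℕ) : ℝ) * logHeight₁ a ≤ Module.finrank ℚ N * ((m - d : ℕ) * log 2 + zM d d1 M) := by
  set φ := (algebraMap K N).comp (algebraMap (𝓞 K) K) with hφ
  have hφapp : ∀ z : 𝓞 K, φ z = algebraMap K N (z : K) := fun z => rfl
  let Pb : Fin (d + 1) → (𝓞 K)[X] := fun b => ∑ x ∈ Finset.range (d1 + 1), C (p x b) * X ^ x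
  have hcoeff : ∀ (b : Fin (d + 1)) (i : ℕ), (Pb b).coeff i = if i ∈ Finset.range (d1 + 1) then p i b else 0 := by
    intro b i
    simp only [Pb, finsetSum_coeff, coeff_C_mul, coeff_X_pow, mul_ite, mul_one, mul_zero]
    rw [Finset.sum_ite_eq]
  set F := ∑ b : Fin (d + 1), C (a' ^ (b : ℕ)) * (Pb b).map φ with hF
  have hF0 : F ≠ 0 := by
    intro h0
    let U : (𝓞 K)[X] := ∑ y ∈ Finset.range (d + 1), C (p x0 y) * X ^ y
    have hUc : ∀ i, U.coeff i = if i ∈ Finset.range (d + 1) then p x0 i else 0 := by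
      intro i
      simp only [U, finsetSum_coeff, coeff_C_mul, coeff_X_pow, mul_ite, mul_one, mul_zero]
      rw [Finset.sum_ite_eq]
    have hU0 : U ≠ 0 := by
      intro h
      have := hUc y0
      rw [h, coeff_zero, if_pos (by rw [Finset.mem_range]; omega)] at this
      exact hp0 this.symm
    have hdvd : (X - C a') ^ 1 ∣ U.map φ := by
      rw [pow_one, dvd_iff_isRoot, IsRoot.def]
      have h1 := congrArg (fun G => G.coeff x0) h0
      simp only [hF, finsetSum_coeff, coeff_C_mul, coeff_map, coeff_zero, hcoeff] at h1
      rw [← h1, Polynomial.eval_map]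
      simp only [U, eval₂_finsetSum, eval₂_mul, eval₂_C, eval₂_X_pow]
      rw [Finset.sum_range]
      refine Finset.sum_congr rfl fun b _ => ?_
      rw [if_pos (by rw [Finset.mem_range]; omega), mul_comm]
    have := root_mult U hU0 a' 1 M (fun i => by
      rw [hUc]; split_ifs
      · exact hp _ _
      · rw [RingOfIntegers.coe_eq_algebraMap, map_zero, house_zero']; exact (exp_pos _).le) hdvd
    simp only [Nat.cast_one, one_mul] at this
    linarith
  set m := F.rootMultiplicity a with hm
  obtain ⟨Q, hQ, hQ2⟩ := exists_eq_pow_rootMultiplicity_mul_and_not_dvd F hF0 a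
  refine ⟨m, ?_, ?_⟩
  · have h1 : nu d1 d p m a a' = (hasseDeriv m F).eval a := by
      rw [hF, map_sum, eval_finsetSum]
      unfold nu
      rw [Finset.sum_comm, Finset.sum_range]
      refine Finset.sum_congr rfl fun b _ => ?_
      rw [← smul_eq_C_mul, map_smul, eval_smul, smul_eq_mul]
      simp only [Pb]
      rw [Polynomial.map_sum, map_sum, eval_finsetSum, Finset.mul_sum]
      refine Finset.sum_congr rfl fun x _ => ?_
      rw [Polynomial.map_mul, map_C, Polynomial.map_pow, map_X, C_mul_X_pow_eq_monomial, hasseDeriv_monomial, eval_monomial, hφapp]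
      ring
    rw [h1, ← taylor_coeff, hQ, taylor_mul, taylor_pow]
    have : taylor a (X - C a) = X := by simp
    rw [this, ← hm, coeff_X_pow_mul', if_pos le_rfl, Nat.sub_self, taylor_coeff_zero]
    intro h
    exact hQ2 (dvd_iff_isRoot.2 h)
  · refine zero_est d d1 Pb ?_ M hM0 ?_ a a' m hF0 (pow_rootMultiplicity_dvd F a)
    · intro b
      rw [natDegree_le_iff_coeff_eq_zero]
      intro i hi
      rw [hcoeff, if_neg]; rw [Finset.mem_range]; omega
    · intro b i
      rw [hcoeff]; split_ifs
      · exact hp _ _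
      · rw [RingOfIntegers.coe_eq_algebraMap, map_zero, house_zero']; exact (exp_pos _).le

end nonvan
end MT
end partF8

section partF9
open NumberField Height Real Polynomial

namespace MT
section twopt
variable {K : Type} [Field K] [NumberField K] {J : ℕ}

/-- pure real-number endgame -/
lemma endgame (d δ h n m Jr CG CZ Cw Ck Ce k0 τ : ℝ) (hd : 1 ≤ d) (hδ : δ = k0 * τ - 2) (hδ0 : 0 < δ)
    (hJ : 0 ≤ Jr) (hCw : 0 ≤ Cw)
    (hCe : d * Ce ≤ d * (δ / 4)) (hm0 : 0 ≤ m)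
    (hh2 : 2 ≤ h) (hhw : Cw ≤ h) (hn : 8 * Jr ≤ n * δ) (hn1 : 1 ≤ n)
    (hm : (m - d) * (h - log 2) ≤ CZ * n) (hCZ : 0 ≤ CZ)
    (hhbig : 4 * (CG + d * Ck + 4 * Jr * CZ) < d * δ * h)
    (hmain : 0 ≤ CG * n + n * d * h + d * n * h - n * d * (k0 * τ * h - Ck - Ce * h) + m * Jr * (h + Cw)) : False := by
  have hl2 : log 2 < 1 := by linarith [log_two_lt_d9]
  have h1 : (m - d) * h ≤ 2 * (CZ * n) := by
    by_cases hmd : m ≤ d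
    · have : 0 ≤ CZ * n := by positivity
      nlinarith
    · push Not at hmd; nlinarith
  have h2 : m * Jr * (h + Cw) ≤ Jr * (2 * (m * h)) := by
    have : m * Jr * (h + Cw) ≤ m * Jr * (h + h) := by gcongr
    linarith
  have h3 : Jr * (2 * (m * h)) ≤ Jr * (2 * (d * h) + 4 * (CZ * n)) := by
    gcongr; linarith
  have h4 : 8 * Jr * (d * h) ≤ n * δ * (d * h) := by gcongr
  have h5 : n * h * (d * Ce) ≤ n * h * (d * (δ / 4)) := by gcongr
  have h6 : n * (4 * (CG + d * Ck + 4 * Jr * CZ)) < n * (d * δ * h) := by gcongr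
  have h7 : n * d * h * (k0 * τ) = n * d * h * (δ + 2) := by rw [hδ]; ring
  have h8 : 0 < n * d * h * δ := by positivity
  nlinarith

set_option maxHeartbeats 4000000 in
theorem two_pt (P : Fin J → 𝓞 K) (hPinj : Function.Injective P) (B : Fin J → ℂ) 
    (h1 : ∑ j, B j = 0) (h2 : ∑ j, B j ^ 2 = 0) (h3 : ∑ j, ‖B j‖ ^ 2 = 1) :
    ∃ ε : ℝ, 0 < ε ∧ ∃ H0 n0 : ℝ, ∀ (N : Type) [Field N] [NumberField N] [Algebra K N] (a a' : N) (h n : ℝ),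
      logHeight₁ a = Module.finrank ℚ N * h → logHeight₁ a' = Module.finrank ℚ N * (n * h) → 
      H0 ≤ h → n0 ≤ n → (∀ j, a ≠ algebraMap K N (P j)) → (∀ j, a' ≠ algebraMap K N (P j)) → 
      ∀ X : Finset N, (∀ x ∈ X, x ≠ 0) → 
      (∀ T : Finset (FinitePlace N), (∀ x ∈ X, GoodT T x) → 
        ∑ w : Pl T, ‖∑ j, B j * (lam T w a' (algebraMap K N (P j)) : ℂ) - n * ∑ j, B j * (lam T w a (algebraMap K N (P j)) : ℂ)‖ ≤ Module.finrank ℚ N * (ε * (n * h))) →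
      False := by
  classical
  obtain ⟨k0, hk0, hk0T, hk0S⟩ := geoB B h1 h2 h3
  set τ := ∑ j, ‖B j‖ with hτ
  obtain ⟨Cg, hCg0, hCg⟩ := geoD B
  set h0 := ∑ j, house (P j : K) with hh0
  have h00 : 0 ≤ h0 := Finset.sum_nonneg fun _ _ => house_nonneg _
  have hP0 : ∀ j, house (P j : K) ≤ exp h0 := by
    intro j
    have a1 : house (P j : K) ≤ h0 := Finset.single_le_sum (f := fun j => house (P j : K)) (fun _ _ => house_nonneg _) (Finset.mem_univ j)
    linarith [add_one_le_exp h0]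
  obtain ⟨d, hd0, Cs, hCs0, hsieg⟩ := siegelP P (fun j => ‖B j‖) (SD B) (fun j j' h => ⟨h.pos1, h.pos2⟩) k0 hk0 hk0S h0 h00 hP0
  have hd1 : (1:ℝ) ≤ d := by exact_mod_cast hd0
  have hl2 := log_nonneg (by norm_num : (1:ℝ) ≤ 2)
  set δ := k0 * τ - 2 with hδ
  have hδ0 : 0 < δ := by rw [hδ]; linarith
  set Cw := 2 * log 2 + ∑ j, logHeight₁ (P j : K) + ∑ i, ∑ j, 2 * logHeight₁ ((P i : K) - P j) with hCw
  have hCw0 : 0 ≤ Cw := by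
    have q1 : 0 ≤ ∑ j, logHeight₁ (P j : K) := Finset.sum_nonneg fun _ _ => zero_le_logHeight₁ _
    have q2 : 0 ≤ ∑ i, ∑ j, 2 * logHeight₁ ((P i : K) - P j) := Finset.sum_nonneg fun _ _ => Finset.sum_nonneg fun _ _ => mul_nonneg (by norm_num) (zero_le_logHeight₁ _)
    positivity
  set ε := δ / (4 * k0 * (Cg + 1)) with hε
  have hε0 : 0 < ε := by positivity
  set CG := 4 * d + 2 * d * (2 * log 2 + h0) + Cs with hCG
  set CZ := log ((d + 1).factorial) + (d + 1) * ((d + 1) * d + Cs) with hCZ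
  have hCZ0 : 0 ≤ CZ := by
    have : 0 ≤ log (((d + 1).factorial : ℕ) : ℝ) := log_natCast_nonneg _
    positivity
  have hCG0 : 0 ≤ CG := by positivity
  refine ⟨ε, hε0, 2 + Cw + (log 2 + Cs) + 4 * (CG + d * (k0 * Cg * Cw) + 4 * J * CZ) / (d * δ), 1 + 8 * J / δ, ?_⟩
  intro N _ _ _ a a' h n hha hha' hH hn0 haP haP' X hX hE
  have hJ0 : (0:ℝ) ≤ J := Nat.cast_nonneg _
  have hH' : 0 ≤ 4 * (CG + d * (k0 * Cg * Cw) + 4 * J * CZ) / (d * δ) := by positivity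
  have hn1 : 1 ≤ n := by
    have : 0 ≤ 8 * J / δ := by positivity
    linarith
  have hh2 : 2 ≤ h := by linarith
  have hnh : h ≤ n * h := le_mul_of_one_le_left (by linarith) hn1
  set D : ℝ := (Module.finrank ℚ N : ℝ) with hD
  have hD0 : 0 < D := by rw [hD]; exact_mod_cast Module.finrank_pos
  obtain ⟨p, ⟨x0, hx0, y0, hy0, hp0⟩, hpb, hpv⟩ := hsieg n hn1
  set d1 := ⌊n * d⌋₊ with hd1'
  have hd1le : (d1 : ℝ) ≤ n * d := Nat.floor_le (by positivity)
  have hdn : (d:ℝ) ≤ n * d := le_mul_of_one_le_left (by positivity) hn1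
  obtain ⟨m, hν, hm⟩ := nonvan d1 d p (Cs * n) (by positivity) hpb x0 y0 hx0 hy0 hp0 a a' (by
    rw [hha']
    apply mul_lt_mul_of_pos_left _ hD0
    have : log 2 ≤ log 2 * n := le_mul_of_one_le_right hl2 hn1
    have : (log 2 + Cs) * n < h * n := by gcongr; linarith
    linarith)
  set ν := nu d1 d p m a a' with hνdef
  have ha0 : a ≠ 0 := by
    intro h0; rw [h0, logHeight₁_zero] at hha
    have : 0 < D * h := by positivity
    linarith
  have ha0' : a' ≠ 0 := by
    intro h0; rw [h0, logHeight₁_zero] at hha'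
    have : 0 < D * (n * h) := by positivity
    linarith
  let Q : Fin J → N := fun j => algebraMap K N (P j)
  have hQinj : ∀ i j, i ≠ j → Q i ≠ Q j := by
    intro i j hij h
    exact hij (hPinj (RingOfIntegers.ext ((algebraMap K N).injective h)))
  -- the set of places
  let Y : Finset N := X ∪ {a, a', ν} ∪ (Finset.univ.image fun j => a - Q j) ∪ (Finset.univ.image fun j => a' - Q j) ∪ 
    ((Finset.univ.image fun j => Q j).filter (· ≠ 0)) ∪ ((Finset.univ.image fun z : Fin J × Fin J => Q z.1 - Q z.2).filter (· ≠ 0))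
  obtain ⟨T, hT⟩ := exists_goodT Y (by
    intro x hx
    simp only [Y, Finset.mem_union, Finset.mem_insert, Finset.mem_singleton, Finset.mem_image, Finset.mem_filter, Finset.mem_univ, true_and] at hx
    rcases hx with ((((hx | (rfl | rfl | rfl)) | ⟨j, rfl⟩) | ⟨j, rfl⟩) | hx) | hx
    · exact hX x hx
    · exact ha0
    · exact ha0'
    · exact hν
    · exact sub_ne_zero.2 (haP j)
    · exact sub_ne_zero.2 (haP' j)
    · exact hx.2
    · exact hx.2)
  have hTX : ∀ x ∈ X, GoodT T x := fun x hx => hT x (by simp only [Y, Finset.mem_union]; tauto)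
  have hTa : GoodT T a := hT a (by simp [Y])
  have hTa' : GoodT T a' := hT a' (by simp [Y])
  have hTν : GoodT T ν := hT ν (by simp [Y])
  have hTaQ : ∀ j, GoodT T (a - Q j) := fun j => hT _ (by simp [Y])
  have hTaQ' : ∀ j, GoodT T (a' - Q j) := fun j => hT _ (by simp [Y])
  have hTQ : ∀ j, Q j = 0 ∨ GoodT T (Q j) := fun j => by
    by_cases h : Q j = 0
    · exact Or.inl h
    · exact Or.inr (hT _ (by simp only [Y, Finset.mem_union, Finset.mem_filter, Finset.mem_image, Finset.mem_univ, true_and]; exact Or.inl (Or.inr ⟨⟨j, rfl⟩, h⟩)))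
  have hTQQ : ∀ i j, Q i - Q j = 0 ∨ GoodT T (Q i - Q j) := fun i j => by
    by_cases h : Q i - Q j = 0
    · exact Or.inl h
    · exact Or.inr (hT _ (by simp only [Y, Finset.mem_union, Finset.mem_filter, Finset.mem_image, Finset.mem_univ, true_and]; exact Or.inr ⟨⟨(i, j), rfl⟩, h⟩))
  have hE' := hE T hTX
  set E : Pl T → ℝ := fun w => ‖∑ j, B j * (lam T w a' (Q j) : ℂ) - n * ∑ j, B j * (lam T w a (Q j) : ℂ)‖ with hEdef
  -- local claims
  have hloc : ∀ w : Pl T, ∃ g : ℝ, 0 ≤ g ∧ (g = 0 ∨ ∃ j j', SD B j j' ∧ g ≤ ‖B j‖ * lam T w a (Q j) ∧ n * g ≤ ‖B j'‖ * lam T w a' (Q j')) ∧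
      ∑ j, ‖B j‖ * lam T w a (Q j) ≤ g + Cg * (cw Q w + E w / n) := fun w =>
    hCg (cw Q w) n (fun j => lam T w a (Q j)) (fun j => lam T w a' (Q j)) (cw_nonneg w) hn1
      (fun j => lam_ge w a j (haP j)) (fun j => lam_ge w a' j (haP' j))
      (fun i j hij => lam_two w a i j (hQinj i j hij) (haP i) (haP j))
      (fun i j hij => lam_two w a' i j (hQinj i j hij) (haP' i) (haP' j))
  choose g hg0 hg1 hg2 using hloc
  -- sum of cw
  have hcwsum : ∑ w : Pl T, cw Q w ≤ D * Cw := by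
    refine (sum_cw hTQ hTQQ).trans ?_
    have hfr : (Module.finrank K N : ℝ) ≤ D := by
      have : FiniteDimensional K N := FiniteDimensional.right ℚ K N
      rw [hD, ← Module.finrank_mul_finrank ℚ K N]; push_cast
      have : (1:ℝ) ≤ Module.finrank ℚ K := by exact_mod_cast Module.finrank_pos
      exact le_mul_of_one_le_left (Nat.cast_nonneg _) this
    have e1 : ∀ x : K, logHeight₁ (algebraMap K N x) ≤ D * logHeight₁ x := fun x => by
      rw [logHeight_ext]; exact mul_le_mul_of_nonneg_right hfr (zero_le_logHeight₁ _)
    rw [hCw, mul_add, mul_add, Finset.mul_sum, Finset.mul_sum]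
    refine add_le_add (add_le_add le_rfl (Finset.sum_le_sum fun j _ => e1 _)) (Finset.sum_le_sum fun i _ => ?_)
    rw [Finset.mul_sum]
    refine Finset.sum_le_sum fun j _ => ?_
    have := e1 ((P i : K) - P j)
    rw [map_sub] at this
    simp only [Q]
    linarith
  have hlamsum : ∀ j, ∑ w : Pl T, lam T w a (Q j) = D * h := fun j => by rw [sum_lam hTa (hTaQ j), hha]
  -- lower bound for the sum of g
  have hgsum : τ * (D * h) ≤ ∑ w, g w + Cg * (D * Cw + D * (ε * h)) := by
    have e : τ * (D * h) = ∑ w : Pl T, ∑ j, ‖B j‖ * lam T w a (Q j) := by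
      rw [Finset.sum_comm, hτ, Finset.sum_mul]
      refine Finset.sum_congr rfl fun j _ => ?_
      rw [← Finset.mul_sum, hlamsum]
    rw [e]
    refine (Finset.sum_le_sum fun w _ => hg2 w).trans ?_
    rw [Finset.sum_add_distrib, ← Finset.mul_sum, Finset.sum_add_distrib, ← Finset.sum_div]
    have hEn : (∑ w, E w) / n ≤ D * (ε * h) := by
      rw [div_le_iff₀ (by linarith)]
      refine hE'.trans (le_of_eq (by ring))
    gcongr
  -- local upper bounds for nu
  have hup : ∀ w : Pl T, log (pv T w ν) ≤ ew w * GG d1 d (Cs * n) h0 + d1 * log⁺ (pv T w a) + d * log⁺ (pv T w a')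
      - n * d * k0 * g w + m * ∑ j, (lam T w a (Q j) + cw Q w) := by
    intro w
    have hpos : 0 < pv T w ν := (pv T w).pos hν
    have hnn : ∀ j, 0 ≤ lam T w a (Q j) + cw Q w := fun j => by linarith [lam_ge (P := Q) w a j (haP j)]
    have hsn : 0 ≤ ∑ j, (lam T w a (Q j) + cw Q w) := Finset.sum_nonneg fun j _ => hnn j
    rcases hg1 w with h | ⟨j, j', hR, q1, q2⟩
    · rw [h]
      have := nu_bound1 w d1 d p (Cs * n) h0 h00 hpb m a a'
      rw [← log_le_iff_le_exp hpos] at this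
      have : 0 ≤ (m:ℝ) * ∑ j, (lam T w a (Q j) + cw Q w) := by positivity
      linarith
    · have := nu_bound2 w d1 d p (Cs * n) h0 h00 hpb m a a' (P j) (P j') (hP0 j) (hP0 j') (haP j) (haP' j')
        ‖B j‖ ‖B j'‖ n (n * d * k0) (g w) hR.pos1 hR.pos2 (by linarith) (hpv j j' hR) (hg0 w) q1 q2
      rw [← log_le_iff_le_exp hpos] at this
      have q3 : lam T w a (Q j) ≤ ∑ j, (lam T w a (Q j) + cw Q w) := by
        have := Finset.single_le_sum (f := fun j => lam T w a (Q j) + cw Q w) (fun j _ => hnn j) (Finset.mem_univ j)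
        have := cw_nonneg (P := Q) w
        linarith
      have q4 : (m:ℝ) * lam T w a (Q j) ≤ m * ∑ j, (lam T w a (Q j) + cw Q w) := by gcongr
      linarith
  have hsum := Finset.sum_le_sum (s := Finset.univ) fun w _ => hup w
  rw [pl_sum_log hTν] at hsum
  simp only [Finset.sum_add_distrib, Finset.sum_sub_distrib, ← Finset.mul_sum, ← Finset.sum_mul] at hsum
  rw [sum_ew, pl_sum_posLog hTa, pl_sum_posLog hTa', hha, hha'] at hsum
  have e1 : ∑ w : Pl T, ∑ j, lam T w a (Q j) = J * (D * h) := by rw [Finset.sum_comm]; simp [hlamsum]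
  have e2 : ∑ w : Pl T, ∑ _j : Fin J, cw Q w = J * ∑ w : Pl T, cw Q w := by simp only [Finset.sum_const, Finset.card_univ, Fintype.card_fin, nsmul_eq_mul, Finset.mul_sum]
  rw [e1, e2] at hsum
  try rw [← hD] at hsum
  -- constants
  have hlog : log (((d1:ℝ) + 1) * (d + 1)) ≤ 2 * d * n := by
    rw [log_mul (by positivity) (by positivity)]
    have q1 := log_le_sub_one_of_pos (by positivity : (0:ℝ) < d1 + 1)
    have q2 := log_le_sub_one_of_pos (by positivity : (0:ℝ) < (d:ℝ) + 1)
    linarith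
  have hGG : GG d1 d (Cs * n) h0 ≤ CG * n := by
    unfold GG
    have : ((d1:ℝ) + d) * (2 * log 2 + h0) ≤ (2 * d * n) * (2 * log 2 + h0) := by gcongr; linarith
    rw [hCG]; linarith
  have hZZ : zM d d1 (Cs * n) ≤ CZ * n := by
    unfold zM
    have q1 := log_le_sub_one_of_pos (by positivity : (0:ℝ) < d1 + 1)
    have q2 : log (d1 + 1) ≤ d * n := by linarith
    have q3 : ((d:ℝ) + 1) * ((d + 1) * log (d1 + 1) + Cs * n) ≤ (d + 1) * ((d + 1) * (d * n) + Cs * n) := by gcongr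
    have q4 : 0 ≤ log (((d + 1).factorial : ℕ) : ℝ) := log_natCast_nonneg _
    have q5 : log (((d + 1).factorial : ℕ) : ℝ) ≤ log (((d + 1).factorial : ℕ) : ℝ) * n := le_mul_of_one_le_right q4 hn1
    rw [hCZ]; linarith
  have hm' : ((m:ℝ) - d) * (h - log 2) ≤ CZ * n := by
    rw [hha] at hm
    have q1 : ((m - d : ℕ) : ℝ) * (h - log 2) ≤ CZ * n := by
      have : D * (((m - d : ℕ) : ℝ) * (h - log 2)) ≤ D * (CZ * n) := by
        have : D * zM d d1 (Cs * n) ≤ D * (CZ * n) := by gcongr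
        linarith
      exact le_of_mul_le_mul_left this hD0
    have q2 : (m:ℝ) - d ≤ ((m - d : ℕ) : ℝ) := by
      have : (m:ℝ) ≤ ((m - d : ℕ) : ℝ) + d := by exact_mod_cast (by omega : m ≤ (m - d) + d)
      linarith
    have q3 : 0 ≤ h - log 2 := by linarith [log_two_lt_d9]
    exact (mul_le_mul_of_nonneg_right q2 q3).trans q1
  have hcw' : (m:ℝ) * (J * (D * h) + J * ∑ w : Pl T, cw Q w) ≤ D * (m * J * (h + Cw)) := by
    have : (m:ℝ) * (J * (D * h) + J * ∑ w : Pl T, cw Q w) ≤ m * (J * (D * h) + J * (D * Cw)) := by gcongr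
    linarith
  have hd1h : (d1:ℝ) * (D * h) ≤ D * (n * d * h) := by
    have : (d1:ℝ) * (D * h) ≤ n * d * (D * h) := by gcongr
    linarith
  have hgk : n * d * k0 * (τ * (D * h) - Cg * (D * Cw + D * (ε * h))) ≤ n * d * k0 * ∑ w, g w := by
    apply mul_le_mul_of_nonneg_left _ (by positivity); linarith
  have hGD : D * GG d1 d (Cs * n) h0 ≤ D * (CG * n) := by gcongr
  refine endgame d δ h n m J CG CZ Cw (k0 * Cg * Cw) (k0 * Cg * ε) k0 τ hd1 hδ hδ0 hJ0 hCw0 ?_ (Nat.cast_nonneg _) hh2 ?_ ?_ hn1 hm' hCZ0 ?_ ?_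
  · gcongr
    rw [hε, mul_div_assoc', div_le_div_iff₀ (by positivity) (by positivity)]
    have : 0 ≤ k0 * δ := by positivity
    linarith
  · linarith
  · have : 8 * J / δ ≤ n := by linarith
    rwa [div_le_iff₀ hδ0] at this
  · have : 4 * (CG + d * (k0 * Cg * Cw) + 4 * J * CZ) / (d * δ) < h := by linarith
    rw [div_lt_iff₀ (by positivity)] at this
    linarith
  · have : 0 ≤ D * (CG * n + n * d * h + d * n * h - n * d * (k0 * τ * h - k0 * Cg * Cw - k0 * Cg * ε * h) + m * J * (h + Cw)) := by
      linarith
    exact nonneg_of_mul_nonneg_right this hD0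

end twopt
end MT
end partF9

section partF10
open NumberField Height Real Polynomial
open scoped IntermediateField

namespace MT

section thmH
variable {K : Type} [Field K] [NumberField K] {J s : ℕ}
variable {Qb : Type} [Field Qb] [CharZero Qb] [Algebra.IsAlgebraic ℚ Qb] [Algebra K Qb]

lemma numberField_adjoin (S : Set Qb) [Finite S] : NumberField (IntermediateField.adjoin K S) := by
  have : Algebra.IsAlgebraic K Qb := Algebra.IsAlgebraic.tower_top (K := ℚ) K
  have : FiniteDimensional K (IntermediateField.adjoin K S) :=
    IntermediateField.finiteDimensional_adjoin fun x _ => (Algebra.IsAlgebraic.isAlgebraic x).isIntegral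
  have : CharZero (IntermediateField.adjoin K S) := charZero_of_injective_algebraMap (algebraMap K _).injective
  have : FiniteDimensional ℚ (IntermediateField.adjoin K S) := FiniteDimensional.trans ℚ K _
  exact {}

/-- The relations satisfied by the point `α`. -/
def Rels (P : Fin J → 𝓞 K) (c : Fin s → K) (α : Qb) (β β' : Fin J → ℤ) (b b' : Fin s → ℤ) : Prop :=
  NonProp β β' ∧ ∑ j, β j = 0 ∧ ∑ j, β' j = 0 ∧
  IsRel (fun j => α - algebraMap K Qb (P j)) (fun l => algebraMap K Qb (c l)) β b ∧
  IsRel (fun j => α - algebraMap K Qb (P j)) (fun l => algebraMap K Qb (c l)) β' b'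

lemma isRel_pull (P : Fin J → 𝓞 K) (c : Fin s → K) (α : Qb) (β : Fin J → ℤ) (b : Fin s → ℤ)
    (h : IsRel (fun j => α - algebraMap K Qb (P j)) (fun l => algebraMap K Qb (c l)) β b)
    (N : Type) [Field N] [Algebra K N] (φ : N →ₐ[K] Qb) (a : N) (ha : φ a = α) :
    IsRel (fun j => a - algebraMap K N (P j)) (fun l => algebraMap K N (c l)) β b := by
  unfold IsRel at *
  apply φ.injective
  rw [map_mul, map_prod, map_prod, map_one, ← h]
  simp only [map_zpow₀, map_sub, AlgHom.toRingHom_eq_coe, RingHom.coe_coe, ha, AlgHom.commutes]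

lemma isRel_log {E : Type} [Field E] (x : Fin J → E) (c : Fin s → E) (hx : ∀ j, x j ≠ 0) (hc : ∀ l, c l ≠ 0)
    (β : Fin J → ℤ) (b : Fin s → ℤ) (h : IsRel x c β b) (v : AbsoluteValue E ℝ) :
    ∑ j, (β j : ℝ) * log (v (x j)) + ∑ l, (b l : ℝ) * log (v (c l)) = 0 := by
  have := congrArg (fun z => log (v z)) h
  simp only [map_mul, map_one, log_one] at this
  rw [log_mul, log_abv_prod_zpow v x hx, log_abv_prod_zpow v c hc] at this
  · exact this
  · exact (v.pos (Finset.prod_ne_zero_iff.2 fun j _ => zpow_ne_zero _ (hx j))).ne'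
  · exact (v.pos (Finset.prod_ne_zero_iff.2 fun j _ => zpow_ne_zero _ (hc j))).ne'

lemma finrank_le_cast {N : Type} [Field N] [NumberField N] [Algebra K N] : (Module.finrank K N : ℝ) ≤ Module.finrank ℚ N := by
  have : FiniteDimensional K N := FiniteDimensional.right ℚ K N
  rw [← Module.finrank_mul_finrank ℚ K N]; push_cast
  have : (1:ℝ) ≤ Module.finrank ℚ K := by exact_mod_cast Module.finrank_pos
  exact le_mul_of_one_le_left (Nat.cast_nonneg _) this

/-- sum of logs of `a - P j` -/
lemma sum_abs_log_sub (P : Fin J → 𝓞 K) {N : Type} [Field N] [NumberField N] [Algebra K N] (a : N) (h : ℝ) (h1 : 1 ≤ h)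
    (hha : logHeight₁ a = Module.finrank ℚ N * h) (T : Finset (FinitePlace N)) (hT : ∀ j, GoodT T (a - algebraMap K N (P j))) :
    ∑ w : Pl T, ∑ j, |log (pv T w (a - algebraMap K N (P j)))| ≤
      Module.finrank ℚ N * (h * (2 * ∑ j, (1 + log 2 + logHeight₁ (P j : K)))) := by
  rw [Finset.sum_comm, Finset.mul_sum, Finset.mul_sum, Finset.mul_sum]
  refine Finset.sum_le_sum fun j _ => ?_
  rw [pl_sum_abs_log (hT j)]
  have q := logHeight_sub_le' a (P j : K)
  rw [hha] at q
  have hl2 := log_nonneg (by norm_num : (1:ℝ) ≤ 2)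
  have hp := zero_le_logHeight₁ (P j : K)
  have : (Module.finrank ℚ N : ℝ) * (log 2 + logHeight₁ (P j : K)) ≤ Module.finrank ℚ N * (h * (log 2 + logHeight₁ (P j : K))) := by
    gcongr
    exact le_mul_of_one_le_left (by positivity) h1
  linarith

lemma rel_data (P : Fin J → 𝓞 K) (c : Fin s → K) (hc : ∀ l, c l ≠ 0)
    (hind : ∀ a : Fin s → ℤ, ∏ i, c i ^ a i = 1 → a = 0) : ∃ C0 : ℝ, ∀ α : Qb, 1 ≤ ht α →
    (∀ j, α ≠ algebraMap K Qb (P j)) → ∀ β β' b b', Rels P c α β β' b b' →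
    ∃ (B : Fin J → ℂ) (A : Fin s → ℂ), ∑ j, B j = 0 ∧ ∑ j, B j ^ 2 = 0 ∧ ∑ j, ‖B j‖ ^ 2 = 1 ∧ (∀ l, ‖A l‖ ≤ C0) ∧
      ∀ (N : Type) [Field N] [Algebra K N] (φ : N →ₐ[K] Qb) (a : N), φ a = α → ∀ v : AbsoluteValue N ℝ,
        ∑ j, B j * (log (v (a - algebraMap K N (P j))) : ℂ) + ht α * ∑ l, A l * (log (v (algebraMap K N (c l))) : ℂ) = 0 := by
  classical
  obtain ⟨c0, hc0, hS⟩ := lemmaS c hc hind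
  set M := 2 * ∑ j, (1 + log 2 + logHeight₁ (P j : K)) with hM
  refine ⟨M / c0 + M / c0, fun α hα hαP β β' b b' ⟨hnp, hs, hs', hr, hr'⟩ => ?_⟩
  obtain ⟨x, y, h2, h3⟩ := geoA β β' hnp
  have h0 : (0:ℝ) < ht α := by linarith
  have h0' : (ht α : ℂ) ≠ 0 := by exact_mod_cast h0.ne'
  set B : Fin J → ℂ := fun j => x * β j + y * β' j with hB
  set A : Fin s → ℂ := fun l => (x * b l + y * b' l) / ht α with hA
  have hid : ∀ (N : Type) [Field N] [Algebra K N] (φ : N →ₐ[K] Qb) (a : N), φ a = α → ∀ v : AbsoluteValue N ℝ,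
        ∑ j, B j * (log (v (a - algebraMap K N (P j))) : ℂ) + ht α * ∑ l, A l * (log (v (algebraMap K N (c l))) : ℂ) = 0 := by
    intro N _ _ φ a ha v
    have hx : ∀ j, a - algebraMap K N (P j) ≠ 0 := fun j h => by
      apply hαP j
      rw [← ha, sub_eq_zero.1 h, AlgHom.commutes]
    have hc' : ∀ l, algebraMap K N (c l) ≠ 0 := fun l => by simpa using hc l
    have q1 := isRel_log _ _ hx hc' β b (isRel_pull P c α β b hr N φ a ha) v
    have q2 := isRel_log _ _ hx hc' β' b' (isRel_pull P c α β' b' hr' N φ a ha) v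
    have q1' : ∑ j, (β j : ℂ) * (log (v (a - algebraMap K N (P j))) : ℂ) + ∑ l, (b l : ℂ) * (log (v (algebraMap K N (c l))) : ℂ) = 0 := by
      exact_mod_cast congrArg (fun r : ℝ => (r : ℂ)) q1
    have q2' : ∑ j, (β' j : ℂ) * (log (v (a - algebraMap K N (P j))) : ℂ) + ∑ l, (b' l : ℂ) * (log (v (algebraMap K N (c l))) : ℂ) = 0 := by
      exact_mod_cast congrArg (fun r : ℝ => (r : ℂ)) q2
    have e : ∀ l, (ht α : ℂ) * (A l * (log (v (algebraMap K N (c l))) : ℂ)) = x * ((b l : ℂ) * (log (v (algebraMap K N (c l))) : ℂ)) + y * ((b' l : ℂ) * (log (v (algebraMap K N (c l))) : ℂ)) := by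
      intro l; simp only [hA]; field_simp
    rw [Finset.mul_sum, Finset.sum_congr rfl fun l _ => e l]
    simp only [hB, add_mul, Finset.sum_add_distrib, mul_assoc, ← Finset.mul_sum]
    linear_combination x * q1' + y * q2'
  refine ⟨B, A, ?_, h2, h3, ?_, hid⟩
  · simp only [hB, Finset.sum_add_distrib, ← Finset.mul_sum]
    rw [← Int.cast_sum, ← Int.cast_sum, hs, hs']; simp
  intro l
  let N := IntermediateField.adjoin K ({α} : Set Qb)
  have : NumberField N := numberField_adjoin _
  let a : N := ⟨α, IntermediateField.mem_adjoin_simple_self K α⟩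
  have ha : N.val a = α := rfl
  have hx : ∀ j, a - algebraMap K N (P j) ≠ 0 := fun j h => by
    apply hαP j
    rw [← ha, sub_eq_zero.1 h, AlgHom.commutes]
  obtain ⟨T, hT⟩ := exists_goodT ((Finset.univ.image fun j => a - algebraMap K N (P j)) ∪ (Finset.univ.image fun l => algebraMap K N (c l))) (by
    intro z hz
    simp only [Finset.mem_union, Finset.mem_image, Finset.mem_univ, true_and] at hz
    rcases hz with ⟨j, rfl⟩ | ⟨l, rfl⟩
    · exact hx j
    · simpa using hc l)
  have hT1 : ∀ j, GoodT T (a - algebraMap K N (P j)) := fun j => hT _ (by simp)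
  have hT2 : ∀ l, GoodT T (algebraMap K N (c l)) := fun l => hT _ (by simp)
  have hD0 : (0:ℝ) < Module.finrank ℚ N := by exact_mod_cast Module.finrank_pos
  have hha : logHeight₁ a = Module.finrank ℚ N * ht α := ht_eq (N.val : N →+* Qb) a
  have hsum := sum_abs_log_sub P a (ht α) hα hha T hT1
  have hB1 : ∀ j, ‖B j‖ ≤ 1 := fun j => by
    have := Finset.single_le_sum (f := fun j => ‖B j‖ ^ 2) (fun j _ => by positivity) (Finset.mem_univ j)
    rw [h3] at this
    exact (sq_le_one_iff₀ (norm_nonneg _)).1 this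
  have hnorm : ∀ w : Pl T, ‖ht α * ∑ l, A l * (log (pv T w (algebraMap K N (c l))) : ℂ)‖ ≤ ∑ j, |log (pv T w (a - algebraMap K N (P j)))| := by
    intro w
    have := hid N N.val a ha (pv T w)
    rw [add_comm] at this
    rw [eq_neg_of_add_eq_zero_left this, norm_neg]
    refine (norm_sum_le _ _).trans (Finset.sum_le_sum fun j _ => ?_)
    rw [norm_mul, Complex.norm_real, norm_eq_abs]
    exact mul_le_of_le_one_left (abs_nonneg _) (hB1 j)
  have hfin : ∀ t : ℝ, c0 * Module.finrank ℚ N * |ht α * t| ≤ ∑ w : Pl T, ‖ht α * ∑ l, A l * (log (pv T w (algebraMap K N (c l))) : ℂ)‖ → |t| ≤ M / c0 := by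
    intro t ht1
    have q := ht1.trans ((Finset.sum_le_sum fun w _ => hnorm w).trans hsum)
    rw [abs_mul, abs_of_pos h0] at q
    rw [le_div_iff₀ hc0]
    have : (Module.finrank ℚ N : ℝ) * ht α * (|t| * c0) ≤ Module.finrank ℚ N * ht α * M := by linarith
    exact le_of_mul_le_mul_left this (by positivity)
  refine (Complex.norm_le_abs_re_add_abs_im _).trans (add_le_add (hfin _ ?_) (hfin _ ?_))
  · refine (hS N T hT2 (fun l => ht α * (A l).re) l).trans (Finset.sum_le_sum fun w _ => ?_)
    refine le_trans (le_of_eq ?_) (Complex.abs_re_le_norm _)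
    congr 1
    simp [Complex.re_sum, Finset.mul_sum, mul_assoc]
  · refine (hS N T hT2 (fun l => ht α * (A l).im) l).trans (Finset.sum_le_sum fun w _ => ?_)
    refine le_trans (le_of_eq ?_) (Complex.abs_im_le_norm _)
    congr 1
    simp [Complex.im_sum, Finset.mul_sum, mul_assoc]

end thmH
end MT
end partF10

section partF11
open NumberField Height Real Polynomial Filter
open scoped IntermediateField Topology

namespace MT

section thmH
variable {K : Type} [Field K] [NumberField K] {J s : ℕ}
variable {Qb : Type} [Field Qb] [CharZero Qb] [Algebra.IsAlgebraic ℚ Qb] [Algebra K Qb]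

lemma approx_err (P : Fin J → 𝓞 K) (c : Fin s → K) (α : Qb) (hα : 1 ≤ ht α) 
    (B B' : Fin J → ℂ) (A A' : Fin s → ℂ) (hB : ∑ j, B j = 0) (ε : ℝ) (hBB : ∀ j, ‖B j - B' j‖ ≤ ε) (hAA : ∀ l, ‖A l - A' l‖ ≤ ε)
    (N : Type) [Field N] [NumberField N] [Algebra K N] (φ : N →ₐ[K] Qb) (a : N) (ha : φ a = α)
    (T : Finset (FinitePlace N)) (hT : ∀ j, GoodT T (a - algebraMap K N (P j))) (hTc : ∀ l, GoodT T (algebraMap K N (c l)))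
    (hrel : ∀ w : Pl T, ∑ j, B' j * (log (pv T w (a - algebraMap K N (P j))) : ℂ) + ht α * ∑ l, A' l * (log (pv T w (algebraMap K N (c l))) : ℂ) = 0) 
    (hε : 0 ≤ ε) :
    ∑ w : Pl T, ‖∑ j, B j * (lam T w a (algebraMap K N (P j)) : ℂ) - ht α * ∑ l, A l * (log (pv T w (algebraMap K N (c l))) : ℂ)‖ ≤
      Module.finrank ℚ N * (ht α * (ε * (2 * ∑ j, (1 + log 2 + logHeight₁ (P j : K)) + 2 * ∑ l, logHeight₁ (c l)))) := by
  have hha : logHeight₁ a = Module.finrank ℚ N * ht α := by rw [← ha]; exact ht_eq (φ : N →+* Qb) a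
  have hsum := sum_abs_log_sub P a (ht α) hα hha T hT
  have hsumc : ∑ w : Pl T, ∑ l, |log (pv T w (algebraMap K N (c l)))| ≤ Module.finrank ℚ N * (2 * ∑ l, logHeight₁ (c l)) := by
    rw [Finset.sum_comm, Finset.mul_sum, Finset.mul_sum]
    refine Finset.sum_le_sum fun l _ => ?_
    rw [pl_sum_abs_log (hTc l), logHeight_ext]
    have : (Module.finrank K N : ℝ) * logHeight₁ (c l) ≤ Module.finrank ℚ N * logHeight₁ (c l) :=
      mul_le_mul_of_nonneg_right finrank_le_cast (zero_le_logHeight₁ _)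
    linarith
  have h0 : (0:ℝ) ≤ ht α := by linarith
  have hpt : ∀ w : Pl T, ‖∑ j, B j * (lam T w a (algebraMap K N (P j)) : ℂ) - ht α * ∑ l, A l * (log (pv T w (algebraMap K N (c l))) : ℂ)‖ ≤
      ε * ∑ j, |log (pv T w (a - algebraMap K N (P j)))| + ht α * (ε * ∑ l, |log (pv T w (algebraMap K N (c l)))|) := by
    intro w
    have e : ∑ j, B j * (lam T w a (algebraMap K N (P j)) : ℂ) - ht α * ∑ l, A l * (log (pv T w (algebraMap K N (c l))) : ℂ)
        = - ∑ j, (B j - B' j) * (log (pv T w (a - algebraMap K N (P j))) : ℂ) - ht α * ∑ l, (A l - A' l) * (log (pv T w (algebraMap K N (c l))) : ℂ) := by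
      have q := hrel w
      have q2 : ∑ j, B j * (log⁺ (pv T w a) : ℂ) = 0 := by rw [← Finset.sum_mul, hB, zero_mul]
      simp only [lam, Complex.ofReal_sub, mul_sub, sub_mul, Finset.sum_sub_distrib]
      linear_combination q2 - q
    rw [e]
    refine (norm_sub_le _ _).trans (add_le_add ?_ ?_)
    · rw [norm_neg, Finset.mul_sum]
      refine (norm_sum_le _ _).trans (Finset.sum_le_sum fun j _ => ?_)
      rw [norm_mul, Complex.norm_real, norm_eq_abs]
      exact mul_le_mul_of_nonneg_right (hBB j) (abs_nonneg _)
    · rw [norm_mul, Complex.norm_real, norm_eq_abs, abs_of_nonneg h0]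
      apply mul_le_mul_of_nonneg_left _ h0
      rw [Finset.mul_sum]
      refine (norm_sum_le _ _).trans (Finset.sum_le_sum fun j _ => ?_)
      rw [norm_mul, Complex.norm_real, norm_eq_abs]
      exact mul_le_mul_of_nonneg_right (hAA j) (abs_nonneg _)
  refine (Finset.sum_le_sum fun w _ => hpt w).trans ?_
  rw [Finset.sum_add_distrib, ← Finset.mul_sum, ← Finset.mul_sum, ← Finset.mul_sum]
  have q1 := mul_le_mul_of_nonneg_left hsum hε
  have q2 := mul_le_mul_of_nonneg_left (mul_le_mul_of_nonneg_left hsumc hε) h0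
  linarith

set_option maxHeartbeats 4000000 in
theorem thmH (P : Fin J → 𝓞 K) (hPinj : Function.Injective P) (c : Fin s → K) (hc : ∀ l, c l ≠ 0)
    (hind : ∀ a : Fin s → ℤ, ∏ i, c i ^ a i = 1 → a = 0) : ∃ H : ℝ, ∀ α : Qb, 
    (∀ j, α ≠ algebraMap K Qb (P j)) → ∀ β β' b b', Rels P c α β β' b b' → ht α ≤ H := by
  classical
  by_contra hcon
  push Not at hcon
  obtain ⟨C0, hdata⟩ := rel_data (Qb := Qb) P c hc hind
  choose α hαP β β' b b' hR hht using fun k : ℕ => hcon (k + 1)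
  have hα1 : ∀ k, 1 ≤ ht (α k) := fun k => by
    have := hht k
    have : (0:ℝ) ≤ k := Nat.cast_nonneg _
    linarith
  choose B A hB1 hB2 hB3 hA hid using fun k => hdata (α k) (hα1 k) (hαP k) _ _ _ _ (hR k)
  have hBn : ∀ k j, ‖B k j‖ ≤ 1 := fun k j => by
    have := Finset.single_le_sum (f := fun j => ‖B k j‖ ^ 2) (fun j _ => by positivity) (Finset.mem_univ j)
    rw [hB3] at this
    exact (sq_le_one_iff₀ (norm_nonneg _)).1 this
  obtain ⟨⟨Bl, Al⟩, -, ψ, hψ, hlim⟩ := tendsto_subseq_of_bounded (x := fun k => (B k, A k))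
    (Metric.isBounded_closedBall (x := (0 : (Fin J → ℂ) × (Fin s → ℂ))) (r := max 1 (max C0 0))) (by
      intro k
      rw [mem_closedBall_zero_iff, Prod.norm_def]
      apply max_le
      · exact (pi_norm_le_iff_of_nonneg (by positivity)).2 fun j => (hBn k j).trans (le_max_left _ _)
      · exact (pi_norm_le_iff_of_nonneg (by positivity)).2 fun j => (hA k j).trans ((le_max_left _ _).trans (le_max_right _ _)))
  have hlB : ∀ j, Tendsto (fun k => B (ψ k) j) atTop (𝓝 (Bl j)) := by
    have := (continuous_fst.tendsto (Bl, Al)).comp hlim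
    exact fun j => ((continuous_apply j).tendsto _).comp this
  have hlA : ∀ j, Tendsto (fun k => A (ψ k) j) atTop (𝓝 (Al j)) := by
    have := (continuous_snd.tendsto (Bl, Al)).comp hlim
    exact fun j => ((continuous_apply j).tendsto _).comp this
  have b1 : ∑ j, Bl j = 0 := by
    refine tendsto_nhds_unique (tendsto_finsetSum Finset.univ fun j _ => hlB j) ?_
    simp [hB1]
  have b2 : ∑ j, Bl j ^ 2 = 0 := by
    refine tendsto_nhds_unique (tendsto_finsetSum Finset.univ fun j _ => (hlB j).pow 2) ?_
    simp [hB2]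
  have b3 : ∑ j, ‖Bl j‖ ^ 2 = 1 := by
    refine tendsto_nhds_unique (tendsto_finsetSum Finset.univ fun j _ => (hlB j).norm.pow 2) ?_
    simp [hB3]
  obtain ⟨ε, hε, H0, n0, htwo⟩ := two_pt P hPinj Bl b1 b2 b3
  set C1 := 2 * ∑ j, (1 + log 2 + logHeight₁ (P j : K)) + 2 * ∑ l, logHeight₁ (c l) with hC1
  have hC10 : 0 ≤ C1 := by
    have hl2 := log_nonneg (by norm_num : (1:ℝ) ≤ 2)
    have q1 : 0 ≤ ∑ j, (1 + log 2 + logHeight₁ (P j : K)) := Finset.sum_nonneg fun j _ => by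
      have := zero_le_logHeight₁ (P j : K); positivity
    have q2 : 0 ≤ ∑ l, logHeight₁ (c l) := Finset.sum_nonneg fun j _ => zero_le_logHeight₁ _
    positivity
  set ε' := ε / (2 * C1 + 1) with hε'
  have hε'0 : 0 < ε' := by positivity
  have hclose : ∀ᶠ k in atTop, (∀ j, ‖Bl j - B (ψ k) j‖ ≤ ε') ∧ (∀ l, ‖Al l - A (ψ k) l‖ ≤ ε') := by
    rw [eventually_and, eventually_all, eventually_all]
    constructor
    · intro j
      filter_upwards [Metric.tendsto_nhds.1 (hlB j) ε' hε'0] with k hk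
      rw [dist_eq_norm, norm_sub_rev] at hk; exact hk.le
    · intro j
      filter_upwards [Metric.tendsto_nhds.1 (hlA j) ε' hε'0] with k hk
      rw [dist_eq_norm, norm_sub_rev] at hk; exact hk.le
  have hbig : Tendsto (fun k => ht (α (ψ k))) atTop atTop := by
    refine tendsto_atTop_mono (fun k => ?_) (tendsto_natCast_atTop_atTop (R := ℝ))
    have : (k:ℝ) ≤ ψ k := by exact_mod_cast hψ.id_le k
    linarith [hht (ψ k)]
  obtain ⟨k, ⟨hkB, hkA⟩, hkH⟩ := (hclose.and (hbig.eventually_ge_atTop H0)).exists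
  obtain ⟨k', ⟨hkB', hkA'⟩, hkn⟩ := (hclose.and (hbig.eventually_ge_atTop (n0 * ht (α (ψ k))))).exists
  set x := α (ψ k) with hx
  set x' := α (ψ k') with hx'
  have hx0 : 0 < ht x := by linarith [hα1 (ψ k)]
  have hx0' : 0 < ht x' := by linarith [hα1 (ψ k')]
  set n := ht x' / ht x with hn
  have hnh : n * ht x = ht x' := by rw [hn]; field_simp
  have hn0 : 0 < n := by positivity
  let N := IntermediateField.adjoin K ({x, x'} : Set Qb)
  have : NumberField N := numberField_adjoin _
  let a : N := ⟨x, IntermediateField.subset_adjoin K _ (by simp)⟩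
  let a' : N := ⟨x', IntermediateField.subset_adjoin K _ (by simp)⟩
  have ha : N.val a = x := rfl
  have ha' : N.val a' = x' := rfl
  have haP : ∀ j, a ≠ algebraMap K N (P j) := fun j h => by
    apply hαP (ψ k) j
    rw [← hx, ← ha, h, AlgHom.commutes]
  have haP' : ∀ j, a' ≠ algebraMap K N (P j) := fun j h => by
    apply hαP (ψ k') j
    rw [← hx', ← ha', h, AlgHom.commutes]
  refine htwo N a a' (ht x) n (ht_eq (N.val : N →+* Qb) a) (by rw [hnh]; exact ht_eq (N.val : N →+* Qb) a') hkH
    (by rw [hn, le_div_iff₀ hx0]; exact hkn) haP haP'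
    ((Finset.univ.image fun j => a - algebraMap K N (P j)) ∪ (Finset.univ.image fun j => a' - algebraMap K N (P j)) ∪ (Finset.univ.image fun l => algebraMap K N (c l))) ?_ ?_
  · intro z hz
    simp only [Finset.mem_union, Finset.mem_image, Finset.mem_univ, true_and] at hz
    rcases hz with (⟨j, rfl⟩ | ⟨j, rfl⟩) | ⟨l, rfl⟩
    · exact sub_ne_zero.2 (haP j)
    · exact sub_ne_zero.2 (haP' j)
    · simpa using hc l
  intro T hT
  have hT1 : ∀ j, GoodT T (a - algebraMap K N (P j)) := fun j => hT _ (by simp)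
  have hT1' : ∀ j, GoodT T (a' - algebraMap K N (P j)) := fun j => hT _ (by simp)
  have hT2 : ∀ l, GoodT T (algebraMap K N (c l)) := fun l => hT _ (by simp)
  have q1 := approx_err P c x (hα1 _) Bl (B (ψ k)) Al (A (ψ k)) b1 ε' hkB hkA N N.val a ha T hT1 hT2
    (fun w => hid (ψ k) N N.val a ha (pv T w)) hε'0.le
  have q2 := approx_err P c x' (hα1 _) Bl (B (ψ k')) Al (A (ψ k')) b1 ε' hkB' hkA' N N.val a' ha' T hT1' hT2
    (fun w => hid (ψ k') N N.val a' ha' (pv T w)) hε'0.le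
  rw [← hC1] at q1 q2
  have q3 : ∀ w : Pl T, ‖∑ j, Bl j * (lam T w a' (algebraMap K N (P j)) : ℂ) - n * ∑ j, Bl j * (lam T w a (algebraMap K N (P j)) : ℂ)‖ ≤
      ‖∑ j, Bl j * (lam T w a' (algebraMap K N (P j)) : ℂ) - ht x' * ∑ l, Al l * (log (pv T w (algebraMap K N (c l))) : ℂ)‖ +
      n * ‖∑ j, Bl j * (lam T w a (algebraMap K N (P j)) : ℂ) - ht x * ∑ l, Al l * (log (pv T w (algebraMap K N (c l))) : ℂ)‖ := by
    intro w
    have : n * ‖∑ j, Bl j * (lam T w a (algebraMap K N (P j)) : ℂ) - ht x * ∑ l, Al l * (log (pv T w (algebraMap K N (c l))) : ℂ)‖ =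
      ‖(n:ℂ) * (∑ j, Bl j * (lam T w a (algebraMap K N (P j)) : ℂ) - ht x * ∑ l, Al l * (log (pv T w (algebraMap K N (c l))) : ℂ))‖ := by
      rw [norm_mul, Complex.norm_real, norm_eq_abs, abs_of_pos hn0]
    rw [this]
    refine le_trans (le_of_eq ?_) (norm_sub_le _ _)
    congr 1
    rw [← hnh]; push_cast; ring
  refine (Finset.sum_le_sum fun w _ => q3 w).trans ?_
  rw [Finset.sum_add_distrib, ← Finset.mul_sum]
  have q4 := mul_le_mul_of_nonneg_left q1 hn0.le
  have q5 : 2 * (ε' * C1) ≤ ε := by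
    rw [hε', div_mul_eq_mul_div, mul_div_assoc', div_le_iff₀ (by positivity)]
    linarith
  have q6 : (Module.finrank ℚ N : ℝ) * (n * ht x) * (2 * (ε' * C1)) ≤ Module.finrank ℚ N * (n * ht x) * ε := by gcongr
  rw [← hnh] at q2
  rw [← hnh]
  linarith

end thmH
end MT
end partF11

section partG1
open NumberField Height Real
open scoped IntermediateField

namespace MT

section core
variable {K : Type} [Field K] [NumberField K] {J s : ℕ}
variable {Qb : Type} [Field Qb] [CharZero Qb] [Algebra.IsAlgebraic ℚ Qb] [Algebra K Qb]

theorem core1 (P : Fin J → 𝓞 K) (hPinj : Function.Injective P) (c : Fin s → K) (hc : ∀ l, c l ≠ 0)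
    (hind : ∀ a : Fin s → ℤ, ∏ i, c i ^ a i = 1 → a = 0) :
    {α : Qb | (∀ j, α ≠ algebraMap K Qb (P j)) ∧ ∃ β β' b b', Rels P c α β β' b b'}.Finite := by
  obtain ⟨H, hH⟩ := thmH (Qb := Qb) P hPinj c hc hind
  obtain ⟨Dmax, hD⟩ := caseA_bound (fun j => (P j : K)) (fun i j h => hPinj (RingOfIntegers.ext h)) c hc (max H 0) (le_max_right _ _)
  refine (northcott_Qb Qb (Module.finrank ℚ K * Dmax) H).subset ?_
  rintro α ⟨hαP, β, β', b, b', hR⟩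
  have hh := hH α hαP _ _ _ _ hR
  refine ⟨?_, hh⟩
  have : NumberField K⟮α⟯ := numberField_adjoin _
  set a : K⟮α⟯ := IntermediateField.AdjoinSimple.gen K α with ha
  have haα : (K⟮α⟯).val a = α := IntermediateField.AdjoinSimple.algebraMap_gen K α
  have haP : ∀ j, a ≠ algebraMap K K⟮α⟯ (P j) := fun j h => by
    apply hαP j
    rw [← haα, h, AlgHom.commutes]
  have htop : K⟮a⟯ = ⊤ := by
    apply IntermediateField.map_injective (K⟮α⟯).val
    rw [IntermediateField.adjoin_map, Set.image_singleton, haα, ← AlgHom.fieldRange_eq_map, IntermediateField.fieldRange_val]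
  obtain ⟨hnp, -, -, hr, hr'⟩ := hR
  have hfin := hD K⟮α⟯ a htop (by
    rw [ht_eq ((K⟮α⟯).val : K⟮α⟯ →+* Qb) a]
    gcongr
    exact le_trans (by rw [← haα] at hh; exact hh) (le_max_left _ _)) haP β β' b b' hnp
    (isRel_pull P c α β b hr _ (K⟮α⟯).val a haα) (isRel_pull P c α β' b' hr' _ (K⟮α⟯).val a haα)
  have hint : IsIntegral ℚ α := (Algebra.IsAlgebraic.isAlgebraic _).isIntegral
  rw [IntermediateField.adjoin.finrank hint]
  have e : minpoly ℚ α = minpoly ℚ a := by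
    exact minpoly.algHom_eq (((K⟮α⟯).val : K⟮α⟯ →+* Qb).toRatAlgHom) (RingHom.injective _) a
  rw [e]
  have := minpoly.natDegree_le (A := ℚ) a
  have hf : FiniteDimensional K K⟮α⟯ := FiniteDimensional.right ℚ K _
  rw [← Module.finrank_mul_finrank ℚ K K⟮α⟯] at this
  exact this.trans (Nat.mul_le_mul_left _ hfin)

end core
end MT
end partG1

section partG2
open NumberField Height Real
open scoped IntermediateField

namespace MT

section core2
variable {K : Type} [Field K] 

lemma indep_basis {κ : Type} [Fintype κ] (g : κ → K) (hg : ∀ i, g i ≠ 0) : ∃ (s : ℕ) (c : Fin s → K), (∀ l, c l ≠ 0) ∧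
    (∀ a : Fin s → ℤ, ∏ i, c i ^ a i = 1 → a = 0) ∧ ∃ M : ℤ, M ≠ 0 ∧ ∃ d : κ → Fin s → ℤ, ∀ i, g i ^ M = ∏ l, c l ^ d i l := by
  classical
  let v : κ → Additive Kˣ := fun i => Additive.ofMul (Units.mk0 (g i) (hg i))
  obtain ⟨S, hS, hmax⟩ := exists_maximal_linearIndepOn ℤ v
  let e := (Fintype.equivFin S).symm
  have key : ∀ {n : ℕ} (t : Fin n → κ) (a : Fin n → ℤ), ((Additive.toMul (∑ l, a l • v (t l)) : Kˣ) : K) = ∏ l, g (t l) ^ a l := by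
    intro n t a
    rw [toMul_sum, Units.coe_prod]
    refine Finset.prod_congr rfl fun l _ => ?_
    rw [toMul_zsmul]
    simp [v]
  refine ⟨Fintype.card S, fun l => g (e l), fun l => hg _, ?_, ?_⟩
  · intro a ha
    have hli : LinearIndependent ℤ (fun l => v (e l)) := (LinearIndependent.comp hS e e.injective)
    rw [Fintype.linearIndependent_iff] at hli
    funext l
    refine hli a ?_ l
    apply Additive.toMul.injective
    apply Units.ext
    rw [key (fun l => (e l : κ)) a, ha]; rfl
  · have h1 : ∀ i, ∃ a : ℤ, a ≠ 0 ∧ a • v i ∈ Submodule.span ℤ (v '' S) := by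
      intro i
      by_cases hi : i ∈ S
      · exact ⟨1, one_ne_zero, by rw [one_smul]; exact Submodule.subset_span ⟨i, hi, rfl⟩⟩
      · exact hmax i hi
    choose a ha0 ha using h1
    have hr : v '' S = Set.range (fun l => v (e l)) := by
      ext z
      constructor
      · rintro ⟨i, hi, rfl⟩
        exact ⟨e.symm ⟨i, hi⟩, by simp⟩
      · rintro ⟨l, rfl⟩
        exact ⟨e l, (e l).2, rfl⟩
    have h2 : ∀ i, ∃ d : Fin (Fintype.card S) → ℤ, ∑ l, d l • v (e l) = (∏ j, a j) • v i := by
      intro i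
      suffices hz : (∏ j, a j) • v i ∈ Submodule.span ℤ (Set.range (fun l => v (e l))) from
        (Submodule.mem_span_range_iff_exists_fun ℤ).1 hz
      rw [← hr, ← Finset.prod_erase_mul Finset.univ a (Finset.mem_univ i), mul_smul]
      exact Submodule.smul_mem _ _ (ha i)
    choose d hd using h2
    refine ⟨∏ j, a j, Finset.prod_ne_zero_iff.2 fun j _ => ha0 j, d, fun i => ?_⟩
    rw [← key (fun l => (e l : κ)) (d i), hd i, toMul_zsmul]
    simp [v]

variable [NumberField K] {Qb : Type} [Field Qb] [CharZero Qb] [Algebra.IsAlgebraic ℚ Qb] [Algebra K Qb]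

theorem core2 {ι κ : Type} [Fintype ι] [Fintype κ] (P : ι → 𝓞 K) (hPinj : Function.Injective P) (g : κ → K) (hg : ∀ l, g l ≠ 0) :
    {α : Qb | (∀ j, α ≠ algebraMap K Qb (P j)) ∧ ∃ (β β' : ι → ℤ) (b b' : κ → ℤ), NonProp β β' ∧ ∑ j, β j = 0 ∧ ∑ j, β' j = 0 ∧
      IsRel (fun j => α - algebraMap K Qb (P j)) (fun l => algebraMap K Qb (g l)) β b ∧
      IsRel (fun j => α - algebraMap K Qb (P j)) (fun l => algebraMap K Qb (g l)) β' b'}.Finite := by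
  classical
  obtain ⟨s, c, hc, hind, M, hM, d, hd⟩ := indep_basis g hg
  let e := (Fintype.equivFin ι).symm
  refine (core1 (Qb := Qb) (fun j => P (e j)) (hPinj.comp e.injective) c hc hind).subset ?_
  rintro α ⟨hα, β, β', b, b', ⟨i, j, hij⟩, hs, hs', hr, hr'⟩
  have key : ∀ (β : ι → ℤ) (b : κ → ℤ), IsRel (fun j => α - algebraMap K Qb (P j)) (fun l => algebraMap K Qb (g l)) β b →
      IsRel (fun j => α - algebraMap K Qb (P (e j))) (fun l => algebraMap K Qb (c l)) (fun j => M * β (e j)) (fun l => ∑ i, b i * d i l) := by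
    intro β b h
    unfold IsRel at *
    have h' := congrArg (fun z => z ^ M) h
    simp only [mul_zpow, one_zpow] at h'
    rw [← h']
    congr 1
    · rw [← Finset.prod_zpow, ← e.prod_comp]
      refine Finset.prod_congr rfl fun j _ => ?_
      change _ ^ (M * β (e j)) = _
      rw [mul_comm, zpow_mul]
    · rw [← Finset.prod_zpow]
      have e1 : ∀ i, (algebraMap K Qb (g i) ^ b i) ^ M = ∏ l, algebraMap K Qb (c l) ^ (b i * d i l) := by
        intro i
        rw [← zpow_mul, mul_comm, zpow_mul, ← map_zpow₀, hd i, map_prod, ← Finset.prod_zpow]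
        refine Finset.prod_congr rfl fun l _ => ?_
        rw [map_zpow₀, ← zpow_mul, mul_comm]
      rw [Finset.prod_congr rfl fun i _ => e1 i, Finset.prod_comm]
      refine Finset.prod_congr rfl fun l _ => ?_
      have hcl : algebraMap K Qb (c l) ≠ 0 := by simpa using hc l
      have : ∀ S : Finset κ, algebraMap K Qb (c l) ^ (∑ i ∈ S, b i * d i l) = ∏ i ∈ S, algebraMap K Qb (c l) ^ (b i * d i l) := by
        intro S
        induction S using Finset.induction_on with
        | empty => simp
        | insert x S hx ih => rw [Finset.sum_insert hx, Finset.prod_insert hx, zpow_add₀ hcl, ih]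
      exact this _
  refine ⟨fun j => hα _, _, _, _, _, ⟨e.symm i, e.symm j, ?_⟩, ?_, ?_, key β b hr, key β' b' hr'⟩
  · simp only [Equiv.apply_symm_apply]
    have : M * β i * (M * β' j) - M * β j * (M * β' i) = M ^ 2 * (β i * β' j - β j * β' i) := by ring
    rw [this]
    exact mul_ne_zero (pow_ne_zero _ hM) hij
  · rw [← Finset.mul_sum, e.sum_comp, hs, mul_zero]
  · rw [← Finset.mul_sum, e.sum_comp, hs', mul_zero]

end core2
end MT
end partG2

section partG3
open NumberField Height Real
open scoped IntermediateField

namespace MT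

section core3
lemma zpow_sum₀ {F : Type} [Field F] {x : F} (hx : x ≠ 0) {κ : Type} (S : Finset κ) (b : κ → ℤ) :
    x ^ (∑ i ∈ S, b i) = ∏ i ∈ S, x ^ b i := by
  classical
  induction S using Finset.induction_on with
  | empty => simp
  | insert a S ha ih => rw [Finset.sum_insert ha, Finset.prod_insert ha, zpow_add₀ hx, ih]

variable {K : Type} [Field K] [NumberField K] {Qb : Type} [Field Qb] [CharZero Qb] [Algebra.IsAlgebraic ℚ Qb] [Algebra K Qb]

theorem core3 {ι κ : Type} [Fintype ι] [Fintype κ] (ρ : ι → K) (hρ : Function.Injective ρ) (g : κ → K) (hg : ∀ l, g l ≠ 0) :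
    {α : Qb | (∀ j, α ≠ algebraMap K Qb (ρ j)) ∧ ∃ (β β' : ι → ℤ) (b b' : κ → ℤ), NonProp β β' ∧
      IsRel (fun j => α - algebraMap K Qb (ρ j)) (fun l => algebraMap K Qb (g l)) β b ∧
      IsRel (fun j => α - algebraMap K Qb (ρ j)) (fun l => algebraMap K Qb (g l)) β' b'}.Finite := by
  classical
  obtain ⟨r, hr⟩ := Infinite.exists_notMem_finset (Finset.univ.image ρ)
  have hr' : ∀ i, ρ i - r ≠ 0 := fun i h => hr (by simp only [Finset.mem_image, Finset.mem_univ, true_and]; exact ⟨i, sub_eq_zero.1 h⟩)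
  obtain ⟨⟨q, hq⟩, hq'⟩ := IsLocalization.exist_integer_multiples_of_finset (nonZeroDivisors (𝓞 K)) (Finset.univ.image fun i => (ρ i - r)⁻¹)
  have hq0 : (q : K) ≠ 0 := by simpa using nonZeroDivisors.ne_zero hq
  have hp : ∀ i, ∃ p : 𝓞 K, (p : K) = q * (ρ i - r)⁻¹ := fun i => by
    obtain ⟨p, hp⟩ := hq' ((ρ i - r)⁻¹) (by simp)
    exact ⟨p, by rw [RingOfIntegers.coe_eq_algebraMap, hp, Algebra.smul_def]⟩
  choose p hp using hp
  let P : Option ι → 𝓞 K := fun o => o.elim 0 p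
  have hp0 : ∀ i, p i ≠ 0 := fun i h => by
    have := hp i
    rw [h] at this
    have h2 : (q:K) * (ρ i - r)⁻¹ ≠ 0 := mul_ne_zero hq0 (inv_ne_zero (hr' i))
    exact h2 (by rw [← this]; simp)
  have hPinj : Function.Injective P := by
    intro x y hxy
    rcases x with _ | i <;> rcases y with _ | j
    · rfl
    · exact absurd hxy.symm (hp0 j)
    · exact absurd hxy (hp0 i)
    · have h1 : p i = p j := hxy
      have h2 : (q:K) * (ρ i - r)⁻¹ = q * (ρ j - r)⁻¹ := by rw [← hp, ← hp, h1]
      have h3 := inv_injective (mul_left_cancel₀ hq0 h2)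
      rw [hρ (sub_left_injective h3)]
  let g' : κ ⊕ ι → K := Sum.elim g (fun i => r - ρ i)
  have hg' : ∀ l, g' l ≠ 0 := by
    rintro (l | i)
    · exact hg l
    · exact fun h => hr' i (by simp only [g', Sum.elim_inr] at h; linear_combination -h)
  have hfin := core2 (Qb := Qb) P hPinj g' hg'
  set Q := algebraMap K Qb q with hQ
  set R := algebraMap K Qb r with hR
  have hQ0 : Q ≠ 0 := by simpa [hQ] using hq0
  let Y : Qb → Qb := fun α => Q * (α - R)⁻¹
  have hYinj : Function.Injective Y := fun x y h => sub_left_injective (inv_injective (mul_left_cancel₀ hQ0 h))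
  refine ((Set.finite_singleton R).union (hfin.preimage hYinj.injOn)).subset ?_
  rintro α ⟨hα, β, β', b, b', ⟨i0, j0, hij⟩, hrel, hrel'⟩
  by_cases hαR : α = R
  · exact Or.inl hαR
  right
  have hαR' : α - R ≠ 0 := sub_ne_zero.2 hαR
  have hY0 : Y α ≠ 0 := mul_ne_zero hQ0 (inv_ne_zero hαR')
  have hPi : ∀ i, algebraMap K Qb (P (some i)) = Q * (algebraMap K Qb (ρ i) - R)⁻¹ := fun i => by
    change algebraMap K Qb (p i) = _
    rw [hp, map_mul, map_inv₀, map_sub]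
  have hρR : ∀ i, algebraMap K Qb (ρ i) - R ≠ 0 := fun i => by
    rw [hR, ← map_sub]; exact (map_ne_zero _).2 (hr' i)
  have hfac : ∀ i, α - algebraMap K Qb (ρ i) = (Y α)⁻¹ * (Y α - algebraMap K Qb (P (some i))) * (R - algebraMap K Qb (ρ i)) := by
    intro i
    rw [hPi]
    have h1 := hρR i
    simp only [Y]
    field_simp
    ring
  have hYP : ∀ i, Y α - algebraMap K Qb (P (some i)) ≠ 0 := fun i h => by
    have := hfac i
    rw [h] at this
    exact hα i (sub_eq_zero.1 (by rw [this]; ring))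
  have key : ∀ (β : ι → ℤ) (b : κ → ℤ), IsRel (fun j => α - algebraMap K Qb (ρ j)) (fun l => algebraMap K Qb (g l)) β b →
      IsRel (fun j => Y α - algebraMap K Qb (P j)) (fun l => algebraMap K Qb (g' l)) (fun o => o.elim (- ∑ i, β i) β) (Sum.elim b β) := by
    intro β b h
    unfold IsRel at *
    rw [Fintype.prod_option, Fintype.prod_sum_type]
    simp only [Option.elim, Sum.elim_inl, Sum.elim_inr, g', map_sub]
    have e0 : algebraMap K Qb (P none) = 0 := by change algebraMap K Qb ((0 : 𝓞 K) : K) = 0; simp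
    rw [e0, sub_zero, ← Finset.sum_neg_distrib, zpow_sum₀ hY0, ← h]
    have e1 : ∏ j, (α - algebraMap K Qb (ρ j)) ^ β j = (∏ j, Y α ^ (- β j)) * (∏ j, (Y α - algebraMap K Qb (P (some j))) ^ β j) * ∏ j, (R - algebraMap K Qb (ρ j)) ^ β j := by
      rw [← Finset.prod_mul_distrib, ← Finset.prod_mul_distrib]
      refine Finset.prod_congr rfl fun j _ => ?_
      rw [hfac j, mul_zpow, mul_zpow, inv_zpow', zpow_neg]
    rw [e1]
    ring
  refine ⟨?_, _, _, _, _, ⟨some i0, some j0, ?_⟩, ?_, ?_, key β b hrel, key β' b' hrel'⟩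
  · rintro (_ | i)
    · change Y α ≠ algebraMap K Qb ((0 : 𝓞 K) : K); simpa using hY0
    · exact sub_ne_zero.1 (hYP i)
  · exact hij
  · rw [Fintype.sum_option]; simp
  · rw [Fintype.sum_option]; simp

end core3
end MT
end partG3

section partG4
open NumberField Height Real Polynomial
open scoped IntermediateField

namespace MT

section final

lemma IsRel.comb_field {E : Type} [Field E] {J L : Type} [Fintype J] [Fintype L] {x : J → E} {c : L → E} (hx : ∀ j, x j ≠ 0) (hc : ∀ l, c l ≠ 0)
    {β β' : J → ℤ} {a a' : L → ℤ} (h : IsRel x c β a) (h' : IsRel x c β' a') (m n : ℤ) :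
    IsRel x c (fun j => m * β j + n * β' j) (fun l => m * a l + n * a' l) := by
  unfold IsRel at *
  have e1 : ∏ j, x j ^ (m * β j + n * β' j) = (∏ j, x j ^ β j) ^ m * (∏ j, x j ^ β' j) ^ n := by
    rw [← Finset.prod_zpow, ← Finset.prod_zpow, ← Finset.prod_mul_distrib]
    refine Finset.prod_congr rfl fun j _ => ?_
    rw [zpow_add₀ (hx j), mul_comm m, mul_comm n, zpow_mul, zpow_mul]
  have e2 : ∏ l, c l ^ (m * a l + n * a' l) = (∏ l, c l ^ a l) ^ m * (∏ l, c l ^ a' l) ^ n := by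
    rw [← Finset.prod_zpow, ← Finset.prod_zpow, ← Finset.prod_mul_distrib]
    refine Finset.prod_congr rfl fun j _ => ?_
    rw [zpow_add₀ (hc j), mul_comm m, mul_comm n, zpow_mul, zpow_mul]
  rw [e1, e2]
  calc _ = ((∏ j, x j ^ β j) * (∏ l, c l ^ a l)) ^ m * ((∏ j, x j ^ β' j) * (∏ l, c l ^ a' l)) ^ n := by
        rw [mul_zpow, mul_zpow]; ring
    _ = 1 := by rw [h, h', one_zpow, one_zpow, one_mul]

variable {K : Type} [Field K] [NumberField K] {Qb : Type} [Field Qb] [CharZero Qb] [Algebra.IsAlgebraic ℚ Qb] [Algebra K Qb]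
  [IsAlgClosed Qb]

lemma eval_fac [DecidableEq Qb] (p : K[X]) (R : Finset Qb) (hR : ∀ x ∈ p.aroots Qb, x ∈ R) (α : Qb) :
    eval₂ (algebraMap K Qb) α p = algebraMap K Qb p.leadingCoeff * ∏ x ∈ R, (α - x) ^ (p.aroots Qb).count x := by
  have h := (IsAlgClosed.splits (p.map (algebraMap K Qb))).aeval_eq_prod_aroots α
  rw [aeval_def] at h
  rw [h]
  congr 1
  rw [Finset.prod_multiset_map_count]
  refine Finset.prod_subset (fun x hx => hR x (Multiset.mem_toFinset.1 hx)) fun x _ hx => ?_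
  rw [Multiset.mem_toFinset] at hx
  rw [Multiset.count_eq_zero_of_notMem hx, pow_zero]

lemma ratfunc_one {m : ℕ} (f : Fin m → RatFunc K) (hf : ∀ i, f i ≠ 0) (R : Finset Qb) (k : Fin m → ℤ)
    (h : ∀ α ∉ R, (∀ i, eval₂ (algebraMap K Qb) α (f i).num ≠ 0) ∧ (∀ i, eval₂ (algebraMap K Qb) α (f i).denom ≠ 0) ∧
      ∏ i, (eval₂ (algebraMap K Qb) α (f i).num / eval₂ (algebraMap K Qb) α (f i).denom) ^ k i = 1) :
    ∏ i, f i ^ k i = 1 := by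
  classical
  have hk : ∀ i, k i = ((k i).toNat : ℤ) - ((- k i).toNat : ℤ) := fun i => by omega
  have gen : ∀ {F : Type} [Field F] (a b : Fin m → F), (∀ i, a i ≠ 0) → (∀ i, b i ≠ 0) →
      (∏ i, (a i / b i) ^ k i = 1 ↔ ∏ i, (a i ^ (k i).toNat * b i ^ (- k i).toNat) = ∏ i, (b i ^ (k i).toNat * a i ^ (- k i).toNat)) := by
    intro F _ a b ha hb
    have e : ∏ i, (a i / b i) ^ k i = (∏ i, (a i ^ (k i).toNat * b i ^ (- k i).toNat)) / ∏ i, (b i ^ (k i).toNat * a i ^ (- k i).toNat) := by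
      rw [← Finset.prod_div_distrib]
      refine Finset.prod_congr rfl fun i _ => ?_
      have h1 := ha i
      have h2 := hb i
      conv_lhs => rw [hk i]
      rw [zpow_sub₀ (div_ne_zero h1 h2), zpow_natCast, zpow_natCast, div_pow, div_pow]
      field_simp
    rw [e, div_eq_one_iff_eq]
    exact Finset.prod_ne_zero_iff.2 fun i _ => mul_ne_zero (pow_ne_zero _ (hb i)) (pow_ne_zero _ (ha i))
  have hnum : ∀ i, algebraMap K[X] (RatFunc K) (f i).num ≠ 0 := fun i => by
    simpa using RatFunc.num_ne_zero (hf i)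
  have hden : ∀ i, algebraMap K[X] (RatFunc K) (f i).denom ≠ 0 := fun i => by
    simpa using RatFunc.denom_ne_zero (f i)
  have hpoly : ∏ i, ((f i).num ^ (k i).toNat * (f i).denom ^ (- k i).toNat) = ∏ i, ((f i).denom ^ (k i).toNat * (f i).num ^ (- k i).toNat) := by
    apply Polynomial.map_injective (algebraMap K Qb) (algebraMap K Qb).injective
    refine Polynomial.eq_of_infinite_eval_eq _ _ ((R.finite_toSet.infinite_compl).mono ?_)
    intro α hα
    obtain ⟨h1, h2, h3⟩ := h α hα
    rw [gen _ _ h1 h2] at h3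
    simp only [Set.mem_ofPred_eq, eval_map, eval₂_finsetProd, eval₂_mul, eval₂_pow]
    exact h3
  have := (gen (fun i => algebraMap K[X] (RatFunc K) (f i).num) (fun i => algebraMap K[X] (RatFunc K) (f i).denom) hnum hden).2 (by
    have := congrArg (algebraMap K[X] (RatFunc K)) hpoly
    simpa only [map_prod, map_mul, map_pow] using this)
  simpa only [RatFunc.num_div_denom] using this

theorem main (m : ℕ) (f : Fin m → RatFunc K) (hf : ∀ i, f i ≠ 0)
    (hindep : ∀ k : Fin m → ℤ, (∏ i, (f i) ^ (k i)) = 1 → k = 0) :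
    Set.Finite {α : Qb |
      (∀ i, Polynomial.eval₂ (algebraMap K Qb) α (f i).denom ≠ 0 ∧ RatFunc.eval (algebraMap K Qb) α (f i) ≠ 0) ∧
      ∃ k l : Fin m → ℤ, LinearIndependent ℤ ![k, l] ∧
        (∏ i, (RatFunc.eval (algebraMap K Qb) α (f i)) ^ (k i)) = 1 ∧
        (∏ i, (RatFunc.eval (algebraMap K Qb) α (f i)) ^ (l i)) = 1} := by
  classical
  let R : Finset Qb := Finset.univ.biUnion fun i => ((f i).num.aroots Qb).toFinset ∪ ((f i).denom.aroots Qb).toFinset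
  have hRn : ∀ i, ∀ x ∈ (f i).num.aroots Qb, x ∈ R := fun i x hx => by
    simp only [R, Finset.mem_biUnion, Finset.mem_univ, true_and, Finset.mem_union, Multiset.mem_toFinset]
    exact ⟨i, Or.inl hx⟩
  have hRd : ∀ i, ∀ x ∈ (f i).denom.aroots Qb, x ∈ R := fun i x hx => by
    simp only [R, Finset.mem_biUnion, Finset.mem_univ, true_and, Finset.mem_union, Multiset.mem_toFinset]
    exact ⟨i, Or.inr hx⟩
  have hRiff : ∀ x ∈ R, ∃ i, eval₂ (algebraMap K Qb) x (f i).num = 0 ∨ eval₂ (algebraMap K Qb) x (f i).denom = 0 := by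
    intro x hx
    simp only [R, Finset.mem_biUnion, Finset.mem_univ, true_and, Finset.mem_union, Multiset.mem_toFinset, mem_aroots', aeval_def] at hx
    obtain ⟨i, h | h⟩ := hx
    · exact ⟨i, Or.inl h.2⟩
    · exact ⟨i, Or.inr h.2⟩
  let L := IntermediateField.adjoin K (R : Set Qb)
  have : NumberField L := numberField_adjoin _
  let ρ : R → L := fun x => ⟨x, IntermediateField.subset_adjoin K _ x.2⟩
  have hρ : Function.Injective ρ := fun x y h => by
    have := congrArg Subtype.val h
    exact Subtype.ext this
  have hρα : ∀ x : R, algebraMap L Qb (ρ x) = x := fun x => rfl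
  let g : Fin m → L := fun i => algebraMap K L ((f i).num.leadingCoeff / (f i).denom.leadingCoeff)
  have hg : ∀ i, g i ≠ 0 := fun i => by
    simp only [g, ne_eq, map_eq_zero, div_eq_zero_iff, leadingCoeff_eq_zero, not_or]
    exact ⟨RatFunc.num_ne_zero (hf i), RatFunc.denom_ne_zero _⟩
  have hgα : ∀ i, algebraMap L Qb (g i) = algebraMap K Qb (f i).num.leadingCoeff / algebraMap K Qb (f i).denom.leadingCoeff := fun i => by
    simp only [g]
    rw [← IsScalarTower.algebraMap_apply K L Qb, map_div₀]
  have hgα0 : ∀ i, algebraMap L Qb (g i) ≠ 0 := fun i => (_root_.map_ne_zero _).2 (hg i)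
  let e : Fin m → R → ℤ := fun i x => (((f i).num.aroots Qb).count (x : Qb) : ℤ) - (((f i).denom.aroots Qb).count (x : Qb) : ℤ)
  have hev : ∀ α ∉ R, ∀ i, eval₂ (algebraMap K Qb) α (f i).num / eval₂ (algebraMap K Qb) α (f i).denom =
      algebraMap L Qb (g i) * ∏ x : R, (α - algebraMap L Qb (ρ x)) ^ e i x := by
    intro α hα i
    rw [eval_fac _ R (hRn i), eval_fac _ R (hRd i), hgα, mul_div_mul_comm, ← Finset.prod_div_distrib]
    congr 1
    rw [← Finset.prod_coe_sort R]
    refine Finset.prod_congr rfl fun x _ => ?_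
    rw [hρα, zpow_sub₀, zpow_natCast, zpow_natCast]
    intro h0
    exact hα (by rw [sub_eq_zero.1 h0]; exact x.2)
  have hne : ∀ α ∉ R, (∀ i, eval₂ (algebraMap K Qb) α (f i).num ≠ 0) ∧ (∀ i, eval₂ (algebraMap K Qb) α (f i).denom ≠ 0) := by
    intro α hα
    constructor
    · intro i h0
      refine hα (hRn i α ?_)
      rw [mem_aroots, aeval_def]
      exact ⟨RatFunc.num_ne_zero (hf i), h0⟩
    · intro i h0
      refine hα (hRd i α ?_)
      rw [mem_aroots, aeval_def]
      exact ⟨RatFunc.denom_ne_zero _, h0⟩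
  let bt : (Fin m → ℤ) → R → ℤ := fun k x => ∑ i, k i * e i x
  have hx0 : ∀ α ∉ R, ∀ x : R, α - algebraMap L Qb (ρ x) ≠ 0 := fun α hα x h0 => hα (by rw [sub_eq_zero.1 h0]; exact x.2)
  have hprod : ∀ α ∉ R, ∀ k : Fin m → ℤ, ∏ i, (eval₂ (algebraMap K Qb) α (f i).num / eval₂ (algebraMap K Qb) α (f i).denom) ^ k i =
      (∏ x : R, (α - algebraMap L Qb (ρ x)) ^ bt k x) * ∏ i, algebraMap L Qb (g i) ^ k i := by
    intro α hα k
    have h1 : ∀ x : R, (α - algebraMap L Qb (ρ x)) ^ bt k x = ∏ i, (α - algebraMap L Qb (ρ x)) ^ (k i * e i x) := fun x =>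
      zpow_sum₀ (hx0 α hα x) _ _
    rw [Finset.prod_congr rfl fun x _ => h1 x, Finset.prod_comm, ← Finset.prod_mul_distrib]
    refine Finset.prod_congr rfl fun i _ => ?_
    rw [hev α hα i, mul_zpow, mul_comm, ← Finset.prod_zpow]
    congr 1
    refine Finset.prod_congr rfl fun x _ => ?_
    rw [← zpow_mul, mul_comm]
  have hconst : ∀ k : Fin m → ℤ, bt k = 0 → ∏ i, algebraMap L Qb (g i) ^ k i = 1 → k = 0 := by
    intro k h1 h2
    refine hindep k (ratfunc_one f hf R k fun α hα => ⟨(hne α hα).1, (hne α hα).2, ?_⟩)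
    rw [hprod α hα, h1, h2]
    simp
  refine (core3 (Qb := Qb) ρ hρ g hg).subset ?_
  rintro α ⟨hα, k, l, hkl, hk, hl⟩
  have hαR : α ∉ R := by
    intro h
    obtain ⟨i, h0 | h0⟩ := hRiff α h
    · exact (hα i).2 (by rw [RatFunc.eval, h0, zero_div])
    · exact (hα i).1 h0
  simp only [RatFunc.eval] at hk hl
  have hk' := hk
  have hl' := hl
  rw [hprod α hαR] at hk hl
  refine ⟨fun x => sub_ne_zero.1 (hx0 α hαR x), bt k, bt l, k, l, ?_, hk, hl⟩
  have hcomb : ∀ p q : ℤ, (∀ x, p * bt k x + q * bt l x = 0) → p = 0 ∧ q = 0 := by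
    intro p q hpq
    have h3 := IsRel.comb_field (hx0 α hαR) hgα0 hk hl p q
    unfold IsRel at h3
    simp only [hpq, zpow_zero, Finset.prod_const_one, one_mul] at h3
    have h4 := hconst (fun i => p * k i + q * l i) (by
      funext x
      have := hpq x
      simp only [bt, Finset.mul_sum] at this ⊢
      rw [← Finset.sum_add_distrib] at this
      rw [Pi.zero_apply, ← this]
      refine Finset.sum_congr rfl fun i _ => by ring) h3
    rw [LinearIndependent.pair_iff] at hkl
    refine hkl p q ?_
    funext i
    exact congrFun h4 i
  by_contra hnp
  unfold NonProp at hnp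
  push Not at hnp
  by_cases hz : ∀ x, bt k x = 0
  · have := (hcomb 1 0 (fun x => by rw [hz x]; ring)).1
    exact one_ne_zero this
  · push Not at hz
    obtain ⟨x0, hx0'⟩ := hz
    have := (hcomb (bt l x0) (- bt k x0) (fun x => by linarith [hnp x x0])).2
    exact hx0' (neg_eq_zero.1 this)

end final
end MT
end partG4

open Polynomial

/-- Effective Maurin theorem: for multiplicatively independent non-zero rational functions
`f₁, …, f_m` over a number field `𝕂` (embedded in `ℚ̄` via `σ`), the set of `α ∈ ℚ̄`
(not a zero or pole of any `fᵢ`) satisfying two independent multiplicative relations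
among the values `fᵢ(α)` is finite. -/
theorem stmt_11 (K : Type) [Field K] [NumberField K] (σ : K →+* AlgebraicClosure ℚ)
    (m : ℕ) (f : Fin m → RatFunc K) (hf : ∀ i, f i ≠ 0)
    (hindep : ∀ k : Fin m → ℤ, (∏ i, (f i) ^ (k i)) = 1 → k = 0) :
    Set.Finite {α : AlgebraicClosure ℚ |
      (∀ i, Polynomial.eval₂ σ α (f i).denom ≠ 0 ∧ RatFunc.eval σ α (f i) ≠ 0) ∧
      ∃ k l : Fin m → ℤ, LinearIndependent ℤ ![k, l] ∧
        (∏ i, (RatFunc.eval σ α (f i)) ^ (k i)) = 1 ∧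
        (∏ i, (RatFunc.eval σ α (f i)) ^ (l i)) = 1} := by
  letI : Algebra K (AlgebraicClosure ℚ) := σ.toAlgebra
  have e : (AlgebraicClosure.instAlgebra ℚ : Algebra ℚ (AlgebraicClosure ℚ)) = DivisionRing.toRatAlgebra := Subsingleton.elim _ _
  haveI : @Algebra.IsAlgebraic ℚ (AlgebraicClosure ℚ) _ _ DivisionRing.toRatAlgebra := by
    rw [← e]; infer_instance
  exact MT.main m f hf hindep
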